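/- Let N ≥ 3 be an integer and let p ≥ q > 0 with pq > 1. Assume that N/(p+1) + N/(q+1) > N−2 and that 2(p+1)/(pq−1) > N−3. Let γ ∈ (0,1] and C₁, C₂ > 0. Then there exists a constant C > 0, depending only on γ, C₁, C₂, p, q, N, such that the following holds: if c, d are γ-Hölder continuous functions on the closed unit ball B̄₁ ⊂ ℝ^N with ‖c‖_{C^γ(B̄₁)} ≤ C₁, ‖d‖_{C^γ(B̄₁)} ≤ C₁, c(x) ≥ C₂ and d(x) ≥ C₂ for all x ∈ B̄₁, and if (u, v) is a pair of nonnegative twice continuously differentiable functions on the open unit ball B₁ satisfying −Δu(x) = c(x) v(x)^p and −Δv(x) = d(x) u(x)^q for all x ∈ B₁, then for every x ∈ B₁: u(x)^{1/α} + v(x)^{1/β} + |∇u(x)|^{1/(α+1)} + |∇v(x)|^{1/(β+1)} ≤ C ( 1 + dist(x, ∂B₁)^{−1} ). -/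

import Mathlib

open MeasureTheory Metric Set Filter

/-- The Euclidean Laplacian of `u : ℝ^N → ℝ`, as the sum of the second derivatives
along the standard coordinate directions. -/
noncomputable def lap {N : ℕ} (u : EuclideanSpace ℝ (Fin N) → ℝ)
    (x : EuclideanSpace ℝ (Fin N)) : ℝ :=
  ∑ i : Fin N, iteratedFDeriv ℝ 2 u x ![EuclideanSpace.single i 1, EuclideanSpace.single i 1]

/-- `(u, v)` is a positive solution of the Hardy–Hénon system
`-Δu = |x|^a v^p`, `-Δv = |x|^b u^q` on the set `Ω`:
`u, v` are continuous on `Ω`, `C²` on `Ω \ {0}`, positive on `Ω`, and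
the equations hold on `Ω \ {0}`. -/
def IsHHSol {N : ℕ} (a b p q : ℝ) (Ω : Set (EuclideanSpace ℝ (Fin N)))
    (u v : EuclideanSpace ℝ (Fin N) → ℝ) : Prop :=
  ContinuousOn u Ω ∧ ContinuousOn v Ω ∧
  ContDiffOn ℝ 2 u (Ω \ {0}) ∧ ContDiffOn ℝ 2 v (Ω \ {0}) ∧
  (∀ x ∈ Ω, 0 < u x) ∧ (∀ x ∈ Ω, 0 < v x) ∧
  (∀ x ∈ Ω \ {0}, -lap u x = ‖x‖ ^ a * v x ^ p) ∧
  (∀ x ∈ Ω \ {0}, -lap v x = ‖x‖ ^ b * u x ^ q)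

/-- Partial derivative in the `i`-th standard coordinate direction. -/
noncomputable def pd {N : ℕ} (i : Fin N) (u : EuclideanSpace ℝ (Fin N) → ℝ)
    (x : EuclideanSpace ℝ (Fin N)) : ℝ :=
  fderiv ℝ u x (EuclideanSpace.single i 1)

section PartialDerivatives

variable {N : ℕ} {u ψ : EuclideanSpace ℝ (Fin N) → ℝ}

theorem pd_contDiff (hu : ContDiff ℝ 2 u) (i : Fin N) : ContDiff ℝ 1 (pd i u) :=
  (hu.fderiv_right (m := 1) (by norm_num)).clm_apply contDiff_const

theorem pd_continuous (hu : ContDiff ℝ 1 u) (i : Fin N) : Continuous (pd i u) :=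
  ((hu.fderiv_right (m := 0) (by norm_num)).clm_apply contDiff_const).continuous

theorem pd_pd_eq (hu : ContDiff ℝ 2 u) (i j : Fin N) (x : EuclideanSpace ℝ (Fin N)) :
    pd i (pd j u) x = fderiv ℝ (fderiv ℝ u) x (EuclideanSpace.single i 1)
      (EuclideanSpace.single j 1) := by
  have h : DifferentiableAt ℝ (fderiv ℝ u) x :=
    ((hu.fderiv_right (m := 1) (by norm_num)).differentiable (by norm_num)) x
  unfold pd
  rw [fderiv_clm_apply h (differentiableAt_const _)]
  simp

theorem pd_comm (hu : ContDiff ℝ 2 u) (i j : Fin N) (x : EuclideanSpace ℝ (Fin N)) :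
    pd i (pd j u) x = pd j (pd i u) x := by
  rw [pd_pd_eq hu, pd_pd_eq hu]
  exact (hu.contDiffAt.isSymmSndFDerivAt (by simp)) _ _

theorem lap_eq_sum_pd (hu : ContDiff ℝ 2 u) (x : EuclideanSpace ℝ (Fin N)) :
    lap u x = ∑ i, pd i (pd i u) x := by
  simp only [lap, pd_pd_eq hu, iteratedFDeriv_two_apply]
  simp

theorem lap_continuous (hu : ContDiff ℝ 2 u) : Continuous (lap u) := by
  have : lap u = fun x => ∑ i, pd i (pd i u) x := funext (lap_eq_sum_pd hu)
  rw [this]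
  exact continuous_finsetSum _ fun i _ => pd_continuous (pd_contDiff hu i) i

theorem pd_hasCompactSupport (hψ : HasCompactSupport ψ) (i : Fin N) :
    HasCompactSupport (pd i ψ) :=
  (hψ.fderiv ℝ).mono (fun x hx => by
    simp only [Function.mem_support, pd] at hx ⊢
    intro h; exact hx (by rw [h]; rfl))

theorem integral_mul_pd (hu : ContDiff ℝ 1 u) (hψ : ContDiff ℝ 1 ψ)
    (hc : HasCompactSupport ψ) (i : Fin N) :
    ∫ x, u x * pd i ψ x = -∫ x, pd i u x * ψ x := by
  refine integral_mul_fderiv_eq_neg_fderiv_mul_of_integrable ?_ ?_ ?_ ?_ ?_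
  · exact ((pd_continuous hu i).mul hψ.continuous).integrable_of_hasCompactSupport hc.mul_left
  · exact (hu.continuous.mul (pd_continuous hψ i)).integrable_of_hasCompactSupport
      (pd_hasCompactSupport hc i).mul_left
  · exact (hu.continuous.mul hψ.continuous).integrable_of_hasCompactSupport hc.mul_left
  · exact fun x _ => hu.differentiable (by norm_num) x
  · exact fun x _ => hψ.differentiable (by norm_num) x

theorem integral_lap_mul (hu : ContDiff ℝ 2 u) (hψ : ContDiff ℝ 2 ψ)
    (hc : HasCompactSupport ψ) :
    ∫ x, lap u x * ψ x = ∫ x, u x * lap ψ x := by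
  have h1 : ContDiff ℝ 1 u := hu.of_le (by norm_num)
  have h2 : ContDiff ℝ 1 ψ := hψ.of_le (by norm_num)
  simp only [lap_eq_sum_pd hu, lap_eq_sum_pd hψ, Finset.sum_mul, Finset.mul_sum]
  rw [integral_finsetSum, integral_finsetSum]
  · refine Finset.sum_congr rfl fun i _ => ?_
    rw [integral_mul_pd h1 (pd_contDiff hψ i) (pd_hasCompactSupport hc i),
      integral_mul_pd (pd_contDiff hu i) h2 hc, neg_neg]
  · exact fun i _ => (hu.continuous.mul
      (pd_continuous (pd_contDiff hψ i) i)).integrable_of_hasCompactSupport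
        (pd_hasCompactSupport (pd_hasCompactSupport hc i) i).mul_left
  · exact fun i _ => ((pd_continuous (pd_contDiff hu i) i).mul
      hψ.continuous).integrable_of_hasCompactSupport hc.mul_left

theorem integral_lap_mul_pd (hu : ContDiff ℝ 2 u) (hψ : ContDiff ℝ 2 ψ)
    (hc : HasCompactSupport ψ) (i : Fin N) :
    ∫ x, lap u x * pd i ψ x = -∫ x, pd i u x * lap ψ x := by
  have h1 : ContDiff ℝ 1 u := hu.of_le (by norm_num)
  have h2 : ContDiff ℝ 1 ψ := hψ.of_le (by norm_num)
  simp only [lap_eq_sum_pd hu, lap_eq_sum_pd hψ, Finset.sum_mul, Finset.mul_sum]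
  rw [integral_finsetSum, integral_finsetSum, ← Finset.sum_neg_distrib]
  · refine Finset.sum_congr rfl fun j _ => ?_
    have e1 := integral_mul_pd (pd_contDiff hu j) (pd_contDiff hψ i)
      (pd_hasCompactSupport hc i) j
    have e2 := integral_mul_pd (pd_contDiff hu j) (pd_contDiff hψ j)
      (pd_hasCompactSupport hc j) i
    have e3 := integral_mul_pd (pd_contDiff hu i) (pd_contDiff hψ j)
      (pd_hasCompactSupport hc j) j
    have e4 : ∫ x, pd j u x * pd j (pd i ψ) x = ∫ x, pd j u x * pd i (pd j ψ) x :=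
      integral_congr_ae (ae_of_all _ fun x => by simp only [pd_comm hψ i j])
    have e5 : ∫ x, pd i (pd j u) x * pd j ψ x = ∫ x, pd j (pd i u) x * pd j ψ x :=
      integral_congr_ae (ae_of_all _ fun x => by simp only [pd_comm hu i j])
    linarith
  · exact fun j _ => ((pd_continuous h1 i).mul
      (pd_continuous (pd_contDiff hψ j) j)).integrable_of_hasCompactSupport
        (pd_hasCompactSupport (pd_hasCompactSupport hc j) j).mul_left
  · exact fun j _ => ((pd_continuous (pd_contDiff hu j) j).mul
      (pd_continuous h2 i)).integrable_of_hasCompactSupport (pd_hasCompactSupport hc i).mul_left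

end PartialDerivatives

section TruncatedKernel

/-- `τ ^ (-m)` minus its third order Taylor polynomial at `1`. -/
noncomputable def taylorTail (m τ : ℝ) : ℝ :=
  τ ^ (-m) - (1 + m * (1 - τ) + m * (m + 1) / 2 * (1 - τ) ^ 2
    + m * (m + 1) * (m + 2) / 6 * (1 - τ) ^ 3)

/-- First derivative of `taylorTail`. -/
noncomputable def taylorTail₁ (m τ : ℝ) : ℝ :=
  -m * τ ^ (-m - 1) + (m + m * (m + 1) * (1 - τ) + m * (m + 1) * (m + 2) / 2 * (1 - τ) ^ 2)

/-- Second derivative of `taylorTail`. -/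
noncomputable def taylorTail₂ (m τ : ℝ) : ℝ :=
  m * (m + 1) * (τ ^ (-m - 2) - (1 + (m + 2) * (1 - τ)))

/-- Radial profile of the truncated fundamental solution. -/
noncomputable def profile (m τ : ℝ) : ℝ := taylorTail m (min τ 1)

/-- First derivative of `profile`. -/
noncomputable def profile₁ (m τ : ℝ) : ℝ := taylorTail₁ m (min τ 1)

/-- Second derivative of `profile`. -/
noncomputable def profile₂ (m τ : ℝ) : ℝ := taylorTail₂ m (min τ 1)

theorem taylorTail_hasDerivAt (m : ℝ) {τ : ℝ} (hτ : 0 < τ) :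
    HasDerivAt (taylorTail m) (taylorTail₁ m τ) τ := by
  have h1 : HasDerivAt (fun t : ℝ => t ^ (-m)) (-m * τ ^ (-m - 1)) τ :=
    Real.hasDerivAt_rpow_const (Or.inl hτ.ne')
  have h2 : HasDerivAt (fun t : ℝ => 1 - t) (-1) τ := by
    simpa using (hasDerivAt_id τ).const_sub 1
  have h3 := (((h2.const_mul m).const_add 1).add ((h2.pow 2).const_mul (m * (m + 1) / 2))).add
    ((h2.pow 3).const_mul (m * (m + 1) * (m + 2) / 6))
  convert! h1.sub h3 using 1
  unfold taylorTail₁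
  push_cast
  simp
  ring

theorem taylorTail₁_hasDerivAt (m : ℝ) {τ : ℝ} (hτ : 0 < τ) :
    HasDerivAt (taylorTail₁ m) (taylorTail₂ m τ) τ := by
  have h1 : HasDerivAt (fun t : ℝ => t ^ (-m - 1)) ((-m - 1) * τ ^ (-m - 1 - 1)) τ :=
    Real.hasDerivAt_rpow_const (Or.inl hτ.ne')
  have h2 : HasDerivAt (fun t : ℝ => 1 - t) (-1) τ := by
    simpa using (hasDerivAt_id τ).const_sub 1
  have h3 := ((h2.const_mul (m * (m + 1))).const_add m).add
    ((h2.pow 2).const_mul (m * (m + 1) * (m + 2) / 2))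
  convert! (h1.const_mul (-m)).add h3 using 1
  unfold taylorTail₂
  rw [show -m - 1 - 1 = -m - 2 by ring]
  push_cast
  simp
  ring

theorem taylorTail_one (m : ℝ) : taylorTail m 1 = 0 := by simp [taylorTail]

theorem taylorTail₁_one (m : ℝ) : taylorTail₁ m 1 = 0 := by simp [taylorTail₁]

theorem taylorTail₂_one (m : ℝ) : taylorTail₂ m 1 = 0 := by simp [taylorTail₂]

theorem HasDerivAt.comp_min_one {A A' : ℝ → ℝ} (hA : ∀ τ, 0 < τ → HasDerivAt A (A' τ) τ)
    (h1 : A' 1 = 0) {τ : ℝ} (hτ : 0 < τ) :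
    HasDerivAt (fun t => A (min t 1)) (A' (min τ 1)) τ := by
  rcases lt_trichotomy τ 1 with h | h | h
  · rw [min_eq_left h.le]
    refine (hA τ hτ).congr_of_eventuallyEq ?_
    filter_upwards [Iio_mem_nhds h] with t ht
    rw [min_eq_left (le_of_lt ht)]
  · subst h
    have h2 := hA 1 one_pos
    rw [h1] at h2
    rw [min_self, h1]
    rw [hasDerivAt_iff_isLittleO] at h2 ⊢
    simp only [smul_zero, sub_zero, min_self] at h2 ⊢
    have h3 : Tendsto (fun t : ℝ => min t 1) (nhds 1) (nhds 1) := by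
      have : Continuous (fun t : ℝ => min t 1) := by fun_prop
      simpa using this.tendsto 1
    refine (h2.comp_tendsto h3).trans_isBigO ?_
    refine Asymptotics.isBigO_of_le _ fun t => ?_
    simp only [Function.comp, Real.norm_eq_abs]
    rcases le_total t 1 with h | h
    · rw [min_eq_left h]
    · rw [min_eq_right h]; simp
  · rw [min_eq_right h.le, h1]
    refine (hasDerivAt_const τ (A 1)).congr_of_eventuallyEq ?_
    filter_upwards [Ioi_mem_nhds h] with t ht
    rw [min_eq_right (le_of_lt ht)]

theorem profile_hasDerivAt (m : ℝ) {τ : ℝ} (hτ : 0 < τ) :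
    HasDerivAt (profile m) (profile₁ m τ) τ :=
  HasDerivAt.comp_min_one (fun _ h => taylorTail_hasDerivAt m h) (taylorTail₁_one m) hτ

theorem profile₁_hasDerivAt (m : ℝ) {τ : ℝ} (hτ : 0 < τ) :
    HasDerivAt (profile₁ m) (profile₂ m τ) τ :=
  HasDerivAt.comp_min_one (fun _ h => taylorTail₁_hasDerivAt m h) (taylorTail₂_one m) hτ

theorem profile₂_continuousOn (m : ℝ) : ContinuousOn (profile₂ m) (Ioi 0) := by
  unfold profile₂ taylorTail₂
  refine ContinuousOn.mul continuousOn_const (ContinuousOn.sub ?_ (by fun_prop))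
  refine ContinuousOn.rpow_const (by fun_prop) fun x hx => Or.inl ?_
  exact (lt_min hx one_pos).ne'

theorem profile_contDiffOn (m : ℝ) : ContDiffOn ℝ 2 (profile m) (Ioi 0) := by
  rw [show (2 : WithTop ℕ∞) = 1 + 1 by norm_num, contDiffOn_succ_iff_deriv_of_isOpen isOpen_Ioi]
  refine ⟨fun τ hτ => (profile_hasDerivAt m hτ).differentiableAt.differentiableWithinAt,
    by simp, ?_⟩
  have h1 : ContDiffOn ℝ 1 (profile₁ m) (Ioi 0) := by
    rw [show (1 : WithTop ℕ∞) = 0 + 1 by norm_num,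
      contDiffOn_succ_iff_deriv_of_isOpen isOpen_Ioi]
    refine ⟨fun τ hτ => (profile₁_hasDerivAt m hτ).differentiableAt.differentiableWithinAt,
      by simp, ?_⟩
    rw [contDiffOn_zero]
    exact (profile₂_continuousOn m).congr fun τ hτ => (profile₁_hasDerivAt m hτ).deriv
  exact h1.congr fun τ hτ => (profile_hasDerivAt m hτ).deriv

theorem taylorTail₂_pos {m τ : ℝ} (hm : 0 < m) (hτ : 0 < τ) (h1 : τ < 1) :
    0 < taylorTail₂ m τ := by
  unfold taylorTail₂
  have h2 : 1 + (m + 2) * (τ⁻¹ - 1) ≤ (1 + (τ⁻¹ - 1)) ^ (m + 2) := by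
    refine one_add_mul_self_le_rpow_one_add ?_ (by linarith)
    have : 0 < τ⁻¹ := by positivity
    linarith
  rw [show 1 + (τ⁻¹ - 1) = τ⁻¹ by ring, Real.inv_rpow hτ.le, ← Real.rpow_neg hτ.le,
    show -(m + 2) = -m - 2 by ring] at h2
  have h3 : 1 - τ < τ⁻¹ - 1 := by
    have : τ⁻¹ - 1 - (1 - τ) = (1 - τ) ^ 2 / τ := by field_simp
    have h4 : 0 < (1 - τ) ^ 2 / τ := div_pos (pow_pos (by linarith) 2) hτ
    linarith
  refine mul_pos (by positivity) ?_
  nlinarith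

theorem taylorTail₁_neg {m τ : ℝ} (hm : 0 < m) (hτ : 0 < τ) (h1 : τ < 1) :
    taylorTail₁ m τ < 0 := by
  have h : StrictMonoOn (taylorTail₁ m) (Icc τ 1) := by
    refine strictMonoOn_of_deriv_pos (convex_Icc _ _) (fun t ht =>
      (taylorTail₁_hasDerivAt m (hτ.trans_le ht.1)).continuousAt.continuousWithinAt) ?_
    intro t ht
    rw [interior_Icc] at ht
    rw [(taylorTail₁_hasDerivAt m (hτ.trans ht.1)).deriv]
    exact taylorTail₂_pos hm (hτ.trans ht.1) ht.2
  rw [← taylorTail₁_one m]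
  exact h ⟨le_rfl, h1.le⟩ ⟨h1.le, le_rfl⟩ h1

theorem taylorTail_strictAntiOn {m : ℝ} (hm : 0 < m) : StrictAntiOn (taylorTail m) (Ioc 0 1) := by
  refine strictAntiOn_of_deriv_neg (convex_Ioc _ _) (fun t ht =>
      (taylorTail_hasDerivAt m ht.1).continuousAt.continuousWithinAt) ?_
  intro t ht
  rw [interior_Ioc] at ht
  rw [(taylorTail_hasDerivAt m ht.1).deriv]
  exact taylorTail₁_neg hm ht.1 ht.2

variable {m τ : ℝ}

theorem profile₂_nonneg (hm : 0 < m) (hτ : 0 < τ) : 0 ≤ profile₂ m τ := by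
  unfold profile₂
  rcases lt_or_ge τ 1 with h | h
  · rw [min_eq_left h.le]; exact (taylorTail₂_pos hm hτ h).le
  · rw [min_eq_right h, taylorTail₂_one]

theorem profile₁_nonpos (hm : 0 < m) (hτ : 0 < τ) : profile₁ m τ ≤ 0 := by
  unfold profile₁
  rcases lt_or_ge τ 1 with h | h
  · rw [min_eq_left h.le]; exact (taylorTail₁_neg hm hτ h).le
  · rw [min_eq_right h, taylorTail₁_one]

theorem profile_anti (hm : 0 < m) {t : ℝ} (hτ : 0 < τ) (h : τ ≤ t) :
    profile m t ≤ profile m τ :=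
  (taylorTail_strictAntiOn hm).antitoneOn ⟨lt_min hτ one_pos, min_le_right _ _⟩
    ⟨lt_min (hτ.trans_le h) one_pos, min_le_right _ _⟩ (min_le_min_right _ h)

theorem profile_eq_zero (h : 1 ≤ τ) : profile m τ = 0 := by
  rw [profile, min_eq_right h, taylorTail_one]

theorem profile₁_eq_zero (h : 1 ≤ τ) : profile₁ m τ = 0 := by
  rw [profile₁, min_eq_right h, taylorTail₁_one]

theorem profile₂_eq_zero (h : 1 ≤ τ) : profile₂ m τ = 0 := by
  rw [profile₂, min_eq_right h, taylorTail₂_one]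

theorem profile_nonneg (hm : 0 < m) (hτ : 0 < τ) : 0 ≤ profile m τ := by
  rcases le_total τ 1 with h | h
  · rw [← profile_eq_zero (m := m) le_rfl]; exact profile_anti hm hτ h
  · rw [profile_eq_zero h]

theorem profile_half_pos (hm : 0 < m) : 0 < profile m (1 / 2) := by
  have := taylorTail_strictAntiOn hm (a := 1 / 2) (b := 1) (by norm_num) (by norm_num)
    (by norm_num)
  rw [taylorTail_one] at this
  rw [profile, min_eq_left (by norm_num)]
  exact this

theorem profile_le_rpow (hm : 0 < m) (hτ : 0 < τ) : profile m τ ≤ τ ^ (-m) := by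
  rcases le_total τ 1 with h | h
  · rw [profile, min_eq_left h, taylorTail]
    have h1 : 0 ≤ 1 - τ := by linarith
    have : 0 ≤ 1 + m * (1 - τ) + m * (m + 1) / 2 * (1 - τ) ^ 2
      + m * (m + 1) * (m + 2) / 6 * (1 - τ) ^ 3 := by positivity
    linarith
  · rw [profile_eq_zero h]; positivity

theorem abs_profile₁_le (hm : 0 < m) (hτ : 0 < τ) : |profile₁ m τ| ≤ m * τ ^ (-m - 1) := by
  rw [abs_of_nonpos (profile₁_nonpos hm hτ)]
  rcases le_total τ 1 with h | h
  · rw [profile₁, min_eq_left h, taylorTail₁]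
    have h1 : 0 ≤ 1 - τ := by linarith
    have : 0 ≤ m + m * (m + 1) * (1 - τ) + m * (m + 1) * (m + 2) / 2 * (1 - τ) ^ 2 := by
      positivity
    linarith
  · rw [profile₁_eq_zero h]; simp; positivity

theorem profile_laplace (hτ : 0 < τ) :
    4 * τ * profile₂ m τ + 2 * (2 * m + 2) * profile₁ m τ
      = 2 * m * (m + 1) * (m + 2) * (m + 3) * (1 - min τ 1) ^ 2 := by
  rcases le_total τ 1 with h | h
  · rw [profile₁, profile₂, min_eq_left h, taylorTail₁, taylorTail₂]
    have : τ ^ (-m - 1) = τ * τ ^ (-m - 2) := by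
      rw [show -m - 1 = 1 + (-m - 2) by ring, Real.rpow_add hτ, Real.rpow_one]
    rw [this]
    ring
  · rw [profile₁_eq_zero h, profile₂_eq_zero h, min_eq_right h]
    simp

end TruncatedKernel

section RadialFunctions

variable {N : ℕ} {ε : ℝ} {g g' : ℝ → ℝ} (x : EuclideanSpace ℝ (Fin N))

theorem radial_pos (hε : 0 < ε) (y : EuclideanSpace ℝ (Fin N)) : 0 < ‖y - x‖ ^ 2 + ε ^ 2 := by
  positivity

theorem radial_contDiff {n : ℕ∞} (hg : ContDiffOn ℝ n g (Ioi 0)) (hε : 0 < ε) :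
    ContDiff ℝ n (fun y => g (‖y - x‖ ^ 2 + ε ^ 2)) := by
  have h1 : ContDiff ℝ n (fun y : EuclideanSpace ℝ (Fin N) => ‖y - x‖ ^ 2 + ε ^ 2) :=
    ((contDiff_id.sub contDiff_const).norm_sq ℝ).add contDiff_const
  rw [contDiff_iff_contDiffAt]
  intro y
  exact (hg.contDiffAt (Ioi_mem_nhds (radial_pos x hε y))).comp y h1.contDiffAt

theorem radial_hasCompactSupport (hg : ∀ τ, 1 ≤ τ → g τ = 0) :
    HasCompactSupport (fun y => g (‖y - x‖ ^ 2 + ε ^ 2)) := by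
  refine HasCompactSupport.intro (isCompact_closedBall x 1) fun y hy => hg _ ?_
  rw [mem_closedBall, dist_eq_norm, not_le] at hy
  nlinarith [sq_nonneg ε]

theorem radial_eq_zero (hg : ∀ τ, 1 ≤ τ → g τ = 0) {y : EuclideanSpace ℝ (Fin N)}
    (hy : y ∉ ball x 1) : g (‖y - x‖ ^ 2 + ε ^ 2) = 0 := by
  apply hg
  rw [mem_ball, dist_eq_norm, not_lt] at hy
  nlinarith [sq_nonneg ε]

theorem radial_hasFDerivAt (hg : ∀ τ, 0 < τ → HasDerivAt g (g' τ) τ) (hε : 0 < ε)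
    (y : EuclideanSpace ℝ (Fin N)) :
    HasFDerivAt (fun y => g (‖y - x‖ ^ 2 + ε ^ 2))
      (g' (‖y - x‖ ^ 2 + ε ^ 2) • (2 • innerSL ℝ (y - x))) y := by
  have h1 : HasFDerivAt (fun y : EuclideanSpace ℝ (Fin N) => ‖y - x‖ ^ 2 + ε ^ 2)
      (2 • innerSL ℝ (y - x)) y := by
    have := (((hasFDerivAt_id y).sub_const x).norm_sq).add_const (ε ^ 2)
    convert! this using 1
  exact (hg _ (radial_pos x hε y)).comp_hasFDerivAt y h1

theorem pd_radial (hg : ∀ τ, 0 < τ → HasDerivAt g (g' τ) τ) (hε : 0 < ε) (i : Fin N) :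
    pd i (fun y => g (‖y - x‖ ^ 2 + ε ^ 2))
      = fun y => 2 * (y i - x i) * g' (‖y - x‖ ^ 2 + ε ^ 2) := by
  funext y
  rw [pd, (radial_hasFDerivAt x hg hε y).fderiv]
  simp [EuclideanSpace.inner_single_right]
  ring

theorem pd_pd_radial {g'' : ℝ → ℝ} (hg : ∀ τ, 0 < τ → HasDerivAt g (g' τ) τ)
    (hg' : ∀ τ, 0 < τ → HasDerivAt g' (g'' τ) τ) (hε : 0 < ε) (i : Fin N)
    (y : EuclideanSpace ℝ (Fin N)) :
    pd i (pd i (fun y => g (‖y - x‖ ^ 2 + ε ^ 2))) y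
      = 2 * g' (‖y - x‖ ^ 2 + ε ^ 2) + 4 * (y i - x i) ^ 2 * g'' (‖y - x‖ ^ 2 + ε ^ 2) := by
  rw [pd_radial x hg hε i]
  have h1 : HasFDerivAt (fun y : EuclideanSpace ℝ (Fin N) => 2 * (y i - x i))
      ((2 : ℝ) • (EuclideanSpace.proj i : EuclideanSpace ℝ (Fin N) →L[ℝ] ℝ)) y :=
    (((EuclideanSpace.proj i : EuclideanSpace ℝ (Fin N) →L[ℝ] ℝ).hasFDerivAt).sub_const
      (x i)).const_mul 2
  have h2 : fderiv ℝ (fun y : EuclideanSpace ℝ (Fin N) =>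
      2 * (y i - x i) * g' (‖y - x‖ ^ 2 + ε ^ 2)) y = _ :=
    (h1.mul (radial_hasFDerivAt x hg' hε y)).fderiv
  rw [pd, h2]
  simp [EuclideanSpace.inner_single_right]
  ring

theorem lap_radial {g'' : ℝ → ℝ} (hC : ContDiffOn ℝ 2 g (Ioi 0))
    (hg : ∀ τ, 0 < τ → HasDerivAt g (g' τ) τ)
    (hg' : ∀ τ, 0 < τ → HasDerivAt g' (g'' τ) τ) (hε : 0 < ε) (y : EuclideanSpace ℝ (Fin N)) :
    lap (fun y => g (‖y - x‖ ^ 2 + ε ^ 2)) y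
      = 2 * N * g' (‖y - x‖ ^ 2 + ε ^ 2)
        + 4 * ‖y - x‖ ^ 2 * g'' (‖y - x‖ ^ 2 + ε ^ 2) := by
  rw [lap_eq_sum_pd (radial_contDiff (n := 2) x (by exact_mod_cast hC) hε)]
  simp only [pd_pd_radial x hg hg' hε]
  have h1 : ‖y - x‖ ^ 2 = ∑ i, (y i - x i) ^ 2 := by
    rw [EuclideanSpace.norm_sq_eq]; simp
  have h2 : ∑ i, 4 * (y i - x i) ^ 2 * g'' (‖y - x‖ ^ 2 + ε ^ 2)
      = 4 * (∑ i, (y i - x i) ^ 2) * g'' (‖y - x‖ ^ 2 + ε ^ 2) := by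
    rw [Finset.mul_sum, Finset.sum_mul]
  rw [Finset.sum_add_distrib, h2, ← h1, Finset.sum_const, Finset.card_univ, Fintype.card_fin,
    nsmul_eq_mul]
  ring

end RadialFunctions

section ApproximateIdentity

variable {N : ℕ} {m : ℝ}

theorem profile₂_le (hm : 0 < m) {τ : ℝ} (hτ : 0 < τ) :
    profile₂ m τ ≤ m * (m + 1) * τ ^ (-m - 2) := by
  rcases le_total τ 1 with h | h
  · rw [profile₂, min_eq_left h, taylorTail₂]
    have : 0 ≤ 1 + (m + 2) * (1 - τ) := by nlinarith
    have : 0 < m * (m + 1) := by positivity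
    nlinarith
  · rw [profile₂_eq_zero h]; positivity

/-- Total mass of the approximate identity. -/
noncomputable def poleMass (N : ℕ) (m : ℝ) : ℝ :=
  4 * (m * (m + 1)) * ∫ z : EuclideanSpace ℝ (Fin N), (1 + ‖z‖ ^ 2) ^ (-m - 2)

theorem integrable_pole (hN : (N : ℝ) = 2 * m + 2) :
    Integrable (fun z : EuclideanSpace ℝ (Fin N) => (1 + ‖z‖ ^ 2) ^ (-m - 2)) := by
  have := integrable_rpow_neg_one_add_norm_sq (E := EuclideanSpace ℝ (Fin N)) (μ := volume)
    (r := 2 * m + 4) (by simp; linarith)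
  convert this using 3
  ring

theorem poleMass_pos (hm : 0 < m) (hN : (N : ℝ) = 2 * m + 2) : 0 < poleMass N m := by
  refine mul_pos (by positivity) ?_
  rw [integral_pos_iff_support_of_nonneg (fun z => by positivity) (integrable_pole hN)]
  have : Function.support (fun z : EuclideanSpace ℝ (Fin N) => (1 + ‖z‖ ^ 2) ^ (-m - 2))
      = univ := by
    ext z; simp only [Function.mem_support, mem_univ, iff_true]; positivity
  rw [this]
  exact isOpen_univ.measure_pos _ univ_nonempty

theorem scaled_profile₂ (hm : 0 < m) (hN : (N : ℝ) = 2 * m + 2) {ε s : ℝ} (hε : 0 < ε)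
    (hs : 0 ≤ s) :
    ε ^ N * (4 * ε ^ 2 * profile₂ m (ε ^ 2 * (1 + s)))
      ≤ 4 * (m * (m + 1)) * (1 + s) ^ (-m - 2) := by
  have h1 := profile₂_le hm (τ := ε ^ 2 * (1 + s)) (by positivity)
  have h2 : ε ^ N * ε ^ 2 * (ε ^ 2 * (1 + s)) ^ (-m - 2) = (1 + s) ^ (-m - 2) := by
    rw [Real.mul_rpow (by positivity) (by positivity), ← Real.rpow_natCast ε N,
      ← Real.rpow_natCast ε 2, ← Real.rpow_mul hε.le, ← mul_assoc, ← Real.rpow_add hε,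
      ← Real.rpow_add hε, hN]
    push_cast
    rw [show 2 * m + 2 + 2 + 2 * (-m - 2) = 0 by ring]
    simp
  calc ε ^ N * (4 * ε ^ 2 * profile₂ m (ε ^ 2 * (1 + s)))
      ≤ ε ^ N * (4 * ε ^ 2 * (m * (m + 1) * (ε ^ 2 * (1 + s)) ^ (-m - 2))) := by gcongr
    _ = 4 * (m * (m + 1)) * (ε ^ N * ε ^ 2 * (ε ^ 2 * (1 + s)) ^ (-m - 2)) := by ring
    _ = _ := by rw [h2]

theorem scaled_profile₂_tendsto (hN : (N : ℝ) = 2 * m + 2) {s : ℝ} (hs : 0 ≤ s) :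
    Tendsto (fun ε : ℝ => ε ^ N * (4 * ε ^ 2 * profile₂ m (ε ^ 2 * (1 + s))))
      (nhdsWithin 0 (Ioi 0)) (nhds (4 * (m * (m + 1)) * (1 + s) ^ (-m - 2))) := by
  have h0 : Tendsto (fun ε : ℝ => 4 * (m * (m + 1)) * ((1 + s) ^ (-m - 2)
      - ε ^ (N + 2) * (1 + (m + 2) * (1 - ε ^ 2 * (1 + s))))) (nhdsWithin 0 (Ioi 0))
      (nhds (4 * (m * (m + 1)) * (1 + s) ^ (-m - 2))) := by
    refine Tendsto.mono_left ?_ nhdsWithin_le_nhds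
    have : Continuous (fun ε : ℝ => 4 * (m * (m + 1)) * ((1 + s) ^ (-m - 2)
      - ε ^ (N + 2) * (1 + (m + 2) * (1 - ε ^ 2 * (1 + s))))) := by fun_prop
    simpa using this.tendsto 0
  refine h0.congr' ?_
  have h1 : ∀ᶠ ε : ℝ in nhdsWithin 0 (Ioi 0), ε ^ 2 * (1 + s) < 1 := by
    refine Filter.Eventually.filter_mono nhdsWithin_le_nhds ?_
    have : Continuous (fun ε : ℝ => ε ^ 2 * (1 + s)) := by fun_prop
    exact (this.tendsto 0).eventually_lt_const (by simp)
  filter_upwards [h1, self_mem_nhdsWithin] with ε h2 hε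
  have hε : 0 < ε := hε
  rw [profile₂, min_eq_left h2.le, taylorTail₂]
  have h2 : ε ^ N * ε ^ 2 * (ε ^ 2 * (1 + s)) ^ (-m - 2) = (1 + s) ^ (-m - 2) := by
    rw [Real.mul_rpow (by positivity) (by positivity), ← Real.rpow_natCast ε N,
      ← Real.rpow_natCast ε 2, ← Real.rpow_mul hε.le, ← mul_assoc, ← Real.rpow_add hε,
      ← Real.rpow_add hε, hN]
    push_cast
    rw [show 2 * m + 2 + 2 + 2 * (-m - 2) = 0 by ring]
    simp
  rw [← h2]
  ring

theorem tendsto_pole (hm : 0 < m) (hN : (N : ℝ) = 2 * m + 2)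
    {w : EuclideanSpace ℝ (Fin N) → ℝ} (hw : Continuous w) (x : EuclideanSpace ℝ (Fin N)) :
    Tendsto (fun ε : ℝ => ∫ y, w y * (4 * ε ^ 2 * profile₂ m (‖y - x‖ ^ 2 + ε ^ 2)))
      (nhdsWithin 0 (Ioi 0)) (nhds (poleMass N m * w x)) := by
  obtain ⟨M, hM⟩ := (isCompact_closedBall x 1).exists_bound_of_continuousOn hw.continuousOn
  have hsub : ∀ ε : ℝ, 0 < ε → ∫ y, w y * (4 * ε ^ 2 * profile₂ m (‖y - x‖ ^ 2 + ε ^ 2))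
      = ∫ z, w (x + ε • z) * (ε ^ N * (4 * ε ^ 2 * profile₂ m (ε ^ 2 * (1 + ‖z‖ ^ 2)))) := by
    intro ε hε
    have h1 := Measure.integral_comp_smul (volume : Measure (EuclideanSpace ℝ (Fin N)))
      (fun z => w (x + z) * (4 * ε ^ 2 * profile₂ m (‖z‖ ^ 2 + ε ^ 2))) ε
    have h2 := integral_add_left_eq_self (μ := (volume : Measure (EuclideanSpace ℝ (Fin N))))
      (fun y => w y * (4 * ε ^ 2 * profile₂ m (‖y - x‖ ^ 2 + ε ^ 2))) x
    simp only [add_sub_cancel_left] at h2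
    rw [h2] at h1
    have hp : (0 : ℝ) < ε ^ N := by positivity
    rw [finrank_euclideanSpace, Fintype.card_fin, abs_of_pos (by positivity), smul_eq_mul] at h1
    have h3 : ∫ y, w y * (4 * ε ^ 2 * profile₂ m (‖y - x‖ ^ 2 + ε ^ 2))
        = ε ^ N * ∫ z, w (x + ε • z) * (4 * ε ^ 2 * profile₂ m (‖ε • z‖ ^ 2 + ε ^ 2)) := by
      rw [h1, ← mul_assoc, mul_inv_cancel₀ hp.ne', one_mul]
    rw [h3, ← integral_const_mul]
    congr 1
    funext z
    rw [norm_smul, Real.norm_eq_abs, mul_pow, sq_abs, show ε ^ 2 * ‖z‖ ^ 2 + ε ^ 2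
      = ε ^ 2 * (1 + ‖z‖ ^ 2) by ring]
    ring
  have hlim : poleMass N m * w x
      = ∫ z : EuclideanSpace ℝ (Fin N), w x * (4 * (m * (m + 1)) * (1 + ‖z‖ ^ 2) ^ (-m - 2)) := by
    rw [integral_const_mul, integral_const_mul, poleMass]; ring
  rw [hlim]
  refine Tendsto.congr' (f₁ := fun ε : ℝ => ∫ z, w (x + ε • z)
    * (ε ^ N * (4 * ε ^ 2 * profile₂ m (ε ^ 2 * (1 + ‖z‖ ^ 2))))) ?_ ?_
  · filter_upwards [self_mem_nhdsWithin] with ε hε using (hsub ε hε).symm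
  refine tendsto_integral_filter_of_dominated_convergence
    (fun z => M * (4 * (m * (m + 1)) * (1 + ‖z‖ ^ 2) ^ (-m - 2))) ?_ ?_ ?_ ?_
  · filter_upwards [self_mem_nhdsWithin] with ε hε
    refine Continuous.aestronglyMeasurable ?_
    refine (hw.comp (by fun_prop)).mul (continuous_const.mul (continuous_const.mul ?_))
    refine (profile₂_continuousOn m).comp_continuous (by fun_prop) fun z => ?_
    have : (0 : ℝ) < ε := hε
    exact mem_Ioi.2 (by positivity)
  · filter_upwards [self_mem_nhdsWithin] with ε hε
    have hε : (0 : ℝ) < ε := hε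
    refine ae_of_all _ fun z => ?_
    have hτ : 0 < ε ^ 2 * (1 + ‖z‖ ^ 2) := by positivity
    have h0 : 0 ≤ ε ^ N * (4 * ε ^ 2 * profile₂ m (ε ^ 2 * (1 + ‖z‖ ^ 2))) :=
      mul_nonneg (by positivity) (mul_nonneg (by positivity) (profile₂_nonneg hm hτ))
    have hM0 : 0 ≤ M := (norm_nonneg _).trans (hM x (by simp))
    rw [norm_mul, Real.norm_of_nonneg h0]
    by_cases hz : x + ε • z ∈ closedBall x 1
    · exact mul_le_mul (hM _ hz) (scaled_profile₂ hm hN hε (by positivity)) h0 hM0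
    · have : 1 ≤ ε ^ 2 * (1 + ‖z‖ ^ 2) := by
        rw [mem_closedBall, dist_eq_norm, add_sub_cancel_left, norm_smul, Real.norm_of_nonneg hε.le,
          not_le] at hz
        nlinarith [sq_nonneg ε]
      rw [profile₂_eq_zero this]
      simp only [mul_zero]
      positivity
  · exact ((integrable_pole hN).const_mul _).const_mul _
  · refine ae_of_all _ fun z => Tendsto.mul ?_ (scaled_profile₂_tendsto hN (by positivity))
    refine Tendsto.mono_left ?_ nhdsWithin_le_nhds
    have : Continuous (fun ε : ℝ => w (x + ε • z)) := hw.comp (by fun_prop)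
    simpa using this.tendsto 0

end ApproximateIdentity

section PotentialEstimates

variable {N : ℕ} {m ε : ℝ}

/-- Coefficient of the smooth part of the Laplacian of the truncated fundamental solution. -/
noncomputable def bumpCoeff (m : ℝ) : ℝ := 2 * m * (m + 1) * (m + 2) * (m + 3)

theorem bumpCoeff_pos (hm : 0 < m) : 0 < bumpCoeff m := by unfold bumpCoeff; positivity

/-- Profile of the smooth part of the Laplacian of the truncated fundamental solution. -/
noncomputable def bumpProfile (m τ : ℝ) : ℝ := bumpCoeff m * (1 - min τ 1) ^ 2

theorem bumpProfile_eq_zero {τ : ℝ} (h : 1 ≤ τ) : bumpProfile m τ = 0 := by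
  simp [bumpProfile, min_eq_right h]

theorem bumpProfile_nonneg (hm : 0 < m) (τ : ℝ) : 0 ≤ bumpProfile m τ :=
  mul_nonneg (bumpCoeff_pos hm).le (sq_nonneg _)

theorem bumpProfile_le (hm : 0 < m) {τ : ℝ} (hτ : 0 ≤ τ) : bumpProfile m τ ≤ bumpCoeff m := by
  have h1 : 0 ≤ min τ 1 := le_min hτ zero_le_one
  have h2 : min τ 1 ≤ 1 := min_le_right _ _
  have : (1 - min τ 1) ^ 2 ≤ 1 := by nlinarith
  unfold bumpProfile
  nlinarith [bumpCoeff_pos hm]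

theorem bumpProfile_hasDerivAt (m : ℝ) {τ : ℝ} (hτ : 0 < τ) :
    HasDerivAt (bumpProfile m) (-(2 * bumpCoeff m * (1 - min τ 1))) τ := by
  refine HasDerivAt.comp_min_one (A := fun t => bumpCoeff m * (1 - t) ^ 2)
    (A' := fun t => -(2 * bumpCoeff m * (1 - t))) (fun t _ => ?_) (by simp) hτ
  have := (((hasDerivAt_id t).const_sub 1).pow 2).const_mul (bumpCoeff m)
  convert! this using 1
  simp; ring

theorem bumpProfile_contDiffOn (m : ℝ) : ContDiffOn ℝ 1 (bumpProfile m) (Ioi 0) := by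
  rw [show (1 : WithTop ℕ∞) = 0 + 1 from rfl, contDiffOn_succ_iff_deriv_of_isOpen isOpen_Ioi]
  refine ⟨fun τ hτ => (bumpProfile_hasDerivAt m hτ).differentiableAt.differentiableWithinAt,
    by simp, ?_⟩
  refine ContDiffOn.congr (f := fun τ => -(2 * bumpCoeff m * (1 - min τ 1))) ?_
    fun τ hτ => (bumpProfile_hasDerivAt m hτ).deriv
  exact contDiffOn_zero.2 (Continuous.continuousOn (by fun_prop))

variable (x : EuclideanSpace ℝ (Fin N))

theorem kernel_contDiff (m : ℝ) (hε : 0 < ε) :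
    ContDiff ℝ 2 (fun y => profile m (‖y - x‖ ^ 2 + ε ^ 2)) :=
  radial_contDiff (n := 2) x (by exact_mod_cast profile_contDiffOn m) hε

theorem kernel_hasCompactSupport (m ε : ℝ) :
    HasCompactSupport (fun y => profile m (‖y - x‖ ^ 2 + ε ^ 2)) :=
  radial_hasCompactSupport x fun _ => profile_eq_zero

theorem lap_kernel (hN : (N : ℝ) = 2 * m + 2) (hε : 0 < ε) (y : EuclideanSpace ℝ (Fin N)) :
    lap (fun y => profile m (‖y - x‖ ^ 2 + ε ^ 2)) y
      = bumpProfile m (‖y - x‖ ^ 2 + ε ^ 2)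
        - 4 * ε ^ 2 * profile₂ m (‖y - x‖ ^ 2 + ε ^ 2) := by
  rw [lap_radial x (profile_contDiffOn m) (fun _ => profile_hasDerivAt m)
    (fun _ => profile₁_hasDerivAt m) hε]
  have := profile_laplace (m := m) (radial_pos x hε y)
  rw [bumpProfile, bumpCoeff, ← this, hN]
  ring

theorem continuous_bump (m ε : ℝ) :
    Continuous (fun y => bumpProfile m (‖y - x‖ ^ 2 + ε ^ 2)) := by
  unfold bumpProfile; fun_prop

theorem bump_hasCompactSupport :
    HasCompactSupport (fun y => bumpProfile m (‖y - x‖ ^ 2 + ε ^ 2)) :=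
  radial_hasCompactSupport x fun _ => bumpProfile_eq_zero

theorem continuous_pole (hε : 0 < ε) :
    Continuous (fun y => 4 * ε ^ 2 * profile₂ m (‖y - x‖ ^ 2 + ε ^ 2)) :=
  continuous_const.mul ((profile₂_continuousOn m).comp_continuous (by fun_prop)
    fun y => radial_pos x hε y)

theorem pole_hasCompactSupport :
    HasCompactSupport (fun y => 4 * ε ^ 2 * profile₂ m (‖y - x‖ ^ 2 + ε ^ 2)) :=
  (radial_hasCompactSupport x fun _ => profile₂_eq_zero).mul_left

theorem integral_mul_lap_kernel (hN : (N : ℝ) = 2 * m + 2) (hε : 0 < ε)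
    {w : EuclideanSpace ℝ (Fin N) → ℝ} (hw : Continuous w) :
    ∫ y, w y * lap (fun y => profile m (‖y - x‖ ^ 2 + ε ^ 2)) y
      = (∫ y, w y * bumpProfile m (‖y - x‖ ^ 2 + ε ^ 2))
        - ∫ y, w y * (4 * ε ^ 2 * profile₂ m (‖y - x‖ ^ 2 + ε ^ 2)) := by
  simp only [lap_kernel x hN hε, mul_sub]
  exact integral_sub
    ((hw.mul (continuous_bump x m ε)).integrable_of_hasCompactSupport
      (bump_hasCompactSupport x).mul_left)
    ((hw.mul (continuous_pole x hε)).integrable_of_hasCompactSupport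
      (pole_hasCompactSupport x).mul_left)

theorem pole_representation (hN : (N : ℝ) = 2 * m + 2) (hε : 0 < ε)
    {u : EuclideanSpace ℝ (Fin N) → ℝ} (hu : ContDiff ℝ 2 u) :
    ∫ y, u y * (4 * ε ^ 2 * profile₂ m (‖y - x‖ ^ 2 + ε ^ 2))
      = (∫ y, -lap u y * profile m (‖y - x‖ ^ 2 + ε ^ 2))
        + ∫ y, u y * bumpProfile m (‖y - x‖ ^ 2 + ε ^ 2) := by
  have h := integral_lap_mul hu (kernel_contDiff x m hε) (kernel_hasCompactSupport x m ε)
  rw [integral_mul_lap_kernel x hN hε hu.continuous] at h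
  simp only [neg_mul, integral_neg]
  linarith

theorem pole_representation_pd (hN : (N : ℝ) = 2 * m + 2) (hε : 0 < ε)
    {u : EuclideanSpace ℝ (Fin N) → ℝ} (hu : ContDiff ℝ 2 u) (i : Fin N) :
    ∫ y, pd i u y * (4 * ε ^ 2 * profile₂ m (‖y - x‖ ^ 2 + ε ^ 2))
      = (∫ y, lap u y * (2 * (y i - x i) * profile₁ m (‖y - x‖ ^ 2 + ε ^ 2)))
        - ∫ y, u y * (2 * (y i - x i)
          * (-(2 * bumpCoeff m * (1 - min (‖y - x‖ ^ 2 + ε ^ 2) 1)))) := by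
  have h := integral_lap_mul_pd hu (kernel_contDiff x m hε) (kernel_hasCompactSupport x m ε) i
  rw [integral_mul_lap_kernel x hN hε (pd_continuous (hu.of_le (by norm_num)) i)] at h
  have h2 := integral_mul_pd (hu.of_le (by norm_num))
    (radial_contDiff (n := 1) x (by exact_mod_cast bumpProfile_contDiffOn m) hε)
    (bump_hasCompactSupport (m := m) (ε := ε) x) i
  rw [pd_radial x (fun _ => bumpProfile_hasDerivAt m) hε] at h2
  rw [pd_radial x (fun _ => profile_hasDerivAt m) hε] at h
  linarith

theorem potential_lower_bound (hm : 0 < m) (hN : (N : ℝ) = 2 * m + 2)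
    {u : EuclideanSpace ℝ (Fin N) → ℝ} (hu : ContDiff ℝ 2 u)
    (hpos : ∀ y ∈ ball x 1, 0 ≤ u y) (hsup : ∀ y ∈ ball x 1, 0 ≤ -lap u y) :
    profile m (1 / 2) * (∫ y in ball x (1 / 2), -lap u y)
      + bumpCoeff m / 4 * (∫ y in ball x (1 / 2), u y) ≤ poleMass N m * u x := by
  refine ge_of_tendsto (tendsto_pole hm hN hu.continuous x) ?_
  have hlt : ∀ᶠ ε : ℝ in nhdsWithin 0 (Ioi 0), ε < 1 / 2 :=
    Filter.Eventually.filter_mono nhdsWithin_le_nhds (eventually_lt_nhds (by norm_num))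
  filter_upwards [hlt, self_mem_nhdsWithin] with ε hε1 hε
  have hε : 0 < ε := hε
  rw [pole_representation x hN hε hu]
  have hlap : Continuous (fun y => -lap u y) := (lap_continuous hu).neg
  have key : ∀ (w k : EuclideanSpace ℝ (Fin N) → ℝ) (c : ℝ), Continuous w → Continuous k →
      HasCompactSupport k → (∀ y, 0 ≤ k y) → (∀ y ∉ ball x 1, k y = 0) →
      (∀ y ∈ ball x 1, 0 ≤ w y) → (∀ y ∈ ball x (1 / 2), c ≤ k y) →
      c * ∫ y in ball x (1 / 2), w y ≤ ∫ y, w y * k y := by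
    intro w k c hw hk hkc hk0 hkz hw0 hck
    rw [← integral_const_mul]
    have hi := (hw.mul hk).integrable_of_hasCompactSupport (μ := volume) hkc.mul_left
    calc ∫ y in ball x (1 / 2), c * w y ≤ ∫ y in ball x (1 / 2), w y * k y := by
          refine setIntegral_mono_on ?_ hi.integrableOn measurableSet_ball fun y hy => ?_
          · exact ((hw.const_mul c).continuousOn.integrableOn_compact
              (isCompact_closedBall x (1 / 2))).mono_set ball_subset_closedBall
          · rw [mul_comm]
            exact mul_le_mul_of_nonneg_left (hck y hy)
              (hw0 y (ball_subset_ball (by norm_num) hy))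
      _ ≤ ∫ y, w y * k y := by
          refine setIntegral_le_integral hi (ae_of_all _ fun y => ?_)
          by_cases hy : y ∈ ball x 1
          · exact mul_nonneg (hw0 y hy) (hk0 y)
          · simp [hkz y hy]
  have hτ : ∀ y ∈ ball x (1 / 2), ‖y - x‖ ^ 2 + ε ^ 2 ≤ 1 / 2 := by
    intro y hy
    rw [mem_ball, dist_eq_norm] at hy
    nlinarith [norm_nonneg (y - x)]
  refine add_le_add (key _ _ _ hlap (kernel_contDiff x m hε).continuous
    (kernel_hasCompactSupport x m ε) (fun y => profile_nonneg hm (radial_pos x hε y))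
    (fun y hy => radial_eq_zero x (fun _ => profile_eq_zero) hy) hsup
    fun y hy => profile_anti hm (radial_pos x hε y) (hτ y hy))
    (key _ _ _ hu.continuous (continuous_bump x m ε) (bump_hasCompactSupport x)
    (fun y => bumpProfile_nonneg hm _)
    (fun y hy => radial_eq_zero x (fun _ => bumpProfile_eq_zero) hy) hpos fun y hy => ?_)
  have h1 := hτ y hy
  rw [bumpProfile, min_eq_left (by linarith)]
  have : (1 / 4 : ℝ) ≤ (1 - (‖y - x‖ ^ 2 + ε ^ 2)) ^ 2 := by nlinarith
  nlinarith [bumpCoeff_pos hm]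

theorem rpow_radial_le {s : ℝ} (hs : 0 ≤ s) (hε : 0 < ε) (y : EuclideanSpace ℝ (Fin N)) :
    ENNReal.ofReal ((‖y - x‖ ^ 2 + ε ^ 2) ^ (-s)) ≤ ‖x - y‖ₑ ^ (-(2 * s)) := by
  rw [← ENNReal.ofReal_rpow_of_pos (radial_pos x hε y), ENNReal.rpow_neg, ENNReal.rpow_neg,
    ENNReal.inv_le_inv, ENNReal.rpow_mul]
  refine ENNReal.rpow_le_rpow ?_ hs
  rw [← ofReal_norm, norm_sub_rev, ENNReal.ofReal_rpow_of_nonneg (norm_nonneg _) (by simp)]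
  refine ENNReal.ofReal_le_ofReal ?_
  norm_cast
  nlinarith

theorem enorm_integral_le_of_kernel_le {w k : EuclideanSpace ℝ (Fin N) → ℝ}
    {g : EuclideanSpace ℝ (Fin N) → ENNReal} {c : ENNReal} (hc : c ≠ ⊤)
    (hk : ∀ y ∉ ball x 1, k y = 0) (hg : ∀ y ∈ ball x 1, ‖k y‖ₑ ≤ c * g y) :
    ‖∫ y, w y * k y‖ₑ ≤ c * ∫⁻ y in ball x 1, g y * ‖w y‖ₑ := by
  refine (enorm_integral_le_lintegral_enorm _).trans ?_
  rw [← lintegral_const_mul' _ _ hc, ← lintegral_indicator measurableSet_ball]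
  refine lintegral_mono fun y => ?_
  by_cases hy : y ∈ ball x 1
  · rw [indicator_of_mem hy, enorm_mul, ← mul_assoc, mul_comm]
    gcongr
    exact hg y hy
  · simp [hk y hy]

theorem potential_upper_bound (hm : 0 < m) (hN : (N : ℝ) = 2 * m + 2)
    {u : EuclideanSpace ℝ (Fin N) → ℝ} (hu : ContDiff ℝ 2 u) :
    ENNReal.ofReal (poleMass N m) * ‖u x‖ₑ
      ≤ (∫⁻ y in ball x 1, ‖x - y‖ₑ ^ (-(2 * m)) * ‖lap u y‖ₑ)
        + ENNReal.ofReal (bumpCoeff m) * ∫⁻ y in ball x 1, ‖u y‖ₑ := by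
  have ht := (continuous_enorm.tendsto _).comp (tendsto_pole hm hN hu.continuous x)
  rw [enorm_mul, Real.enorm_of_nonneg (poleMass_pos hm hN).le] at ht
  refine le_of_tendsto ht ?_
  filter_upwards [self_mem_nhdsWithin] with ε hε
  have hε : 0 < ε := hε
  simp only [Function.comp_apply]
  rw [pole_representation x hN hε hu]
  refine (enorm_add_le _ _).trans (add_le_add ?_ ?_)
  · refine (enorm_integral_le_of_kernel_le x (c := 1) (g := fun y => ‖x - y‖ₑ ^ (-(2 * m)))
      (by simp) (fun y hy => radial_eq_zero x (fun _ => profile_eq_zero) hy)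
      fun y hy => ?_).trans ?_
    · rw [one_mul, Real.enorm_of_nonneg (profile_nonneg hm (radial_pos x hε y))]
      exact (ENNReal.ofReal_le_ofReal (profile_le_rpow hm (radial_pos x hε y))).trans
        (rpow_radial_le x hm.le hε y)
    · simp
  · refine (enorm_integral_le_of_kernel_le x (c := ENNReal.ofReal (bumpCoeff m)) (g := fun y => 1)
      (by simp) (fun y hy => radial_eq_zero x (fun _ => bumpProfile_eq_zero) hy)
      fun y hy => ?_).trans ?_
    · rw [mul_one, Real.enorm_of_nonneg (bumpProfile_nonneg hm _)]
      exact ENNReal.ofReal_le_ofReal (bumpProfile_le hm (radial_pos x hε y).le)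
    · simp

theorem abs_coord_sub_le (y : EuclideanSpace ℝ (Fin N)) (i : Fin N) :
    |y i - x i| ≤ ‖y - x‖ := by
  have := PiLp.norm_apply_le (y - x) i
  simpa using this

theorem gradient_potential_upper_bound (hm : 0 < m) (hN : (N : ℝ) = 2 * m + 2)
    {u : EuclideanSpace ℝ (Fin N) → ℝ} (hu : ContDiff ℝ 2 u) (i : Fin N) :
    ENNReal.ofReal (poleMass N m) * ‖pd i u x‖ₑ
      ≤ ENNReal.ofReal (2 * m) * (∫⁻ y in ball x 1, ‖x - y‖ₑ ^ (-(2 * m + 1)) * ‖lap u y‖ₑ)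
        + ENNReal.ofReal (4 * bumpCoeff m) * ∫⁻ y in ball x 1, ‖u y‖ₑ := by
  have ht := (continuous_enorm.tendsto _).comp
    (tendsto_pole hm hN (pd_continuous (hu.of_le (by norm_num)) i) x)
  rw [enorm_mul, Real.enorm_of_nonneg (poleMass_pos hm hN).le] at ht
  refine le_of_tendsto ht ?_
  filter_upwards [self_mem_nhdsWithin] with ε hε
  have hε : 0 < ε := hε
  simp only [Function.comp_apply]
  rw [pole_representation_pd x hN hε hu]
  refine (enorm_sub_le).trans (add_le_add ?_ ?_)
  · refine enorm_integral_le_of_kernel_le x (g := fun y => ‖x - y‖ₑ ^ (-(2 * m + 1)))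
      ENNReal.ofReal_ne_top (fun y hy => ?_) fun y hy => ?_
    · rw [radial_eq_zero x (fun _ => profile₁_eq_zero) hy, mul_zero]
    · have hτ := radial_pos x hε y
      have h2 : |y i - x i| ≤ (‖y - x‖ ^ 2 + ε ^ 2) ^ (1 / 2 : ℝ) := by
        rw [← Real.sqrt_eq_rpow]
        refine (abs_coord_sub_le x y i).trans (Real.le_sqrt_of_sq_le ?_)
        nlinarith
      have h3 : |2 * (y i - x i) * profile₁ m (‖y - x‖ ^ 2 + ε ^ 2)|
          ≤ 2 * m * (‖y - x‖ ^ 2 + ε ^ 2) ^ (-(m + 1 / 2)) := by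
        rw [abs_mul, abs_mul, abs_two]
        calc 2 * |y i - x i| * |profile₁ m (‖y - x‖ ^ 2 + ε ^ 2)|
            ≤ 2 * (‖y - x‖ ^ 2 + ε ^ 2) ^ (1 / 2 : ℝ)
              * (m * (‖y - x‖ ^ 2 + ε ^ 2) ^ (-m - 1)) := by
              gcongr
              exact abs_profile₁_le hm hτ
          _ = 2 * m * (‖y - x‖ ^ 2 + ε ^ 2) ^ (-(m + 1 / 2)) := by
              rw [show -(m + 1 / 2) = 1 / 2 + (-m - 1) by ring, Real.rpow_add hτ]; ring
      rw [Real.enorm_eq_ofReal_abs]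
      refine (ENNReal.ofReal_le_ofReal h3).trans ?_
      rw [ENNReal.ofReal_mul (by positivity)]
      gcongr
      have := rpow_radial_le x (s := m + 1 / 2) (by positivity) hε y
      rwa [show 2 * (m + 1 / 2) = 2 * m + 1 by ring] at this
  · refine (enorm_integral_le_of_kernel_le x (c := ENNReal.ofReal (4 * bumpCoeff m))
      (g := fun y => 1) ENNReal.ofReal_ne_top (fun y hy => ?_) fun y hy => ?_).trans ?_
    · rw [mem_ball, dist_eq_norm, not_lt] at hy
      rw [min_eq_right (by nlinarith [sq_nonneg ε])]
      simp
    · rw [mul_one, Real.enorm_eq_ofReal_abs]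
      refine ENNReal.ofReal_le_ofReal ?_
      rw [mem_ball, dist_eq_norm] at hy
      have h1 := abs_coord_sub_le x y i
      have h2 : |1 - min (‖y - x‖ ^ 2 + ε ^ 2) 1| ≤ 1 := by
        rw [abs_of_nonneg (by simp)]
        have : 0 ≤ min (‖y - x‖ ^ 2 + ε ^ 2) 1 := le_min (radial_pos x hε y).le zero_le_one
        linarith
      have h3 := bumpCoeff_pos hm
      rw [abs_mul, abs_mul, abs_neg, abs_mul, abs_mul, abs_two, abs_of_pos h3]
      calc 2 * |y i - x i| * (2 * bumpCoeff m * |1 - min (‖y - x‖ ^ 2 + ε ^ 2) 1|)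
          ≤ 2 * 1 * (2 * bumpCoeff m * 1) := by
            gcongr
            linarith
        _ = _ := by ring
    · simp

end PotentialEstimates

/-- `(u, v)` is a pair of globally `C²` functions which, on the ball of radius `ρ` around the
origin, are nonnegative and satisfy `-Δu ≈ v ^ p` and `-Δv ≈ u ^ q`, with constants `C₂`, `C₁`. -/
structure IsSol {N : ℕ} (p q C₁ C₂ ρ : ℝ) (u v : EuclideanSpace ℝ (Fin N) → ℝ) : Prop where
  contDiff_u : ContDiff ℝ 2 u
  contDiff_v : ContDiff ℝ 2 v
  u_nonneg : ∀ x ∈ ball 0 ρ, 0 ≤ u x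
  v_nonneg : ∀ x ∈ ball 0 ρ, 0 ≤ v x
  lower_u : ∀ x ∈ ball 0 ρ, C₂ * v x ^ p ≤ -lap u x
  lower_v : ∀ x ∈ ball 0 ρ, C₂ * u x ^ q ≤ -lap v x
  upper_u : ∀ x ∈ ball 0 ρ, -lap u x ≤ C₁ * v x ^ p
  upper_v : ∀ x ∈ ball 0 ρ, -lap v x ≤ C₁ * u x ^ q

section IntegralBounds

variable {N : ℕ} {p q C₁ C₂ ρ : ℝ} {u v : EuclideanSpace ℝ (Fin N) → ℝ}

theorem IsSol.symm (h : IsSol p q C₁ C₂ ρ u v) : IsSol q p C₁ C₂ ρ v u :=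
  ⟨h.contDiff_v, h.contDiff_u, h.v_nonneg, h.u_nonneg, h.lower_v, h.lower_u, h.upper_v, h.upper_u⟩

theorem IsSol.mono {ρ' : ℝ} (h : IsSol p q C₁ C₂ ρ u v) (hρ : ρ' ≤ ρ) :
    IsSol p q C₁ C₂ ρ' u v := by
  have hs : ∀ x ∈ ball (0 : EuclideanSpace ℝ (Fin N)) ρ', x ∈ ball 0 ρ :=
    fun x hx => ball_subset_ball hρ hx
  exact ⟨h.contDiff_u, h.contDiff_v, fun x hx => h.u_nonneg x (hs x hx),
    fun x hx => h.v_nonneg x (hs x hx), fun x hx => h.lower_u x (hs x hx),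
    fun x hx => h.lower_v x (hs x hx), fun x hx => h.upper_u x (hs x hx),
    fun x hx => h.upper_v x (hs x hx)⟩

theorem IsSol.lap_u_nonneg (h : IsSol p q C₁ C₂ ρ u v) (hC₂ : 0 < C₂)
    {x : EuclideanSpace ℝ (Fin N)} (hx : x ∈ ball 0 ρ) : 0 ≤ -lap u x :=
  (mul_nonneg hC₂.le (Real.rpow_nonneg (h.v_nonneg x hx) p)).trans (h.lower_u x hx)

/-- Local lower bounds by averages, in all dimensions at least three. -/
theorem exists_average_le (hN : 3 ≤ N) : ∃ c > 0, ∀ (u : EuclideanSpace ℝ (Fin N) → ℝ)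
    (z x : EuclideanSpace ℝ (Fin N)), ContDiff ℝ 2 u → (∀ y ∈ ball x 1, 0 ≤ u y) →
    (∀ y ∈ ball x 1, 0 ≤ -lap u y) → x ∈ ball z (1 / 4) →
    c * (∫ y in ball z (1 / 4), -lap u y) ≤ u x ∧ c * (∫ y in ball z (1 / 4), u y) ≤ u x := by
  set m : ℝ := ((N : ℝ) - 2) / 2 with hmdef
  have hm : 0 < m := by
    have : (3 : ℝ) ≤ N := by exact_mod_cast hN
    rw [hmdef]; linarith
  have hNm : (N : ℝ) = 2 * m + 2 := by rw [hmdef]; ring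
  have hK := poleMass_pos hm hNm
  have hA := profile_half_pos hm
  have hB := bumpCoeff_pos hm
  refine ⟨min (profile m (1 / 2)) (bumpCoeff m / 4) / poleMass N m, by positivity, ?_⟩
  intro u z x hu hpos hsup hx
  have h := potential_lower_bound x hm hNm hu hpos hsup
  have hsub : ball z (1 / 4) ⊆ ball x (1 / 2) := by
    refine ball_subset_ball' ?_
    rw [mem_ball, dist_comm] at hx
    linarith
  have hlap : Continuous (fun y => -lap u y) := (lap_continuous hu).neg
  have key : ∀ w : EuclideanSpace ℝ (Fin N) → ℝ, Continuous w → (∀ y ∈ ball x 1, 0 ≤ w y) →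
      0 ≤ ∫ y in ball z (1 / 4), w y ∧
        ∫ y in ball z (1 / 4), w y ≤ ∫ y in ball x (1 / 2), w y := by
    intro w hw hw0
    have hi : IntegrableOn w (ball x (1 / 2)) :=
      (hw.continuousOn.integrableOn_compact
        (isCompact_closedBall x (1 / 2))).mono_set ball_subset_closedBall
    have hw1 : ∀ y ∈ ball x (1 / 2), 0 ≤ w y := fun y hy =>
      hw0 y (ball_subset_ball (by norm_num) hy)
    refine ⟨setIntegral_nonneg measurableSet_ball fun y hy => hw1 y (hsub hy), ?_⟩
    exact setIntegral_mono_set hi ((ae_restrict_iff' measurableSet_ball).2 (ae_of_all _ hw1))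
      (ae_of_all _ hsub)
  obtain ⟨f1, f2⟩ := key _ hlap hsup
  obtain ⟨u1, u2⟩ := key _ hu.continuous hpos
  have m1 : min (profile m (1 / 2)) (bumpCoeff m / 4) ≤ profile m (1 / 2) := min_le_left _ _
  have m2 : min (profile m (1 / 2)) (bumpCoeff m / 4) ≤ bumpCoeff m / 4 := min_le_right _ _
  have hB4 : 0 < bumpCoeff m / 4 := by positivity
  rw [div_mul_eq_mul_div, div_mul_eq_mul_div, div_le_iff₀ hK, div_le_iff₀ hK, mul_comm (u x)]
  constructor
  · have := mul_le_mul m1 f2 f1 hA.le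
    have := mul_nonneg hB4.le (u1.trans u2)
    linarith
  · have := mul_le_mul m2 u2 u1 hB4.le
    have := mul_nonneg hA.le (f1.trans f2)
    linarith

theorem exists_bound_of_superlinear {A s : ℝ} (hA : 0 < A) (hs : 1 < s) :
    ∃ M, ∀ I : ℝ, 0 ≤ I → A * I ^ s ≤ I → I ≤ M := by
  refine ⟨(A⁻¹) ^ (1 / (s - 1)), fun I hI h => ?_⟩
  rcases hI.eq_or_lt with rfl | hI
  · positivity
  have h1 : I ^ s = I ^ (s - 1) * I := by
    rw [← Real.rpow_add_one hI.ne']; ring_nf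
  have h2 : I ^ (s - 1) ≤ A⁻¹ := by
    rw [h1, ← mul_assoc] at h
    rw [← one_div, le_div_iff₀ hA, mul_comm]
    exact (mul_le_iff_le_one_left hI).1 h
  have h3 : I = (I ^ (s - 1)) ^ (1 / (s - 1)) := by
    rw [← Real.rpow_mul hI.le, mul_one_div_cancel (by linarith), Real.rpow_one]
  rw [h3]
  exact Real.rpow_le_rpow (by positivity) h2 (by rw [one_div_nonneg]; linarith)

theorem exists_bound_of_coupled {a b : ℝ} (ha : 0 < a) (hb : 0 < b) (hp : 0 < p)
    (hpq : 1 < p * q) : ∃ M, ∀ I J : ℝ, 0 ≤ I → 0 ≤ J → b * (a * I) ^ q ≤ J →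
      b * (a * J) ^ p ≤ I → I ≤ M := by
  obtain ⟨M, hM⟩ := exists_bound_of_superlinear (A := b * a ^ p * (b ^ p * a ^ (q * p)))
    (by positivity) (s := p * q) hpq
  refine ⟨M, fun I J hI hJ h1 h2 => hM I hI (le_trans ?_ h2)⟩
  rw [Real.mul_rpow ha.le hJ, ← mul_assoc b, mul_assoc (b * a ^ p)]
  gcongr
  calc b ^ p * a ^ (q * p) * I ^ (p * q) = (b * (a * I) ^ q) ^ p := by
        rw [Real.mul_rpow hb.le (by positivity), ← Real.rpow_mul (by positivity),
          Real.mul_rpow ha.le hI, mul_comm p q, mul_assoc]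
    _ ≤ J ^ p := Real.rpow_le_rpow (by positivity) h1 hp.le

theorem exists_local_bound (hN : 3 ≤ N) (hp : 0 < p) (hq : 0 < q) (hpq : 1 < p * q)
    (hC₂ : 0 < C₂) (C₁ : ℝ) : ∃ M, ∀ (ρ : ℝ) (u v : EuclideanSpace ℝ (Fin N) → ℝ)
      (z : EuclideanSpace ℝ (Fin N)), IsSol p q C₁ C₂ ρ u v → ‖z‖ + 2 ≤ ρ →
      ∫ y in ball z (1 / 4), v y ^ p ≤ M ∧ ∫ y in ball z (1 / 4), u y ≤ M := by
  obtain ⟨c, hc, hav⟩ := exists_average_le hN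
  set b : ℝ := volume.real (ball (0 : EuclideanSpace ℝ (Fin N)) (1 / 4)) with hbdef
  have hb : 0 < b := by
    refine ENNReal.toReal_pos (measure_ball_pos _ _ (by norm_num)).ne' measure_ball_lt_top.ne
  set a : ℝ := c * min C₂ 1 with hadef
  have ha : 0 < a := by positivity
  have hac : a ≤ c := by
    have := min_le_right C₂ 1
    rw [hadef]; nlinarith
  have hac2 : a ≤ c * C₂ := by
    have := min_le_left C₂ 1
    rw [hadef]; nlinarith
  obtain ⟨M₁, hM₁⟩ := exists_bound_of_coupled ha hb hp hpq
  obtain ⟨M₂, hM₂⟩ := exists_bound_of_coupled ha hb hq (by rwa [mul_comm])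
  have main : ∀ (p q : ℝ) (ρ : ℝ) (u v : EuclideanSpace ℝ (Fin N) → ℝ)
      (z : EuclideanSpace ℝ (Fin N)), 0 < p → 0 < q → IsSol p q C₁ C₂ ρ u v → ‖z‖ + 2 ≤ ρ →
      0 ≤ ∫ y in ball z (1 / 4), v y ^ p ∧ 0 ≤ ∫ y in ball z (1 / 4), u y ∧
      b * (a * ∫ y in ball z (1 / 4), v y ^ p) ^ q ≤ ∫ y in ball z (1 / 4), u y ^ q ∧
      b * (a * ∫ y in ball z (1 / 4), u y) ^ q ≤ ∫ y in ball z (1 / 4), u y ^ q := by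
    intro p q ρ u v z hp hq h hz
    have hdom : ∀ x ∈ ball z (1 / 4), ∀ y ∈ ball x 1, y ∈ ball 0 ρ := by
      intro x hx y hy
      rw [mem_ball, dist_zero_right]
      rw [mem_ball, dist_eq_norm] at hx hy
      calc ‖y‖ = ‖(y - x) + (x - z) + z‖ := by congr 1; abel
        _ ≤ ‖y - x‖ + ‖x - z‖ + ‖z‖ := norm_add₃_le
        _ < ρ := by linarith
    have hd0 : ∀ x ∈ ball z (1 / 4), x ∈ ball 0 ρ := fun x hx => hdom x hx x (by simp)
    have hI0 : 0 ≤ ∫ y in ball z (1 / 4), v y ^ p := setIntegral_nonneg measurableSet_ball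
      fun y hy => Real.rpow_nonneg (h.v_nonneg y (hd0 y hy)) _
    have hU0 : 0 ≤ ∫ y in ball z (1 / 4), u y := setIntegral_nonneg measurableSet_ball
      fun y hy => h.u_nonneg y (hd0 y hy)
    have hintg : ∀ w : EuclideanSpace ℝ (Fin N) → ℝ, Continuous w →
        IntegrableOn w (ball z (1 / 4)) := fun w hw =>
      (hw.continuousOn.integrableOn_compact
        (isCompact_closedBall z (1 / 4))).mono_set ball_subset_closedBall
    have hcont : ∀ (w : EuclideanSpace ℝ (Fin N) → ℝ) (r : ℝ), Continuous w → 0 < r →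
      Continuous (fun y => w y ^ r) := fun w r hw hr => hw.rpow_const fun _ => Or.inr hr.le
    have hlow : ∀ x ∈ ball z (1 / 4), a * (∫ y in ball z (1 / 4), v y ^ p) ≤ u x ∧
        a * (∫ y in ball z (1 / 4), u y) ≤ u x := by
      intro x hx
      obtain ⟨h1, h2⟩ := hav u z x h.contDiff_u (fun y hy => h.u_nonneg y (hdom x hx y hy))
        (fun y hy => h.lap_u_nonneg hC₂ (hdom x hx y hy)) hx
      refine ⟨?_, (mul_le_mul_of_nonneg_right hac hU0).trans h2⟩
      have h3 : C₂ * (∫ y in ball z (1 / 4), v y ^ p) ≤ ∫ y in ball z (1 / 4), -lap u y := by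
        rw [← integral_const_mul]
        exact setIntegral_mono_on ((hintg _ (hcont v p h.contDiff_v.continuous hp)).const_mul _)
          (hintg _ (lap_continuous h.contDiff_u).neg) measurableSet_ball
          fun y hy => h.lower_u y (hd0 y hy)
      calc _ ≤ c * C₂ * (∫ y in ball z (1 / 4), v y ^ p) := mul_le_mul_of_nonneg_right hac2 hI0
        _ = c * (C₂ * (∫ y in ball z (1 / 4), v y ^ p)) := by ring
        _ ≤ _ := (mul_le_mul_of_nonneg_left h3 hc.le).trans h1
    have hfin : ∀ t : ℝ, 0 ≤ t → (∀ x ∈ ball z (1 / 4), t ≤ u x) →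
        b * t ^ q ≤ ∫ y in ball z (1 / 4), u y ^ q := by
      intro t ht htu
      have h1 : b * t ^ q = ∫ y in ball z (1 / 4), t ^ q := by
        rw [setIntegral_const, smul_eq_mul, hbdef]
        congr 1
        rw [measureReal_def, measureReal_def, Measure.addHaar_ball_center volume z]
      rw [h1]
      exact setIntegral_mono_on (hintg _ continuous_const)
        (hintg _ (hcont u q h.contDiff_u.continuous hq)) measurableSet_ball
        fun y hy => Real.rpow_le_rpow ht (htu y hy) hq.le
    exact ⟨hI0, hU0, hfin _ (mul_nonneg ha.le hI0) fun x hx => (hlow x hx).1,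
      hfin _ (mul_nonneg ha.le hU0) fun x hx => (hlow x hx).2⟩
  refine ⟨max M₁ ((M₂ / b) ^ (1 / q) / a), fun ρ u v z h hz => ?_⟩
  obtain ⟨a1, a2, a3, a4⟩ := main p q ρ u v z hp hq h hz
  obtain ⟨b1, b2, b3, b4⟩ := main q p ρ v u z hq hp h.symm hz
  have hJ := hM₂ _ _ b1 a1 b3 a3
  refine ⟨le_max_of_le_left (hM₁ _ _ a1 b1 a3 b3), le_max_of_le_right ?_⟩
  have h5 : (a * ∫ y in ball z (1 / 4), u y) ^ q ≤ M₂ / b := by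
    rw [le_div_iff₀ hb, mul_comm]; exact a4.trans hJ
  rw [le_div_iff₀ ha, mul_comm]
  have h6 : 0 ≤ a * ∫ y in ball z (1 / 4), u y := mul_nonneg ha.le a2
  calc a * ∫ y in ball z (1 / 4), u y
      = ((a * ∫ y in ball z (1 / 4), u y) ^ q) ^ (1 / q) := by
        rw [← Real.rpow_mul h6, mul_one_div_cancel hq.ne', Real.rpow_one]
    _ ≤ _ := Real.rpow_le_rpow (Real.rpow_nonneg h6 _) h5 (by positivity)

theorem lintegral_le_of_finite_cover {X : Type*} [MeasurableSpace X] {μ : Measure X}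
    {t : Set X} (ht : t.Finite) {s : Set X} {B : X → Set X} (hs : s ⊆ ⋃ z ∈ t, B z)
    {f : X → ENNReal} {M : ENNReal} (hM : ∀ z ∈ t, ∫⁻ y in B z, f y ∂μ ≤ M) :
    ∫⁻ y in s, f y ∂μ ≤ ht.toFinset.card * M := by
  calc ∫⁻ y in s, f y ∂μ ≤ ∫⁻ y in ⋃ z ∈ t, B z, f y ∂μ := lintegral_mono_set hs
    _ = ∫⁻ y in ⋃ z : ht.toFinset, B z, f y ∂μ := by
        congr 2
        ext y
        simp
    _ ≤ ∑' z : ht.toFinset, ∫⁻ y in B z, f y ∂μ := lintegral_iUnion_le _ _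
    _ ≤ ∑' z : ht.toFinset, M :=
        ENNReal.tsum_le_tsum fun z => hM z (ht.mem_toFinset.1 z.2)
    _ = _ := by rw [tsum_fintype, Finset.sum_const, Finset.card_univ, Fintype.card_coe,
        nsmul_eq_mul]

theorem exists_integral_bound (hN : 3 ≤ N) (hp : 0 < p) (hq : 0 < q) (hpq : 1 < p * q)
    (hC₂ : 0 < C₂) (C₁ : ℝ) : ∃ M : NNReal, ∀ (u v : EuclideanSpace ℝ (Fin N) → ℝ),
      IsSol p q C₁ C₂ (5 * N) u v →
      ∫⁻ y in ball 0 (4 * N), ‖v y ^ p‖ₑ ≤ M ∧ ∫⁻ y in ball 0 (4 * N), ‖u y‖ₑ ≤ M := by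
  obtain ⟨M, hM⟩ := exists_local_bound hN hp hq hpq hC₂ C₁
  obtain ⟨t, ht1, ht2, ht3⟩ := (isCompact_closedBall (0 : EuclideanSpace ℝ (Fin N))
    (4 * N)).finite_cover_balls (e := 1 / 4) (by norm_num)
  refine ⟨ht2.toFinset.card * M.toNNReal, fun u v h => ?_⟩
  have hN3 : (3 : ℝ) ≤ N := by exact_mod_cast hN
  have hz : ∀ z ∈ t, ‖z‖ + 2 ≤ 5 * N := by
    intro z hz
    have := ht1 hz
    rw [mem_closedBall, dist_zero_right] at this
    linarith
  have hd : ∀ z ∈ t, ∀ y ∈ ball z (1 / 4), y ∈ ball 0 (5 * N : ℝ) := by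
    intro z hzt y hy
    have := hz z hzt
    rw [mem_ball, dist_zero_right]
    rw [mem_ball, dist_eq_norm] at hy
    have h3 := norm_add_le (y - z) z
    rw [sub_add_cancel] at h3
    linarith
  have hsub := ball_subset_closedBall.trans ht3
  have key : ∀ w : EuclideanSpace ℝ (Fin N) → ℝ, Continuous w →
      (∀ z ∈ t, ∀ y ∈ ball z (1 / 4), 0 ≤ w y) →
      (∀ z ∈ t, ∫ y in ball z (1 / 4), w y ≤ M) →
      ∫⁻ y in ball 0 (4 * N), ‖w y‖ₑ ≤ (ht2.toFinset.card * M.toNNReal : NNReal) := by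
    intro w hw hw0 hwM
    refine (lintegral_le_of_finite_cover ht2 hsub (M := ENNReal.ofReal M) fun z hzt => ?_).trans ?_
    · have hi : IntegrableOn w (ball z (1 / 4)) := (hw.continuousOn.integrableOn_compact
        (isCompact_closedBall z (1 / 4))).mono_set ball_subset_closedBall
      have h1 : 0 ≤ᵐ[volume.restrict (ball z (1 / 4))] w :=
        (ae_restrict_iff' measurableSet_ball).2 (ae_of_all _ (hw0 z hzt))
      have h2 := ofReal_integral_eq_lintegral_ofReal hi h1
      have h3 : ∫⁻ y in ball z (1 / 4), ‖w y‖ₑ = ∫⁻ y in ball z (1 / 4), ENNReal.ofReal (w y) :=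
        setLIntegral_congr_fun measurableSet_ball fun y hy => Real.enorm_of_nonneg (hw0 z hzt y hy)
      rw [h3, ← h2]
      exact ENNReal.ofReal_le_ofReal (hwM z hzt)
    · push_cast
      rfl
  exact ⟨key _ (h.contDiff_v.continuous.rpow_const fun _ => Or.inr hp.le)
    (fun z hzt y hy => Real.rpow_nonneg (h.v_nonneg y (hd z hzt y hy)) _)
    fun z hzt => (hM _ u v z h (hz z hzt)).1, key _ h.contDiff_u.continuous
    (fun z hzt y hy => h.u_nonneg y (hd z hzt y hy)) fun z hzt => (hM _ u v z h (hz z hzt)).2⟩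

end IntegralBounds

section SchurTest

theorem lintegral_kernel_rpow_le {X Y : Type*} [MeasurableSpace X] [MeasurableSpace Y]
    {μ : Measure X} {ν : Measure Y} [SFinite μ] [SFinite ν] {K : X → Y → ENNReal}
    (hK : Measurable (Function.uncurry K)) {f : Y → ENNReal} (hf : Measurable f) {k z s : ℝ}
    (hk : 1 ≤ k) (hz : k ≤ z) (hs : 1 / s = 1 + 1 / z - 1 / k) {A : ENNReal}
    (h1 : ∀ x, ∫⁻ y, K x y ^ s ∂ν ≤ A) (h2 : ∀ y, ∫⁻ x, K x y ^ s ∂μ ≤ A) :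
    ∫⁻ x, (∫⁻ y, K x y * f y ∂ν) ^ z ∂μ
      ≤ A ^ (z * (1 - 1 / k) + 1) * (∫⁻ y, f y ^ k ∂ν) ^ (z / k) := by
  have hk0 : 0 < k := by linarith
  have hz0 : 0 < z := by linarith
  have hkz : 1 / z ≤ 1 / k := one_div_le_one_div_of_le hk0 hz
  have hk1 : 1 / k ≤ 1 := by rw [div_le_one hk0]; exact hk
  have hz1 : 0 < 1 / z := by positivity
  have hs0 : 0 < s := by
    have : 0 < 1 / s := by rw [hs]; linarith
    exact one_div_pos.1 this
  have hKx : ∀ x, Measurable (K x) := fun x => hK.comp measurable_prodMk_left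
  have hKy : ∀ y, Measurable fun x => K x y := fun y => hK.comp measurable_prodMk_right
  set M := ∫⁻ y, f y ^ k ∂ν with hM
  have hpt : ∀ x, (∫⁻ y, K x y * f y ∂ν) ^ z
      ≤ (∫⁻ y, K x y ^ s * f y ^ k ∂ν) * A ^ (z * (1 - 1 / k)) * M ^ (z / k - 1) := by
    intro x
    have hol : ∫⁻ y, K x y * f y ∂ν ≤ (∫⁻ y, K x y ^ s * f y ^ k ∂ν) ^ (1 / z)
        * (∫⁻ y, K x y ^ s ∂ν) ^ (1 - 1 / k) * M ^ (1 / k - 1 / z) := by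
      have h := ENNReal.lintegral_prod_norm_pow_le (μ := ν) (Finset.univ : Finset (Fin 3))
        (f := ![fun y => K x y ^ s * f y ^ k, fun y => K x y ^ s, fun y => f y ^ k])
        (p := ![1 / z, 1 - 1 / k, 1 / k - 1 / z]) ?_ ?_ ?_
      · simp only [Fin.prod_univ_three, Matrix.cons_val_zero, Matrix.cons_val_one,
          Matrix.cons_val] at h
        refine le_trans (lintegral_mono fun y => ?_) h
        rw [ENNReal.mul_rpow_of_nonneg _ _ hz1.le, ← ENNReal.rpow_mul, ← ENNReal.rpow_mul,
          ← ENNReal.rpow_mul, ← ENNReal.rpow_mul]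
        have e1 : s * (1 / z) + s * (1 - 1 / k) = 1 := by
          have : s * (1 / s) = 1 := mul_one_div_cancel hs0.ne'
          rw [hs] at this; linarith
        have e2 : k * (1 / z) + k * (1 / k - 1 / z) = 1 := by
          have : k * (1 / k) = 1 := mul_one_div_cancel hk0.ne'
          linarith
        have e3 : K x y = K x y ^ (s * (1 / z)) * K x y ^ (s * (1 - 1 / k)) := by
          rw [← ENNReal.rpow_add_of_nonneg _ _ (by positivity)
            (mul_nonneg hs0.le (by linarith)), e1, ENNReal.rpow_one]
        have e4 : f y = f y ^ (k * (1 / z)) * f y ^ (k * (1 / k - 1 / z)) := by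
          rw [← ENNReal.rpow_add_of_nonneg _ _ (by positivity)
            (mul_nonneg hk0.le (by linarith)), e2, ENNReal.rpow_one]
        refine le_of_eq ?_
        conv_lhs => rw [e3, e4]
        ring
      · intro i _
        fin_cases i
        · exact (((hKx x).pow_const s).mul (hf.pow_const k)).aemeasurable
        · exact ((hKx x).pow_const s).aemeasurable
        · exact (hf.pow_const k).aemeasurable
      · simp [Fin.sum_univ_three]
        ring
      · intro i _
        fin_cases i
        · exact hz1.le
        · simpa using hk1
        · simpa using hkz
    calc (∫⁻ y, K x y * f y ∂ν) ^ z
        ≤ ((∫⁻ y, K x y ^ s * f y ^ k ∂ν) ^ (1 / z)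
          * A ^ (1 - 1 / k) * M ^ (1 / k - 1 / z)) ^ z := by
          refine ENNReal.rpow_le_rpow (hol.trans ?_) hz0.le
          gcongr
          exact h1 x
      _ = _ := by
          rw [ENNReal.mul_rpow_of_nonneg _ _ hz0.le, ENNReal.mul_rpow_of_nonneg _ _ hz0.le,
            ← ENNReal.rpow_mul, ← ENNReal.rpow_mul, ← ENNReal.rpow_mul,
            one_div_mul_cancel hz0.ne', ENNReal.rpow_one]
          congr 2
          · rw [mul_comm]
          · field_simp
  have hmeas : Measurable (Function.uncurry fun x y => K x y ^ s * f y ^ k) :=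
    (hK.pow_const s).mul ((hf.comp measurable_snd).pow_const k)
  calc ∫⁻ x, (∫⁻ y, K x y * f y ∂ν) ^ z ∂μ
      ≤ ∫⁻ x, (∫⁻ y, K x y ^ s * f y ^ k ∂ν) * A ^ (z * (1 - 1 / k)) * M ^ (z / k - 1) ∂μ :=
        lintegral_mono hpt
    _ = (∫⁻ y, ∫⁻ x, K x y ^ s * f y ^ k ∂μ ∂ν) * A ^ (z * (1 - 1 / k)) * M ^ (z / k - 1) := by
        have m1 : Measurable fun x => ∫⁻ y, K x y ^ s * f y ^ k ∂ν := hmeas.lintegral_prod_right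
        rw [lintegral_mul_const _ (m1.mul_const _), lintegral_mul_const _ m1,
          lintegral_lintegral_swap hmeas.aemeasurable]
    _ ≤ (A * M) * A ^ (z * (1 - 1 / k)) * M ^ (z / k - 1) := by
        gcongr
        rw [hM, ← lintegral_const_mul _ (hf.pow_const k)]
        refine lintegral_mono fun y => ?_
        rw [lintegral_mul_const _ ((hKy y).pow_const s)]
        gcongr
        exact h2 y
    _ = A ^ (z * (1 - 1 / k) + 1) * M ^ (z / k) := by
        have e1 : M ^ (z / k) = M * M ^ (z / k - 1) := by
          have : z / k = 1 + (z / k - 1) := by ring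
          conv_lhs => rw [this]
          rw [ENNReal.rpow_add_of_nonneg _ _ zero_le_one (by
            rw [sub_nonneg, one_le_div hk0]; exact hz), ENNReal.rpow_one]
        have e2 : A ^ (z * (1 - 1 / k) + 1) = A ^ (z * (1 - 1 / k)) * A := by
          rw [ENNReal.rpow_add_of_nonneg _ _ (mul_nonneg hz0.le (by linarith)) zero_le_one,
            ENNReal.rpow_one]
        rw [e1, e2]
        ring

end SchurTest

section Cubes

/-- Lebesgue measure restricted to the cube `[-R, R]^n`. -/
noncomputable def cube (n : ℕ) (R : ℝ) : Measure (Fin n → ℝ) :=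
  Measure.pi fun _ => volume.restrict (Icc (-R) R)

instance (n : ℕ) (R : ℝ) : IsFiniteMeasure (cube n R) := by unfold cube; infer_instance

theorem cube_eq (n : ℕ) (R : ℝ) :
    cube n R = volume.restrict (Icc (fun _ => -R) (fun _ => R)) := by
  rw [← pi_univ_Icc, volume_pi, Measure.restrict_pi_pi, cube]

theorem lintegral_cube_succ {n : ℕ} {R : ℝ} (i : Fin (n + 1)) {f : (Fin (n + 1) → ℝ) → ENNReal}
    (hf : Measurable f) : ∫⁻ x, f x ∂cube (n + 1) R
      = ∫⁻ t in Icc (-R) R, ∫⁻ x, f (i.insertNth t x) ∂cube n R := by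
  have h := (measurePreserving_piFinSuccAbove
    (fun _ : Fin (n + 1) => volume.restrict (Icc (-R) R)) i).symm
  rw [cube, ← h.lintegral_comp hf, lintegral_prod]
  · rfl
  · exact (hf.comp (MeasurableEquiv.measurable _)).aemeasurable

theorem lintegral_cube_prod {R : ℝ} {n : ℕ} (f : Fin n → ℝ → ENNReal)
    (hf : ∀ i, Measurable (f i)) :
    ∫⁻ x, ∏ i, f i (x i) ∂cube n R = ∏ i, ∫⁻ t in Icc (-R) R, f i t := by
  induction n with
  | zero => simp [cube]
  | succ n ih =>
    have hm : Measurable fun x : Fin (n + 1) → ℝ => ∏ i, f i (x i) :=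
      Finset.measurable_prod _ fun i _ => (hf i).comp (measurable_pi_apply i)
    rw [lintegral_cube_succ 0 hm, Fin.prod_univ_succ, ← ih (fun i => f i.succ) fun i => hf _,
      ← lintegral_mul_const _ (hf 0)]
    refine lintegral_congr fun t => ?_
    rw [← lintegral_const_mul]
    · refine lintegral_congr fun x => ?_
      rw [Fin.prod_univ_succ]
      simp
    · exact Finset.measurable_prod _ fun i _ => (hf _).comp (measurable_pi_apply i)

/-- Uniform bound of the one-dimensional singular integrals. -/
theorem exists_singular_bound {e : ℝ} (he0 : 0 < e) (he : e < 1) (R : ℝ) :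
    ∃ D : NNReal, ∀ x : ℝ, ∫⁻ t in Icc (-R) R, ‖x - t‖ₑ ^ (-e) ≤ D := by
  have hfin : ∫⁻ t in Icc (-1 : ℝ) 1, ‖t‖ₑ ^ (-e) ≠ ⊤ := by
    have hpos : ∫⁻ t in Ioc (0 : ℝ) 1, ‖t‖ₑ ^ (-e) ≠ ⊤ := by
      have h := (intervalIntegral.intervalIntegrable_rpow' (a := 0) (b := 1) (r := -e)
        (by linarith)).1
      have h2 := h.lintegral_lt_top.ne
      rwa [setLIntegral_congr_fun (g := fun t : ℝ => ENNReal.ofReal (t ^ (-e))) measurableSet_Ioc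
        fun t ht => ?_]
      rw [Real.enorm_of_nonneg ht.1.le, ENNReal.ofReal_rpow_of_pos ht.1]
    have hneg : ∫⁻ t in Ico (-1 : ℝ) 0, ‖t‖ₑ ^ (-e) ≠ ⊤ := by
      have h := (Measure.measurePreserving_neg (volume : Measure ℝ)).setLIntegral_comp_preimage
        (s := Ioc (0 : ℝ) 1) measurableSet_Ioc (f := fun t : ℝ => ‖t‖ₑ ^ (-e))
        (by fun_prop)
      simp only [enorm_neg, Set.neg_preimage, Set.neg_Ioc, neg_zero] at h
      rwa [h]
    have hsub : Icc (-1 : ℝ) 1 ⊆ (Ico (-1) 0 ∪ Ioc 0 1) ∪ {0} := by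
      intro t ht
      rcases lt_trichotomy t 0 with h | h | h
      · exact Or.inl (Or.inl ⟨ht.1, h⟩)
      · exact Or.inr h
      · exact Or.inl (Or.inr ⟨h, ht.2⟩)
    refine ne_top_of_le_ne_top ?_ ((lintegral_mono_set hsub).trans ((lintegral_union_le _ _ _).trans
      (add_le_add (lintegral_union_le _ _ _) le_rfl)))
    simp [hpos, hneg]
  set S := ∫⁻ t in Icc (-1 : ℝ) 1, ‖t‖ₑ ^ (-e) with hS
  refine ⟨S.toNNReal + (2 * R).toNNReal, fun x => ?_⟩
  have hm : Measurable fun t : ℝ => (Icc (-1 : ℝ) 1).indicator (fun t => ‖t‖ₑ ^ (-e)) (t - x) :=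
    Measurable.comp (g := (Icc (-1 : ℝ) 1).indicator (fun t => ‖t‖ₑ ^ (-e)))
      (Measurable.indicator (by fun_prop) measurableSet_Icc) (measurable_id.sub_const x)
  have hpt : ∀ t : ℝ, ‖x - t‖ₑ ^ (-e)
      ≤ (Icc (-1 : ℝ) 1).indicator (fun t => ‖t‖ₑ ^ (-e)) (t - x) + 1 := by
    intro t
    rw [← enorm_neg (x - t), neg_sub]
    by_cases ht : t - x ∈ Icc (-1 : ℝ) 1
    · rw [indicator_of_mem ht]
      exact le_self_add
    · rw [indicator_of_notMem ht, zero_add, ENNReal.rpow_neg, ENNReal.inv_le_one]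
      refine ENNReal.one_le_rpow ?_ he0
      rw [← abs_le.trans (by rfl : _ ↔ t - x ∈ Icc (-1 : ℝ) 1), not_le] at ht
      rw [Real.enorm_eq_ofReal_abs, ENNReal.one_le_ofReal]
      exact ht.le
  calc ∫⁻ t in Icc (-R) R, ‖x - t‖ₑ ^ (-e)
      ≤ ∫⁻ t in Icc (-R) R, ((Icc (-1 : ℝ) 1).indicator (fun t => ‖t‖ₑ ^ (-e)) (t - x) + 1) :=
        lintegral_mono fun t => hpt t
    _ = (∫⁻ t in Icc (-R) R, (Icc (-1 : ℝ) 1).indicator (fun t => ‖t‖ₑ ^ (-e)) (t - x))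
        + volume (Icc (-R) R) := by rw [lintegral_add_left hm]; simp
    _ ≤ (∫⁻ t, (Icc (-1 : ℝ) 1).indicator (fun t => ‖t‖ₑ ^ (-e)) (t - x))
        + volume (Icc (-R) R) := by gcongr; exact Measure.restrict_le_self
    _ = S + ENNReal.ofReal (2 * R) := by
        rw [lintegral_sub_right_eq_self (fun t => (Icc (-1 : ℝ) 1).indicator
          (fun t => ‖t‖ₑ ^ (-e)) t) x, lintegral_indicator measurableSet_Icc, Real.volume_Icc]
        congr 2
        ring
    _ = _ := by
        rw [ENNReal.coe_add, ENNReal.coe_toNNReal hfin]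
        rfl

/-- Anisotropic majorant of the singular part of the potential kernel along the coordinates
transversal to the `i`-th one. -/
noncomputable def sideKernel {n : ℕ} (lam : ℝ) (i : Fin (n + 1)) (x' : Fin n → ℝ)
    (y : Fin (n + 1) → ℝ) : ENNReal := ∏ l, ‖x' l - y (i.succAbove l)‖ₑ ^ (-lam)

theorem sideKernel_rpow {n : ℕ} (lam s : ℝ) (hs : 0 ≤ s) (i : Fin (n + 1)) (x' : Fin n → ℝ)
    (y : Fin (n + 1) → ℝ) : sideKernel lam i x' y ^ s = sideKernel (lam * s) i x' y := by
  unfold sideKernel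
  rw [← ENNReal.prod_rpow_of_nonneg hs]
  refine Finset.prod_congr rfl fun l _ => ?_
  rw [← ENNReal.rpow_mul]
  ring_nf

theorem measurable_sideKernel {n : ℕ} (lam : ℝ) (i : Fin (n + 1)) :
    Measurable (Function.uncurry (sideKernel (n := n) lam i)) := by
  unfold sideKernel Function.uncurry
  fun_prop

theorem exists_slice_bound {n : ℕ} {a lam k z s : ℝ} (R : ℝ) (ha0 : 0 < a) (ha1 : a < 1)
    (hlam : 0 < lam) (hk : 1 ≤ k) (hz : k ≤ z) (hs : 1 / s = 1 + 1 / z - 1 / k)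
    (hls : lam * s < 1) : ∃ C : NNReal, ∀ (i : Fin (n + 1)) (t : ℝ)
      (f : (Fin (n + 1) → ℝ) → ENNReal), Measurable f →
      ∫⁻ x', (∫⁻ y, ‖t - y i‖ₑ ^ (-a) * sideKernel lam i x' y * f y ∂cube (n + 1) R) ^ z ∂cube n R
        ≤ C * (∫⁻ y, ‖t - y i‖ₑ ^ (-a) * f y ^ k ∂cube (n + 1) R) ^ (z / k) := by
  have hk0 : 0 < k := by linarith
  have hz0 : 0 < z := by linarith
  have hk1 : 1 / k ≤ 1 := by rw [div_le_one hk0]; exact hk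
  have hs0 : 0 < s := by
    have : 0 < 1 / s := by
      rw [hs]
      have : 0 < 1 / z := by positivity
      linarith
    exact one_div_pos.1 this
  obtain ⟨D₁, hD₁⟩ := exists_singular_bound ha0 ha1 R
  obtain ⟨D₂, hD₂⟩ := exists_singular_bound (mul_pos hlam hs0) hls R
  set A : NNReal := max (D₁ * D₂ ^ n) (D₂ ^ n) with hA
  have hexp : 0 ≤ z * (1 - 1 / k) + 1 := by
    have := mul_nonneg hz0.le (sub_nonneg.2 hk1)
    linarith
  refine ⟨A ^ (z * (1 - 1 / k) + 1), fun i t f hf => ?_⟩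
  have hw : Measurable fun y : Fin (n + 1) → ℝ => ‖t - y i‖ₑ ^ (-a) := by fun_prop
  have hsk : ∀ (lam : ℝ) (x' : Fin n → ℝ), Measurable (sideKernel lam i x') := fun lam x' =>
    (measurable_sideKernel lam i).comp measurable_prodMk_left
  set ν := (cube (n + 1) R).withDensity fun y => ‖t - y i‖ₑ ^ (-a) with hν
  have hνint : ∀ g : (Fin (n + 1) → ℝ) → ENNReal, Measurable g →
      ∫⁻ y, g y ∂ν = ∫⁻ y, ‖t - y i‖ₑ ^ (-a) * g y ∂cube (n + 1) R := fun g hg => by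
    rw [hν, lintegral_withDensity_eq_lintegral_mul _ hw hg]
    rfl
  have h := lintegral_kernel_rpow_le (μ := cube n R) (ν := ν) (measurable_sideKernel lam i) hf
    hk hz hs (A := A) ?_ ?_
  · rw [hνint _ (hf.pow_const k)] at h
    rw [ENNReal.coe_rpow_of_nonneg _ hexp]
    refine le_trans (le_of_eq (lintegral_congr fun x' => ?_)) h
    rw [hνint (fun y => sideKernel lam i x' y * f y) ((hsk lam x').mul hf)]
    congr 1
    refine lintegral_congr fun y => ?_
    ring
  · intro x'
    simp only [sideKernel_rpow _ _ hs0.le]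
    rw [hνint _ (hsk _ x'), lintegral_cube_succ
      (f := fun y => ‖t - y i‖ₑ ^ (-a) * sideKernel (lam * s) i x' y) i (hw.mul (hsk _ x'))]
    calc ∫⁻ τ in Icc (-R) R, ∫⁻ y', ‖t - i.insertNth (α := fun _ => ℝ) τ y' i‖ₑ ^ (-a)
          * sideKernel (lam * s) i x' (i.insertNth τ y') ∂cube n R
        = ∫⁻ τ in Icc (-R) R, ‖t - τ‖ₑ ^ (-a)
          * ∏ l, ∫⁻ y' in Icc (-R) R, ‖x' l - y'‖ₑ ^ (-(lam * s)) := by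
          refine lintegral_congr fun τ => ?_
          rw [← lintegral_cube_prod (fun l y' => ‖x' l - y'‖ₑ ^ (-(lam * s)))
            fun l => by fun_prop, ← lintegral_const_mul _ (by fun_prop)]
          simp [sideKernel]
      _ ≤ ∫⁻ τ in Icc (-R) R, ‖t - τ‖ₑ ^ (-a) * (D₂ : ENNReal) ^ n := by
          refine lintegral_mono fun τ => ?_
          gcongr
          refine (Finset.prod_le_prod' fun l _ => hD₂ (x' l)).trans ?_
          simp
      _ ≤ D₁ * (D₂ : ENNReal) ^ n := by
          rw [lintegral_mul_const _ (by fun_prop)]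
          gcongr
          exact hD₁ t
      _ ≤ A := by
          rw [hA]
          norm_cast
          exact le_max_left _ _
  · intro y
    simp only [sideKernel_rpow _ _ hs0.le]
    unfold sideKernel
    rw [lintegral_cube_prod (fun l x => ‖x - y (i.succAbove l)‖ₑ ^ (-(lam * s)))
      fun l => by fun_prop]
    calc ∏ l : Fin n, ∫⁻ x in Icc (-R) R, ‖x - y (i.succAbove l)‖ₑ ^ (-(lam * s))
        ≤ ∏ l : Fin n, (D₂ : ENNReal) := Finset.prod_le_prod' fun l _ => by
          refine le_trans (le_of_eq (lintegral_congr fun x => ?_)) (hD₂ (y (i.succAbove l)))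
          rw [← enorm_neg, neg_sub]
      _ ≤ A := by
          rw [hA]
          simp only [Finset.prod_const, Finset.card_univ, Fintype.card_fin]
          norm_cast
          exact le_max_right _ _

theorem exists_weighted_bound {a : ℝ} (ha0 : 0 < a) (ha1 : a < 1) (R : ℝ) : ∃ C : NNReal,
    ∀ (N : ℕ) (i : Fin N) (f : (Fin N → ℝ) → ENNReal), Measurable f →
      ∫⁻ t in Icc (-R) R, ∫⁻ y, ‖t - y i‖ₑ ^ (-a) * f y ∂cube N R ≤ C * ∫⁻ y, f y ∂cube N R := by
  obtain ⟨D, hD⟩ := exists_singular_bound ha0 ha1 R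
  refine ⟨D, fun N i f hf => ?_⟩
  rw [lintegral_lintegral_swap (by fun_prop), ← lintegral_const_mul _ hf]
  refine lintegral_mono fun y => ?_
  rw [lintegral_mul_const _ (by fun_prop)]
  gcongr
  refine le_trans (le_of_eq (lintegral_congr fun t => ?_)) (hD (y i))
  rw [← enorm_neg, neg_sub]

end Cubes

section Pohozaev

variable {N : ℕ} {f g u v : EuclideanSpace ℝ (Fin N) → ℝ} {x : EuclideanSpace ℝ (Fin N)}

theorem pd_add (hf : DifferentiableAt ℝ f x) (hg : DifferentiableAt ℝ g x) (i : Fin N) :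
    pd i (f + g) x = pd i f x + pd i g x := by
  have : fderiv ℝ (f + g) x = _ := (hf.hasFDerivAt.add hg.hasFDerivAt).fderiv
  simp [pd, this]

theorem pd_sub (hf : DifferentiableAt ℝ f x) (hg : DifferentiableAt ℝ g x) (i : Fin N) :
    pd i (f - g) x = pd i f x - pd i g x := by
  have : fderiv ℝ (f - g) x = _ := (hf.hasFDerivAt.sub hg.hasFDerivAt).fderiv
  simp [pd, this]

theorem pd_mul (hf : DifferentiableAt ℝ f x) (hg : DifferentiableAt ℝ g x) (i : Fin N) :
    pd i (f * g) x = pd i f x * g x + f x * pd i g x := by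
  have : fderiv ℝ (f * g) x = _ := (hf.hasFDerivAt.mul hg.hasFDerivAt).fderiv
  simp [pd, this]; ring

theorem pd_const_mul (c : ℝ) (hf : DifferentiableAt ℝ f x) (i : Fin N) :
    pd i (fun y => c * f y) x = c * pd i f x := by
  have : fderiv ℝ (fun y => c * f y) x = _ := (hf.hasFDerivAt.const_mul c).fderiv
  simp [pd, this]

theorem pd_sum {F : Fin N → EuclideanSpace ℝ (Fin N) → ℝ}
    (hF : ∀ j, DifferentiableAt ℝ (F j) x) (i : Fin N) :
    pd i (fun y => ∑ j, F j y) x = ∑ j, pd i (F j) x := by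
  have : fderiv ℝ (fun y => ∑ j, F j y) x = ∑ j, fderiv ℝ (F j) x := by
    have := (HasFDerivAt.fun_sum (u := Finset.univ) fun j _ => (hF j).hasFDerivAt).fderiv
    exact this
  simp [pd, this]

theorem pd_rpow (hf : DifferentiableAt ℝ f x) {s : ℝ} (hs : 1 ≤ s) (i : Fin N) :
    pd i (fun y => f y ^ s) x = s * f x ^ (s - 1) * pd i f x := by
  have : fderiv ℝ (fun y => f y ^ s) x = _ :=
    ((Real.hasDerivAt_rpow_const (Or.inr hs)).comp_hasFDerivAt x hf.hasFDerivAt).fderiv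
  simp [pd, this]

theorem coord_contDiff {k : ℕ∞} (j : Fin N) :
    ContDiff ℝ k (fun y : EuclideanSpace ℝ (Fin N) => y j) :=
  (EuclideanSpace.proj (𝕜 := ℝ) j).contDiff

theorem pd_coord (i j : Fin N) (x : EuclideanSpace ℝ (Fin N)) :
    pd i (fun y : EuclideanSpace ℝ (Fin N) => y j) x = if j = i then 1 else 0 := by
  have : fderiv ℝ (fun y : EuclideanSpace ℝ (Fin N) => y j) x = EuclideanSpace.proj (𝕜 := ℝ) j :=
    (EuclideanSpace.proj (𝕜 := ℝ) j).fderiv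
  simp [pd, this]

/-- The radial derivative `x · ∇u`. -/
noncomputable def eulerDeriv (u : EuclideanSpace ℝ (Fin N) → ℝ)
    (x : EuclideanSpace ℝ (Fin N)) : ℝ := ∑ j, x j * pd j u x

/-- The Euclidean product of the gradients of `u` and `v`. -/
noncomputable def gradProd (u v : EuclideanSpace ℝ (Fin N) → ℝ)
    (x : EuclideanSpace ℝ (Fin N)) : ℝ := ∑ j, pd j u x * pd j v x

theorem eulerDeriv_contDiff (hu : ContDiff ℝ 2 u) : ContDiff ℝ 1 (eulerDeriv u) :=
  ContDiff.sum fun j _ => (coord_contDiff (k := 1) j).mul (pd_contDiff hu j)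

theorem gradProd_contDiff (hu : ContDiff ℝ 2 u) (hv : ContDiff ℝ 2 v) :
    ContDiff ℝ 1 (gradProd u v) :=
  ContDiff.sum fun j _ => (pd_contDiff hu j).mul (pd_contDiff hv j)

theorem pd_eulerDeriv (hu : ContDiff ℝ 2 u) (i : Fin N) :
    pd i (eulerDeriv u) x = pd i u x + ∑ j, x j * pd i (pd j u) x := by
  have h1 : ∀ j : Fin N, DifferentiableAt ℝ (pd j u) x := fun j =>
    (pd_contDiff hu j).differentiable (by norm_num) x
  have h2 : ∀ j : Fin N, DifferentiableAt ℝ (fun y : EuclideanSpace ℝ (Fin N) => y j) x := fun j =>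
    (coord_contDiff (k := 1) j).differentiable (by norm_num) x
  have : pd i (eulerDeriv u) x = ∑ j, pd i (fun y => y j * pd j u y) x :=
    pd_sum (fun j => (h2 j).mul (h1 j)) i
  rw [this]
  have h3 : ∀ j, pd i (fun y => y j * pd j u y) x = _ := fun j => pd_mul (h2 j) (h1 j) i
  simp_rw [h3, pd_coord, Finset.sum_add_distrib]
  simp

theorem pd_gradProd (hu : ContDiff ℝ 2 u) (hv : ContDiff ℝ 2 v) (i : Fin N) :
    pd i (gradProd u v) x
      = ∑ j, pd i (pd j u) x * pd j v x + ∑ j, pd j u x * pd i (pd j v) x := by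
  have h1 : ∀ j : Fin N, DifferentiableAt ℝ (pd j u) x := fun j =>
    (pd_contDiff hu j).differentiable (by norm_num) x
  have h2 : ∀ j : Fin N, DifferentiableAt ℝ (pd j v) x := fun j =>
    (pd_contDiff hv j).differentiable (by norm_num) x
  have : pd i (gradProd u v) x = ∑ j, pd i (fun y => pd j u y * pd j v y) x :=
    pd_sum (fun j => (h1 j).mul (h2 j)) i
  rw [this]
  have h3 : ∀ j, pd i (fun y => pd j u y * pd j v y) x = _ := fun j => pd_mul (h1 j) (h2 j) i
  simp_rw [h3, Finset.sum_add_distrib]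

/-- The Pohozaev vector field of the system `-Δu = c v ^ p`, `-Δv = d u ^ q`. -/
noncomputable def pohozaevField (p q a b c d : ℝ) (u v : EuclideanSpace ℝ (Fin N) → ℝ) (i : Fin N)
    (x : EuclideanSpace ℝ (Fin N)) : ℝ :=
  (eulerDeriv u x * pd i v x + eulerDeriv v x * pd i u x - x i * gradProd u v x)
    + ((a * v x) * pd i u x + (b * u x) * pd i v x)
    + x i * (d / (q + 1) * u x ^ (q + 1) + c / (p + 1) * v x ^ (p + 1))

theorem energy_contDiff (hp : 0 < p) (hq : 0 < q) (c d : ℝ) (hu : ContDiff ℝ 2 u)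
    (hv : ContDiff ℝ 2 v) :
    ContDiff ℝ 1 (fun x => d / (q + 1) * u x ^ (q + 1) + c / (p + 1) * v x ^ (p + 1)) :=
  (contDiff_const.mul ((hu.of_le (by norm_num)).rpow_const_of_le (by norm_num; linarith))).add
    (contDiff_const.mul ((hv.of_le (by norm_num)).rpow_const_of_le (by norm_num; linarith)))

theorem pohozaevField_contDiff (hp : 0 < p) (hq : 0 < q) (a b c d : ℝ) (hu : ContDiff ℝ 2 u)
    (hv : ContDiff ℝ 2 v) (i : Fin N) : ContDiff ℝ 1 (pohozaevField p q a b c d u v i) := by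
  have hu1 : ContDiff ℝ 1 u := hu.of_le (by norm_num)
  have hv1 : ContDiff ℝ 1 v := hv.of_le (by norm_num)
  exact (((((eulerDeriv_contDiff hu).mul (pd_contDiff hv i)).add
    ((eulerDeriv_contDiff hv).mul (pd_contDiff hu i))).sub
    ((coord_contDiff (k := 1) i).mul (gradProd_contDiff hu hv))).add
    (((contDiff_const.mul hv1).mul (pd_contDiff hu i)).add
      ((contDiff_const.mul hu1).mul (pd_contDiff hv i)))).add
    ((coord_contDiff (k := 1) i).mul (energy_contDiff hp hq c d hu hv))

theorem pd_pohozaevField (hp : 0 < p) (hq : 0 < q) (a b c d : ℝ) (hu : ContDiff ℝ 2 u)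
    (hv : ContDiff ℝ 2 v) (i : Fin N) :
    pd i (pohozaevField p q a b c d u v i) x
      = (pd i u x + ∑ j, x j * pd i (pd j u) x) * pd i v x + eulerDeriv u x * pd i (pd i v) x
        + ((pd i v x + ∑ j, x j * pd i (pd j v) x) * pd i u x + eulerDeriv v x * pd i (pd i u) x)
        - (gradProd u v x
          + x i * (∑ j, pd i (pd j u) x * pd j v x + ∑ j, pd j u x * pd i (pd j v) x))
        + (a * pd i v x * pd i u x + a * v x * pd i (pd i u) x
          + (b * pd i u x * pd i v x + b * u x * pd i (pd i v) x))
        + ((d / (q + 1) * u x ^ (q + 1) + c / (p + 1) * v x ^ (p + 1))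
          + x i * (d * u x ^ q * pd i u x + c * v x ^ p * pd i v x)) := by
  have D : ∀ {f : EuclideanSpace ℝ (Fin N) → ℝ}, ContDiff ℝ 1 f → DifferentiableAt ℝ f x :=
    fun h => h.differentiable (by norm_num) x
  have hu1 : ContDiff ℝ 1 u := hu.of_le (by norm_num)
  have hv1 : ContDiff ℝ 1 v := hv.of_le (by norm_num)
  have du := D hu1
  have dv := D hv1
  have dui := D (pd_contDiff hu i)
  have dvi := D (pd_contDiff hv i)
  have dU := D (eulerDeriv_contDiff hu)
  have dV := D (eulerDeriv_contDiff hv)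
  have dG := D (gradProd_contDiff hu hv)
  have dx := D (coord_contDiff (k := 1) i)
  have dE := D (energy_contDiff hp hq c d hu hv)
  have dup : DifferentiableAt ℝ (fun y => u y ^ (q + 1)) x :=
    D (hu1.rpow_const_of_le (by norm_num; linarith))
  have dvp : DifferentiableAt ℝ (fun y => v y ^ (p + 1)) x :=
    D (hv1.rpow_const_of_le (by norm_num; linarith))
  have e1 : pd i (fun y => (eulerDeriv u y * pd i v y + eulerDeriv v y * pd i u y
      - y i * gradProd u v y)
    + ((a * v y) * pd i u y + (b * u y) * pd i v y)
    + y i * (d / (q + 1) * u y ^ (q + 1) + c / (p + 1) * v y ^ (p + 1))) x = _ :=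
    pd_add ((((dU.mul dvi).add (dV.mul dui)).sub (dx.mul dG)).add
      (((dv.const_mul a).mul dui).add ((du.const_mul b).mul dvi))) (dx.mul dE) i
  have e2 : pd i (pohozaevField p q a b c d u v i) x = _ := e1
  have e3 : pd i (fun y => d / (q + 1) * u y ^ (q + 1) + c / (p + 1) * v y ^ (p + 1)) x = _ :=
    pd_add (dup.const_mul _) (dvp.const_mul _) i
  have hq1 : (q + 1) ≠ 0 := by positivity
  have hp1 : (p + 1) ≠ 0 := by positivity
  rw [e2, pd_add (((dU.mul dvi).add (dV.mul dui)).sub (dx.mul dG))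
      (((dv.const_mul a).mul dui).add ((du.const_mul b).mul dvi)),
    pd_sub ((dU.mul dvi).add (dV.mul dui)) (dx.mul dG), pd_add (dU.mul dvi) (dV.mul dui),
    pd_mul dU dvi, pd_mul dV dui, pd_mul dx dG,
    pd_add ((dv.const_mul a).mul dui) ((du.const_mul b).mul dvi), pd_mul (dv.const_mul a) dui,
    pd_mul (du.const_mul b) dvi, pd_const_mul a dv, pd_const_mul b du, pd_mul dx dE,
    e3, pd_const_mul _ dup, pd_const_mul _ dvp,
    pd_rpow du (by linarith), pd_rpow dv (by linarith), pd_coord, pd_eulerDeriv hu,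
    pd_eulerDeriv hv, pd_gradProd hu hv, if_pos rfl]
  simp only [add_sub_cancel_right]
  field_simp

theorem sum_pd_pohozaevField (hp : 0 < p) (hq : 0 < q) {a b : ℝ} (c d : ℝ)
    (hab : a + b = (N : ℝ) - 2) (hu : ContDiff ℝ 2 u) (hv : ContDiff ℝ 2 v)
    (hux : 0 ≤ u x) (hvx : 0 ≤ v x) :
    ∑ i, pd i (pohozaevField p q a b c d u v i) x
      = (N / (q + 1) - b) * d * u x ^ (q + 1) + (N / (p + 1) - a) * c * v x ^ (p + 1)
        + (lap v x + d * u x ^ q) * (eulerDeriv u x + b * u x)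
        + (lap u x + c * v x ^ p) * (eulerDeriv v x + a * v x) := by
  simp_rw [pd_pohozaevField hp hq a b c d hu hv]
  have hU : u x ^ (q + 1) = u x ^ q * u x := by
    rw [Real.rpow_add_one' hux (by positivity)]
  have hV : v x ^ (p + 1) = v x ^ p * v x := by
    rw [Real.rpow_add_one' hvx (by positivity)]
  rw [lap_eq_sum_pd hu, lap_eq_sum_pd hv]
  have s1 : ∑ i, (∑ j, x j * pd i (pd j u) x) * pd i v x
      = ∑ i, x i * ∑ j, pd i (pd j u) x * pd j v x := by
    simp_rw [Finset.sum_mul, Finset.mul_sum]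
    rw [Finset.sum_comm]
    refine Finset.sum_congr rfl fun i _ => Finset.sum_congr rfl fun j _ => ?_
    rw [pd_comm hu j i]; ring
  have s2 : ∑ i, (∑ j, x j * pd i (pd j v) x) * pd i u x
      = ∑ i, x i * ∑ j, pd j u x * pd i (pd j v) x := by
    simp_rw [Finset.sum_mul, Finset.mul_sum]
    rw [Finset.sum_comm]
    refine Finset.sum_congr rfl fun i _ => Finset.sum_congr rfl fun j _ => ?_
    rw [pd_comm hv j i]; ring
  have s3 : ∑ i, pd i u x * pd i v x = gradProd u v x := rfl
  have s4 : ∑ i, x i * pd i u x = eulerDeriv u x := rfl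
  have s5 : ∑ i, x i * pd i v x = eulerDeriv v x := rfl
  have key : ∀ i : Fin N,
      (pd i u x + ∑ j, x j * pd i (pd j u) x) * pd i v x + eulerDeriv u x * pd i (pd i v) x
        + ((pd i v x + ∑ j, x j * pd i (pd j v) x) * pd i u x + eulerDeriv v x * pd i (pd i u) x)
        - (gradProd u v x
          + x i * (∑ j, pd i (pd j u) x * pd j v x + ∑ j, pd j u x * pd i (pd j v) x))
        + (a * pd i v x * pd i u x + a * v x * pd i (pd i u) x
          + (b * pd i u x * pd i v x + b * u x * pd i (pd i v) x))
        + ((d / (q + 1) * u x ^ (q + 1) + c / (p + 1) * v x ^ (p + 1))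
          + x i * (d * u x ^ q * pd i u x + c * v x ^ p * pd i v x))
      = (2 + a + b) * (pd i u x * pd i v x) + (∑ j, x j * pd i (pd j u) x) * pd i v x
        + (∑ j, x j * pd i (pd j v) x) * pd i u x
        + (eulerDeriv u x + b * u x) * pd i (pd i v) x
        + (eulerDeriv v x + a * v x) * pd i (pd i u) x
        - x i * ∑ j, pd i (pd j u) x * pd j v x - x i * ∑ j, pd j u x * pd i (pd j v) x
        + d * u x ^ q * (x i * pd i u x) + c * v x ^ p * (x i * pd i v x)
        + (d / (q + 1) * u x ^ (q + 1) + c / (p + 1) * v x ^ (p + 1) - gradProd u v x) := by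
    intro i; ring
  simp_rw [key, Finset.sum_add_distrib, Finset.sum_sub_distrib, Finset.sum_add_distrib, s1, s2,
    ← Finset.mul_sum, s3, s4, s5]
  simp only [Finset.sum_const, Finset.card_univ, Fintype.card_fin, nsmul_eq_mul]
  rw [hU, hV]
  have : a = N - 2 - b := by linarith
  subst this
  ring

theorem integral_cube_sum_pd {n : ℕ} {Z : Fin (n + 1) → EuclideanSpace ℝ (Fin (n + 1)) → ℝ}
    (hZ : ∀ i, ContDiff ℝ 1 (Z i)) {r : ℝ} (hr : 0 ≤ r) :
    ∫ x, ∑ i, pd i (Z i) (WithLp.toLp 2 x) ∂cube (n + 1) r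
      = ∑ i, (∫ x, Z i (WithLp.toLp 2 (i.insertNth r x)) ∂cube n r
        - ∫ x, Z i (WithLp.toLp 2 (i.insertNth (-r) x)) ∂cube n r) := by
  set T := (PiLp.continuousLinearEquiv 2 ℝ (fun _ : Fin (n + 1) => ℝ)).symm with hT
  have hc : ∀ i, Continuous fun x : Fin (n + 1) → ℝ => pd i (Z i) (WithLp.toLp 2 x) := fun i =>
    (pd_continuous (hZ i) i).comp T.continuous
  have h := integral_divergence_of_hasFDerivAt_off_countable' (fun _ : Fin (n + 1) => -r)
    (fun _ => r) (fun _ => by linarith) (fun i x => Z i (T x))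
    (fun i x => (fderiv ℝ (Z i) (T x)).comp (T : (Fin (n + 1) → ℝ) →L[ℝ] _)) ∅ countable_empty
    (fun i => ((hZ i).continuous.comp T.continuous).continuousOn)
    (fun x _ i => ((hZ i).differentiable (by norm_num) (T x)).hasFDerivAt.comp x T.hasFDerivAt)
    ?_
  · simp only [cube_eq]
    exact h
  · exact (continuous_finsetSum _ fun i _ => hc i).continuousOn.integrableOn_compact isCompact_Icc

/-- The sum of the absolute values of `u` and its first derivatives. -/
noncomputable def jetSum (u : EuclideanSpace ℝ (Fin N) → ℝ) (x : EuclideanSpace ℝ (Fin N)) : ℝ :=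
  |u x| + ∑ j, |pd j u x|

theorem jetSum_continuous (hu : ContDiff ℝ 1 u) : Continuous (jetSum u) :=
  hu.continuous.abs.add (continuous_finsetSum _ fun j _ => (pd_continuous hu j).abs)

theorem jetSum_nonneg (u : EuclideanSpace ℝ (Fin N) → ℝ) (x : EuclideanSpace ℝ (Fin N)) :
    0 ≤ jetSum u x := by unfold jetSum; positivity

theorem abs_le_jetSum (u : EuclideanSpace ℝ (Fin N) → ℝ) (x : EuclideanSpace ℝ (Fin N)) :
    |u x| ≤ jetSum u x := le_add_of_nonneg_right (by positivity)

theorem sum_abs_pd_le_jetSum (u : EuclideanSpace ℝ (Fin N) → ℝ) (x : EuclideanSpace ℝ (Fin N)) :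
    ∑ j, |pd j u x| ≤ jetSum u x := le_add_of_nonneg_left (abs_nonneg _)

theorem abs_pd_le_jetSum (u : EuclideanSpace ℝ (Fin N) → ℝ) (x : EuclideanSpace ℝ (Fin N))
    (j : Fin N) : |pd j u x| ≤ jetSum u x :=
  (Finset.single_le_sum (f := fun j => |pd j u x|) (fun _ _ => abs_nonneg _)
    (Finset.mem_univ j)).trans (sum_abs_pd_le_jetSum u x)

theorem abs_eulerDeriv_le {R : ℝ} (hx : ∀ i, |x i| ≤ R) (hR : 0 ≤ R) :
    |eulerDeriv u x| ≤ R * jetSum u x := by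
  calc |eulerDeriv u x| ≤ ∑ j, |x j * pd j u x| := Finset.abs_sum_le_sum_abs _ _
    _ ≤ ∑ j, R * |pd j u x| := Finset.sum_le_sum fun j _ => by
        rw [abs_mul]; exact mul_le_mul_of_nonneg_right (hx j) (abs_nonneg _)
    _ = R * ∑ j, |pd j u x| := by rw [Finset.mul_sum]
    _ ≤ R * jetSum u x := mul_le_mul_of_nonneg_left (sum_abs_pd_le_jetSum u x) hR

theorem abs_gradProd_le : |gradProd u v x| ≤ jetSum u x * jetSum v x := by
  calc |gradProd u v x| ≤ ∑ j, |pd j u x * pd j v x| := Finset.abs_sum_le_sum_abs _ _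
    _ ≤ ∑ j, |pd j u x| * jetSum v x := Finset.sum_le_sum fun j _ => by
        rw [abs_mul]; exact mul_le_mul_of_nonneg_left (abs_pd_le_jetSum v x j) (abs_nonneg _)
    _ = (∑ j, |pd j u x|) * jetSum v x := by rw [Finset.sum_mul]
    _ ≤ _ := mul_le_mul_of_nonneg_right (sum_abs_pd_le_jetSum u x) (jetSum_nonneg v x)

/-- The boundary density of the Pohozaev identity. -/
noncomputable def bdryDensity (p q : ℝ) (u v : EuclideanSpace ℝ (Fin N) → ℝ)
    (x : EuclideanSpace ℝ (Fin N)) : ℝ :=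
  |u x| ^ (q + 1) + |v x| ^ (p + 1) + jetSum u x * jetSum v x

theorem abs_pohozaevField_le (hp : 0 < p) (hq : 0 < q) {a b c d A : ℝ} (hc : |c| ≤ A)
    (hd : |d| ≤ A) (hx : ∀ i, |x i| ≤ 2) (hu : 0 ≤ u x) (hv : 0 ≤ v x) (i : Fin N) :
    |pohozaevField p q a b c d u v i x| ≤ (6 + |a| + |b| + 2 * A) * bdryDensity p q u v x := by
  have hA : 0 ≤ A := (abs_nonneg c).trans hc
  have Su := jetSum_nonneg u x
  have Sv := jetSum_nonneg v x
  have t1 : |eulerDeriv u x * pd i v x| ≤ 2 * (jetSum u x * jetSum v x) := by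
    rw [abs_mul, ← mul_assoc]
    exact mul_le_mul (abs_eulerDeriv_le hx (by norm_num)) (abs_pd_le_jetSum v x i)
      (abs_nonneg _) (by positivity)
  have t2 : |eulerDeriv v x * pd i u x| ≤ 2 * (jetSum u x * jetSum v x) := by
    rw [abs_mul, mul_comm (jetSum u x), ← mul_assoc]
    exact mul_le_mul (abs_eulerDeriv_le hx (by norm_num)) (abs_pd_le_jetSum u x i)
      (abs_nonneg _) (by positivity)
  have t3 : |x i * gradProd u v x| ≤ 2 * (jetSum u x * jetSum v x) := by
    rw [abs_mul]
    exact mul_le_mul (hx i) abs_gradProd_le (abs_nonneg _) (by norm_num)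
  have t4 : |a * v x * pd i u x| ≤ |a| * (jetSum u x * jetSum v x) := by
    rw [abs_mul, abs_mul, mul_assoc, mul_comm (jetSum u x)]
    gcongr
    · exact abs_le_jetSum v x
    · exact abs_pd_le_jetSum u x i
  have t5 : |b * u x * pd i v x| ≤ |b| * (jetSum u x * jetSum v x) := by
    rw [abs_mul, abs_mul, mul_assoc]
    gcongr
    · exact abs_le_jetSum u x
    · exact abs_pd_le_jetSum v x i
  have hw : ∀ {s e w : ℝ}, 0 < s → |e| ≤ A → 0 ≤ w →
      |e / (s + 1) * w| ≤ A * w := by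
    intro s e w hs he hw
    rw [abs_mul, abs_div, abs_of_nonneg hw, abs_of_pos (by linarith : 0 < s + 1)]
    gcongr
    exact (div_le_self (abs_nonneg _) (by linarith)).trans he
  have hun : 0 ≤ |u x| ^ (q + 1) := by positivity
  have hvn : 0 ≤ |v x| ^ (p + 1) := by positivity
  have t6 : |x i * (d / (q + 1) * u x ^ (q + 1) + c / (p + 1) * v x ^ (p + 1))|
      ≤ 2 * (A * |u x| ^ (q + 1) + A * |v x| ^ (p + 1)) := by
    rw [abs_mul]
    refine mul_le_mul (hx i) ((abs_add_le _ _).trans (add_le_add ?_ ?_)) (abs_nonneg _) (by norm_num)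
    · rw [abs_of_nonneg hu]
      exact hw hq hd (Real.rpow_nonneg hu (q + 1))
    · rw [abs_of_nonneg hv]
      exact hw hp hc (Real.rpow_nonneg hv (p + 1))
  have hS : 0 ≤ jetSum u x * jetSum v x := mul_nonneg Su Sv
  unfold pohozaevField bdryDensity
  rw [abs_le] at t1 t2 t3 t4 t5 t6 ⊢
  have ha := abs_nonneg a
  have hb := abs_nonneg b
  have q1 := mul_nonneg hA hS
  have q2 := mul_nonneg ha hun
  have q3 := mul_nonneg ha hvn
  have q4 := mul_nonneg hb hun
  have q5 := mul_nonneg hb hvn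
  constructor <;> linarith [t1.1, t1.2, t2.1, t2.2, t3.1, t3.2, t4.1, t4.2, t5.1, t5.2, t6.1, t6.2]

theorem ae_cube_abs_le (n : ℕ) (r : ℝ) : ∀ᵐ x ∂cube n r, ∀ i, |x i| ≤ r := by
  rw [cube_eq]
  filter_upwards [ae_restrict_mem measurableSet_Icc] with x hx i
  exact abs_le.2 ⟨hx.1 i, hx.2 i⟩

theorem integrable_cube {n : ℕ} (r : ℝ) {F : (Fin n → ℝ) → ℝ} (hF : Continuous F) :
    Integrable F (cube n r) := by
  rw [cube_eq]
  exact hF.continuousOn.integrableOn_compact isCompact_Icc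

theorem lintegral_face_le {n : ℕ} {u v : EuclideanSpace ℝ (Fin (n + 1)) → ℝ} (hp : 0 < p)
    (hq : 0 < q) {a b c d A r t : ℝ} (hc : |c| ≤ A) (hd : |d| ≤ A) (hr2 : r ≤ 2) (ht : |t| ≤ 2)
    (hpos : ∀ x : EuclideanSpace ℝ (Fin (n + 1)), (∀ i, |x i| ≤ 2) → 0 ≤ u x ∧ 0 ≤ v x)
    (i : Fin (n + 1)) :
    ENNReal.ofReal |∫ x, pohozaevField p q a b c d u v i
        (WithLp.toLp 2 (i.insertNth t x)) ∂cube n r|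
      ≤ ENNReal.ofReal (6 + |a| + |b| + 2 * A) * ∫⁻ x, ENNReal.ofReal
        (bdryDensity p q u v (WithLp.toLp 2 (i.insertNth t x))) ∂cube n r := by
  have hA : 0 ≤ A := (abs_nonneg c).trans hc
  rw [← Real.norm_eq_abs, ofReal_norm, ← lintegral_const_mul' _ _ ENNReal.ofReal_ne_top]
  refine (enorm_integral_le_lintegral_enorm _).trans (lintegral_mono_ae ?_)
  filter_upwards [ae_cube_abs_le n r] with x hx
  rw [← ENNReal.ofReal_mul (by positivity), ← ofReal_norm]
  have hx2 : ∀ j, |(WithLp.toLp 2 (i.insertNth t x) : EuclideanSpace ℝ (Fin (n + 1))) j| ≤ 2 := by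
    refine (Fin.forall_iff_succAbove i).2 ⟨by simpa using ht, fun j => ?_⟩
    simpa using (hx j).trans hr2
  exact ENNReal.ofReal_le_ofReal (abs_pohozaevField_le hp hq hc hd hx2 (hpos _ hx2).1
    (hpos _ hx2).2 i)

theorem exists_pohozaev_bound {n : ℕ} {C₁ C₂ : ℝ} (hp : 0 < p) (hq : 0 < q) (hC₂ : 0 < C₂)
    (hsub : (n : ℝ) - 1 < (n + 1) / (p + 1) + (n + 1) / (q + 1)) :
    ∃ K : NNReal, ∀ (u v : EuclideanSpace ℝ (Fin (n + 1)) → ℝ) (c d r : ℝ),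
      ContDiff ℝ 2 u → ContDiff ℝ 2 v → C₂ ≤ c → c ≤ C₁ → C₂ ≤ d → d ≤ C₁ → 1 ≤ r → r ≤ 2 →
      (∀ x : EuclideanSpace ℝ (Fin (n + 1)), (∀ i, |x i| ≤ 2) → 0 ≤ u x ∧ 0 ≤ v x) →
      (∀ x : EuclideanSpace ℝ (Fin (n + 1)), (∀ i, |x i| ≤ 2) →
        |lap u x + c * v x ^ p| * jetSum v x ≤ 1 ∧ |lap v x + d * u x ^ q| * jetSum u x ≤ 1) →
      ∫⁻ x, ‖u (WithLp.toLp 2 x)‖ₑ ^ (q + 1) ∂cube (n + 1) r ≤ K * (1 + ∑ i : Fin (n + 1),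
        (∫⁻ x, ENNReal.ofReal (bdryDensity p q u v (WithLp.toLp 2 (i.insertNth r x))) ∂cube n r
        + ∫⁻ x, ENNReal.ofReal
          (bdryDensity p q u v (WithLp.toLp 2 (i.insertNth (-r) x))) ∂cube n r)) := by
  obtain ⟨ε, hε⟩ : ∃ ε : ℝ, ε = ((n + 1) / (p + 1) + (n + 1) / (q + 1) - (n - 1)) / 2 := ⟨_, rfl⟩
  have hε0 : 0 < ε := by rw [hε]; linarith
  obtain ⟨a, ha⟩ : ∃ a : ℝ, a = (n + 1) / (p + 1) - ε := ⟨_, rfl⟩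
  obtain ⟨b, hb⟩ : ∃ b : ℝ, b = n - 1 - a := ⟨_, rfl⟩
  obtain ⟨E, hE⟩ : ∃ E : ℝ, E = 4 + |a| + |b| := ⟨_, rfl⟩
  have hE0 : 0 ≤ E := by rw [hE]; positivity
  refine ⟨(ENNReal.ofReal ((ε * C₂)⁻¹)).toNNReal * (ENNReal.ofReal (E * 4 ^ (n + 1))
    + ENNReal.ofReal (6 + |a| + |b| + 2 * C₁)).toNNReal, ?_⟩
  intro u v c d r hu hv hc1 hc2 hd1 hd2 hr1 hr2 hpos herr
  have hC₁ : 0 ≤ C₁ := by linarith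
  set Z := pohozaevField p q a b c d u v with hZ
  have T := (PiLp.continuousLinearEquiv 2 ℝ (fun _ : Fin (n + 1) => ℝ)).symm.continuous
  have hZc : ∀ i, ContDiff ℝ 1 (Z i) := pohozaevField_contDiff hp hq a b c d hu hv
  have hdiv := integral_cube_sum_pd hZc (show (0 : ℝ) ≤ r by linarith)
  have hI : Integrable (fun x => ∑ i, pd i (Z i) (WithLp.toLp 2 x)) (cube (n + 1) r) :=
    integrable_cube r ((continuous_finsetSum _ fun i _ => pd_continuous (hZc i) i).comp T)
  have hU : Integrable (fun x => |u (WithLp.toLp 2 x)| ^ (q + 1)) (cube (n + 1) r) :=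
    integrable_cube r ((hu.continuous.comp T).abs.rpow_const fun _ => Or.inr (by linarith))
  have hvol : (cube (n + 1) r).real univ ≤ 4 ^ (n + 1) := by
    rw [cube_eq, Measure.real, Measure.restrict_apply_univ, Real.volume_Icc_pi_toReal
      (fun _ => by linarith)]
    simp only [Finset.prod_const, Finset.card_univ, Fintype.card_fin]
    exact pow_le_pow_left₀ (by linarith) (by linarith) _
  have hmain : ε * C₂ * ∫ x, |u (WithLp.toLp 2 x)| ^ (q + 1) ∂cube (n + 1) r
      ≤ (∫ x, ∑ i, pd i (Z i) (WithLp.toLp 2 x) ∂cube (n + 1) r) + E * 4 ^ (n + 1) := by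
    have h1 : ∫ x, ε * C₂ * |u (WithLp.toLp 2 x)| ^ (q + 1) ∂cube (n + 1) r
        ≤ ∫ x, ((∑ i, pd i (Z i) (WithLp.toLp 2 x)) + E) ∂cube (n + 1) r := by
      refine integral_mono_ae (hU.const_mul _) (hI.add (integrable_const E)) ?_
      filter_upwards [ae_cube_abs_le (n + 1) r] with x hx
      obtain ⟨y, hy⟩ : ∃ y : EuclideanSpace ℝ (Fin (n + 1)), y = WithLp.toLp 2 x := ⟨_, rfl⟩
      have hy2 : ∀ i, |y i| ≤ 2 := fun i => by rw [hy]; exact (hx i).trans hr2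
      obtain ⟨hu0, hv0⟩ := hpos y hy2
      obtain ⟨e1, e2⟩ := herr y hy2
      rw [← hy, hZ, sum_pd_pohozaevField hp hq c d (by push_cast; linarith) hu hv hu0 hv0,
        abs_of_nonneg hu0]
      push_cast
      have k1 : ((n : ℝ) + 1) / (q + 1) - b = ε := by rw [hb, ha, hε]; ring
      have k2 : ((n : ℝ) + 1) / (p + 1) - a = ε := by rw [ha]; ring
      rw [k1, k2]
      have g1 : |(lap v y + d * u y ^ q) * (eulerDeriv u y + b * u y)| ≤ 2 + |b| := by
        have : |eulerDeriv u y + b * u y| ≤ (2 + |b|) * jetSum u y := by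
          refine (abs_add_le _ _).trans ?_
          rw [add_mul, abs_mul]
          exact add_le_add (abs_eulerDeriv_le hy2 (by norm_num))
            (mul_le_mul_of_nonneg_left (abs_le_jetSum u y) (abs_nonneg _))
        rw [abs_mul]
        nlinarith [mul_le_mul_of_nonneg_left this (abs_nonneg (lap v y + d * u y ^ q)),
          abs_nonneg b]
      have g2 : |(lap u y + c * v y ^ p) * (eulerDeriv v y + a * v y)| ≤ 2 + |a| := by
        have : |eulerDeriv v y + a * v y| ≤ (2 + |a|) * jetSum v y := by
          refine (abs_add_le _ _).trans ?_
          rw [add_mul, abs_mul]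
          exact add_le_add (abs_eulerDeriv_le hy2 (by norm_num))
            (mul_le_mul_of_nonneg_left (abs_le_jetSum v y) (abs_nonneg _))
        rw [abs_mul]
        nlinarith [mul_le_mul_of_nonneg_left this (abs_nonneg (lap u y + c * v y ^ p)),
          abs_nonneg a]
      have g3 : ε * C₂ * u y ^ (q + 1) ≤ ε * d * u y ^ (q + 1) := by gcongr
      have g4 : 0 ≤ ε * c * v y ^ (p + 1) := by
        have : 0 < c := hC₂.trans_le hc1
        positivity
      linarith [(abs_le.1 g1).1, (abs_le.1 g2).1]
    rw [integral_const_mul, integral_add hI (integrable_const E), integral_const, smul_eq_mul] at h1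
    nlinarith
  have hcA : |c| ≤ C₁ := abs_le.2 ⟨by linarith, hc2⟩
  have hdA : |d| ≤ C₁ := abs_le.2 ⟨by linarith, hd2⟩
  have hface : ∀ i, ENNReal.ofReal |∫ x, Z i (WithLp.toLp 2 (i.insertNth r x)) ∂cube n r
        - ∫ x, Z i (WithLp.toLp 2 (i.insertNth (-r) x)) ∂cube n r|
      ≤ ENNReal.ofReal (6 + |a| + |b| + 2 * C₁) *
        (∫⁻ x, ENNReal.ofReal (bdryDensity p q u v (WithLp.toLp 2 (i.insertNth r x))) ∂cube n r
        + ∫⁻ x, ENNReal.ofReal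
          (bdryDensity p q u v (WithLp.toLp 2 (i.insertNth (-r) x))) ∂cube n r) := fun i => by
    refine (ENNReal.ofReal_le_ofReal (abs_sub _ _)).trans ?_
    rw [ENNReal.ofReal_add (abs_nonneg _) (abs_nonneg _), mul_add]
    have hr' : |r| ≤ 2 := abs_le.2 ⟨by linarith, hr2⟩
    exact add_le_add (lintegral_face_le hp hq hcA hdA hr2 hr' hpos i)
      (lintegral_face_le hp hq hcA hdA hr2 (by rwa [abs_neg]) hpos i)
  have hsum : ∫ x, ∑ i, pd i (Z i) (WithLp.toLp 2 x) ∂cube (n + 1) r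
      ≤ ∑ i, |∫ x, Z i (WithLp.toLp 2 (i.insertNth r x)) ∂cube n r
        - ∫ x, Z i (WithLp.toLp 2 (i.insertNth (-r) x)) ∂cube n r| := by
    rw [hdiv]; exact Finset.sum_le_sum fun i _ => le_abs_self _
  have hL : ∫⁻ x, ‖u (WithLp.toLp 2 x)‖ₑ ^ (q + 1) ∂cube (n + 1) r
      = ENNReal.ofReal (∫ x, |u (WithLp.toLp 2 x)| ^ (q + 1) ∂cube (n + 1) r) := by
    rw [ofReal_integral_eq_lintegral_ofReal hU (ae_of_all _ fun x => by positivity)]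
    refine lintegral_congr fun x => ?_
    rw [← ENNReal.ofReal_rpow_of_nonneg (abs_nonneg _) (by linarith), ← Real.norm_eq_abs,
      ofReal_norm]
  have hεC : 0 < ε * C₂ := by positivity
  have hfin : ∫ x, |u (WithLp.toLp 2 x)| ^ (q + 1) ∂cube (n + 1) r
      ≤ (ε * C₂)⁻¹ * (E * 4 ^ (n + 1) + ∑ i, |∫ x, Z i (WithLp.toLp 2 (i.insertNth r x)) ∂cube n r
        - ∫ x, Z i (WithLp.toLp 2 (i.insertNth (-r) x)) ∂cube n r|) := by
    rw [inv_mul_eq_div, le_div_iff₀ hεC]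
    linarith
  rw [hL]
  refine (ENNReal.ofReal_le_ofReal hfin).trans ?_
  rw [ENNReal.ofReal_mul (by positivity), ENNReal.ofReal_add (by positivity) (by positivity),
    ENNReal.ofReal_sum_of_nonneg (fun _ _ => abs_nonneg _)]
  push_cast
  rw [ENNReal.coe_toNNReal ENNReal.ofReal_ne_top, ENNReal.coe_toNNReal
    (ENNReal.add_ne_top.2 ⟨ENNReal.ofReal_ne_top, ENNReal.ofReal_ne_top⟩), mul_assoc]
  refine mul_le_mul_right ?_ _
  rw [mul_add, mul_one]
  refine add_le_add le_self_add ?_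
  refine (Finset.sum_le_sum fun i _ => hface i).trans ?_
  rw [← Finset.mul_sum]
  exact mul_le_mul_left le_add_self _

end Pohozaev

section PointwiseBounds

variable {n : ℕ} {p q C₁ C₂ : ℝ}

theorem enorm_coord_le {N : ℕ} (w : EuclideanSpace ℝ (Fin N)) (i : Fin N) : ‖w i‖ₑ ≤ ‖w‖ₑ := by
  rw [← ofReal_norm, ← ofReal_norm]
  exact ENNReal.ofReal_le_ofReal (PiLp.norm_apply_le w i)

theorem enorm_rpow_neg_anti {s : ℝ} (hs : 0 ≤ s) {x y : ENNReal} (h : x ≤ y) :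
    y ^ (-s) ≤ x ^ (-s) := by
  rw [ENNReal.rpow_neg, ENNReal.rpow_neg]
  exact ENNReal.inv_le_inv.2 (ENNReal.rpow_le_rpow h hs)

/-- Splitting of the potential kernel along the coordinates. -/
theorem kernel_le_slice {a lam κ : ℝ} (ha : 0 < a) (hlam : 0 < lam) (hκ : a + n * lam = κ)
    (i : Fin (n + 1)) (t : ℝ) (x' : Fin n → ℝ) (y : Fin (n + 1) → ℝ) :
    ‖(WithLp.toLp 2 (i.insertNth t x') : EuclideanSpace ℝ (Fin (n + 1))) - WithLp.toLp 2 y‖ₑ ^ (-κ)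
      ≤ ‖t - y i‖ₑ ^ (-a) * sideKernel lam i x' y := by
  obtain ⟨w, hw⟩ : ∃ w : EuclideanSpace ℝ (Fin (n + 1)),
    w = WithLp.toLp 2 (i.insertNth t x') - WithLp.toLp 2 y := ⟨_, rfl⟩
  have h0 : w i = t - y i := by rw [hw]; simp
  have hl : ∀ l, w (i.succAbove l) = x' l - y (i.succAbove l) := fun l => by rw [hw]; simp
  have hside : sideKernel lam i x' y = ∏ l, ‖w (i.succAbove l)‖ₑ ^ (-lam) := by
    simp only [hl, sideKernel]
  rw [← hw, ← h0, hside]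
  rcases eq_or_ne w 0 with rfl | hw0
  · have : ∀ s : ℝ, 0 < s → (0 : ENNReal) ^ (-s) = ⊤ := fun s hs =>
      ENNReal.zero_rpow_of_neg (by linarith)
    have hκ0 : 0 < κ := by rw [← hκ]; positivity
    simp only [PiLp.zero_apply, enorm_zero, this a ha, this lam hlam]
    rw [ENNReal.top_mul]
    · exact le_top
    · exact Finset.prod_ne_zero_iff.2 fun l _ => by simp
  · have hne : ‖w‖ₑ ≠ 0 := by simpa using hw0
    have hsplit : ‖w‖ₑ ^ (-κ) = ‖w‖ₑ ^ (-a) * ∏ _l : Fin n, ‖w‖ₑ ^ (-lam) := by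
      rw [Finset.prod_const, Finset.card_univ, Fintype.card_fin, ← ENNReal.rpow_natCast,
        ← ENNReal.rpow_mul, ← ENNReal.rpow_add _ _ hne enorm_ne_top, ← hκ]
      ring_nf
    rw [hsplit]
    exact mul_le_mul' (enorm_rpow_neg_anti ha.le (enorm_coord_le w i))
      (Finset.prod_le_prod' fun l _ => enorm_rpow_neg_anti hlam.le (enorm_coord_le w _))

theorem abs_coord_le_of_mem_ball {N : ℕ} {R : ℝ} {x y : EuclideanSpace ℝ (Fin N)}
    (hx : ∀ i, |x i| ≤ R) (hy : y ∈ ball x 1) (i : Fin N) : |y i| ≤ R + 1 := by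
  have h1 := abs_coord_sub_le x y i
  rw [mem_ball, dist_eq_norm] at hy
  have h2 := hx i
  rw [abs_le] at *
  constructor <;> linarith [h1.1, h1.2, h2.1, h2.2]

theorem norm_le_of_abs_coord_le {N : ℕ} {R : ℝ} {x : EuclideanSpace ℝ (Fin N)}
    (hx : ∀ i, |x i| ≤ R) : ‖x‖ ≤ N * R := by
  have h : x = ∑ i, x i • EuclideanSpace.single i (1 : ℝ) := by
    ext j
    simp [Pi.single_apply]
  rw [h]
  refine (norm_sum_le _ _).trans ((Finset.sum_le_sum (g := fun _ => R) fun i _ => ?_).trans ?_)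
  · rw [norm_smul]; simpa using hx i
  · simp

theorem setLIntegral_le_cube {N : ℕ} {R : ℝ} {s : Set (EuclideanSpace ℝ (Fin N))}
    (hs : ∀ y ∈ s, ∀ i, |y i| ≤ R) (F : EuclideanSpace ℝ (Fin N) → ENNReal) :
    ∫⁻ y in s, F y ≤ ∫⁻ y, F (WithLp.toLp 2 y) ∂cube N R := by
  rw [← (PiLp.volume_preserving_toLp (Fin N)).setLIntegral_comp_preimage_emb
    (MeasurableEquiv.toLp 2 (Fin N → ℝ)).measurableEmbedding, cube_eq]
  refine lintegral_mono_set fun y hy => ?_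
  exact ⟨fun i => (abs_le.1 (hs _ hy i)).1, fun i => (abs_le.1 (hs _ hy i)).2⟩

theorem cube_lintegral_le {N : ℕ} {R : ℝ} {s : Set (EuclideanSpace ℝ (Fin N))}
    (hs : ∀ y : EuclideanSpace ℝ (Fin N), (∀ i, |y i| ≤ R) → y ∈ s)
    (F : EuclideanSpace ℝ (Fin N) → ENNReal) :
    ∫⁻ y, F (WithLp.toLp 2 y) ∂cube N R ≤ ∫⁻ y in s, F y := by
  rw [← (PiLp.volume_preserving_toLp (Fin N)).setLIntegral_comp_preimage_emb
    (MeasurableEquiv.toLp 2 (Fin N → ℝ)).measurableEmbedding, cube_eq]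
  exact lintegral_mono_set fun y hy => hs _ fun i => abs_le.2 ⟨hy.1 i, hy.2 i⟩

/-- Potential of `f` on the cube, for the anisotropic kernel. -/
noncomputable def slicePotential (a lam : ℝ) (i : Fin (n + 1)) (t : ℝ) (x' : Fin n → ℝ)
    (f : (Fin (n + 1) → ℝ) → ENNReal) : ENNReal :=
  ∫⁻ y, ‖t - y i‖ₑ ^ (-a) * sideKernel lam i x' y * f y ∂cube (n + 1) 3

theorem setLIntegral_kernel_le {a lam κ : ℝ} (ha : 0 < a) (hlam : 0 < lam) (hκ : a + n * lam = κ)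
    {i : Fin (n + 1)} {t : ℝ} {x' : Fin n → ℝ} (ht : |t| ≤ 2) (hx' : ∀ l, |x' l| ≤ 2)
    (f : EuclideanSpace ℝ (Fin (n + 1)) → ENNReal) :
    ∫⁻ y in ball (WithLp.toLp 2 (i.insertNth t x') : EuclideanSpace ℝ (Fin (n + 1))) 1,
      ‖WithLp.toLp 2 (i.insertNth t x') - y‖ₑ ^ (-κ) * f y
      ≤ slicePotential a lam i t x' fun y => f (WithLp.toLp 2 y) := by
  have hx2 : ∀ j, |(WithLp.toLp 2 (i.insertNth t x') : EuclideanSpace ℝ (Fin (n + 1))) j| ≤ 2 :=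
    (Fin.forall_iff_succAbove i).2 ⟨by simpa using ht, fun j => by simpa using hx' j⟩
  refine (setLIntegral_le_cube (R := 3) (fun y hy j => ?_) _).trans (lintegral_mono fun y => ?_)
  · have := abs_coord_le_of_mem_ball hx2 hy j
    linarith
  · exact mul_le_mul_left (kernel_le_slice ha hlam hκ i t x' y) _

theorem exists_slicePotential_bound (hn : 2 ≤ n) (hp : 0 < p) (hq : 0 < q) (hpq : 1 < p * q)
    (hC₂ : 0 < C₂) (C₁ : ℝ) {a : ℝ} (ha0 : 0 < a) (ha1 : a < 1) :
    ∃ K : NNReal, ∀ (u v : EuclideanSpace ℝ (Fin (n + 1)) → ℝ),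
      IsSol p q C₁ C₂ (5 * (n + 1 : ℕ)) u v →
      ∀ (i : Fin (n + 1)) (t : ℝ) (x' : Fin n → ℝ), |t| ≤ 2 → (∀ l, |x' l| ≤ 2) →
        ‖u (WithLp.toLp 2 (i.insertNth t x'))‖ₑ ≤ K * (slicePotential a ((n - 1 - a) / n) i t x'
          (fun y => ‖v (WithLp.toLp 2 y) ^ p‖ₑ) + 1) ∧
        ‖jetSum u (WithLp.toLp 2 (i.insertNth t x'))‖ₑ ≤ K * (slicePotential a ((n - a) / n) i t x'
          (fun y => ‖v (WithLp.toLp 2 y) ^ p‖ₑ) + 1) := by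
  obtain ⟨M, hM⟩ := exists_integral_bound (N := n + 1) (by omega) hp hq hpq hC₂ C₁
  obtain ⟨m, hm⟩ : ∃ m : ℝ, m = ((n : ℝ) - 1) / 2 := ⟨_, rfl⟩
  have hn2 : (2 : ℝ) ≤ n := by exact_mod_cast hn
  have hm0 : 0 < m := by rw [hm]; linarith
  have hNm : ((n + 1 : ℕ) : ℝ) = 2 * m + 2 := by rw [hm]; push_cast; ring
  set P := ENNReal.ofReal (poleMass (n + 1) m) with hP
  have hP0 : P ≠ 0 := by
    rw [hP, Ne, ENNReal.ofReal_eq_zero, not_le]; exact poleMass_pos hm0 hNm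
  set A : NNReal := P⁻¹.toNNReal * (C₁.toNNReal + (bumpCoeff m).toNNReal * M) with hA
  set B : NNReal := P⁻¹.toNNReal * ((2 * m).toNNReal * C₁.toNNReal
    + (4 * bumpCoeff m).toNNReal * M) with hB
  have hPinv : ((P⁻¹.toNNReal : NNReal) : ENNReal) = P⁻¹ := ENNReal.coe_toNNReal (by simpa using hP0)
  refine ⟨A + (n + 1) * B, fun u v h i t x' ht hx' => ?_⟩
  obtain ⟨x, hx⟩ : ∃ x : EuclideanSpace ℝ (Fin (n + 1)), x = WithLp.toLp 2 (i.insertNth t x') :=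
    ⟨_, rfl⟩
  have hx2 : ∀ j, |x j| ≤ 2 := by
    rw [hx]
    exact (Fin.forall_iff_succAbove i).2 ⟨by simpa using ht, fun j => by simpa using hx' j⟩
  have hball : ∀ y ∈ ball x 1, y ∈ ball (0 : EuclideanSpace ℝ (Fin (n + 1))) (4 * (n + 1 : ℕ)) := by
    intro y hy
    have h1 := norm_le_of_abs_coord_le (abs_coord_le_of_mem_ball hx2 hy)
    rw [mem_ball, dist_zero_right]
    push_cast at h1 ⊢
    linarith
  have hball5 : ∀ y ∈ ball x 1, y ∈ ball (0 : EuclideanSpace ℝ (Fin (n + 1))) (5 * (n + 1 : ℕ)) :=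
    fun y hy => ball_subset_ball (by push_cast; linarith) (hball y hy)
  have hlap : ∀ y ∈ ball x 1, ‖lap u y‖ₑ ≤ C₁.toNNReal * ‖v y ^ p‖ₑ := by
    intro y hy
    have h1 := h.lap_u_nonneg hC₂ (hball5 y hy)
    have h2 := h.upper_u y (hball5 y hy)
    have h3 := Real.rpow_nonneg (h.v_nonneg y (hball5 y hy)) p
    rw [← enorm_neg, Real.enorm_of_nonneg h1, Real.enorm_of_nonneg h3]
    change _ ≤ ENNReal.ofReal C₁ * _
    rw [← ENNReal.ofReal_mul' h3]
    exact ENNReal.ofReal_le_ofReal h2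
  have hker : ∀ κ : ℝ, ∫⁻ y in ball x 1, ‖x - y‖ₑ ^ (-κ) * ‖lap u y‖ₑ
      ≤ C₁.toNNReal * ∫⁻ y in ball x 1, ‖x - y‖ₑ ^ (-κ) * ‖v y ^ p‖ₑ := by
    intro κ
    rw [← lintegral_const_mul' _ _ ENNReal.coe_ne_top]
    refine setLIntegral_mono' measurableSet_ball fun y hy => ?_
    rw [mul_left_comm]
    exact mul_le_mul_right (hlap y hy) _
  have hintg : ∫⁻ y in ball x 1, ‖u y‖ₑ ≤ M :=
    (lintegral_mono_set fun y hy => hball y hy).trans (hM u v h).2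
  have hdivP : ∀ {X Y : ENNReal}, P * X ≤ Y → X ≤ (P⁻¹.toNNReal : NNReal) * Y := by
    intro X Y hXY
    rw [hPinv, ← ENNReal.mul_le_iff_le_inv hP0 ENNReal.ofReal_ne_top]
    exact hXY
  have comb : ∀ {X S : ENNReal} {c1 c2 : NNReal}, P * X ≤ c1 * S + c2 * M →
      X ≤ (P⁻¹.toNNReal * (c1 + c2 * M) : NNReal) * (S + 1) := by
    intro X S c1 c2 hX
    refine (hdivP hX).trans ?_
    push_cast
    rw [mul_assoc]
    refine mul_le_mul_right ?_ _
    rw [mul_add, mul_one, add_mul]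
    exact add_le_add le_self_add le_add_self
  have hu1 : ∀ {a' lam κ : ℝ}, 0 < a' → 0 < lam → a' + n * lam = κ → 2 * m ≤ κ →
      ‖u x‖ₑ ≤ A * (slicePotential a' lam i t x' (fun y => ‖v (WithLp.toLp 2 y) ^ p‖ₑ) + 1) := by
    intro a' lam κ ha' hlam hκ hmκ
    have h1 := potential_upper_bound x hm0 hNm h.contDiff_u
    refine comb (h1.trans (add_le_add ((hker _).trans (mul_le_mul_right ?_ _))
      (mul_le_mul_right hintg _)))
    refine (setLIntegral_mono' (g := fun y => ‖x - y‖ₑ ^ (-κ) * ‖v y ^ p‖ₑ) measurableSet_ball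
      fun y hy => mul_le_mul_left ?_ _).trans ?_
    · refine ENNReal.rpow_le_rpow_of_exponent_ge ?_ (by linarith)
      rw [← ofReal_norm, ENNReal.ofReal_le_one, norm_sub_rev]
      exact (mem_ball_iff_norm.1 hy).le
    · rw [hx]
      exact setLIntegral_kernel_le ha' hlam hκ ht hx' _
  have hgrad : ∀ j, ‖pd j u x‖ₑ ≤ B * (slicePotential a ((n - a) / n) i t x'
      (fun y => ‖v (WithLp.toLp 2 y) ^ p‖ₑ) + 1) := by
    intro j
    have h1 := gradient_potential_upper_bound x hm0 hNm h.contDiff_u j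
    refine comb (h1.trans (add_le_add ?_ (mul_le_mul_right hintg _)))
    push_cast
    rw [mul_assoc]
    refine mul_le_mul_right ((hker _).trans (mul_le_mul_right ?_ _)) _
    rw [hx]
    refine setLIntegral_kernel_le ha0 (by apply div_pos <;> linarith) ?_ ht hx' _
    rw [hm]; field_simp; ring
  rw [← hx]
  constructor
  · refine (hu1 (κ := 2 * m) ha0 (by apply div_pos <;> linarith) (by rw [hm]; field_simp; ring)
      le_rfl).trans (mul_le_mul_left ?_ _)
    push_cast; exact le_self_add
  · have h2 := hu1 (a' := a) (lam := (n - a) / n) (κ := n) ha0 (by apply div_pos <;> linarith)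
      (by field_simp; ring) (by rw [hm]; linarith)
    have h3 : ‖jetSum u x‖ₑ ≤ ‖u x‖ₑ + ∑ j, ‖pd j u x‖ₑ := by
      refine (enorm_add_le _ _).trans ?_
      have habs : ∀ s : ℝ, ‖|s|‖ₑ = ‖s‖ₑ := fun s => by simp [enorm_eq_nnnorm]
      rw [habs]
      refine add_le_add le_rfl ((enorm_sum_le _ _).trans ?_)
      simp only [habs, le_refl]
    refine h3.trans ((add_le_add h2 (Finset.sum_le_sum fun j _ => hgrad j)).trans ?_)
    rw [Finset.sum_const, Finset.card_univ, Fintype.card_fin, nsmul_eq_mul]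
    push_cast
    exact le_of_eq (by ring)

end PointwiseBounds

section KeyEstimate

variable {n : ℕ} {p q C₁ C₂ : ℝ}

theorem exists_exponents (hn : 2 ≤ n) (hq : 0 < q) (hqp : q ≤ p) (hpq : 1 < p * q)
    (hsub : (n : ℝ) - 1 < (n + 1) / (p + 1) + (n + 1) / (q + 1))
    (halpha : (n : ℝ) - 2 < 2 * (p + 1) / (p * q - 1)) :
    ∃ θ a ζ : ℝ, 0 < θ ∧ θ < 1 / (p + 1) ∧ p * θ < 1 / (q + 1) ∧ 0 < a ∧ a < 1 ∧
      1 - θ - 1 / (q + 1) < (1 + a) / n ∧ 1 - θ - a / n < ζ ∧ 1 / (q + 1) ≤ ζ ∧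
      ζ < 1 / (q + 1) + a / n ∧ ζ ≤ 1 - θ ∧ 1 / (q + 1) < 1 - θ := by
  have hp : 0 < p := by linarith
  have hn2 : (2 : ℝ) ≤ n := by exact_mod_cast hn
  have hn0 : (0 : ℝ) < n := by linarith
  obtain ⟨P, hP⟩ : ∃ P : ℝ, P = 1 / (p + 1) := ⟨_, rfl⟩
  obtain ⟨Q, hQ⟩ : ∃ Q : ℝ, Q = 1 / (q + 1) := ⟨_, rfl⟩
  have hP0 : 0 < P := by rw [hP]; positivity
  have hQ0 : 0 < Q := by rw [hQ]; positivity
  have h1 : 1 - 2 / n - Q < P := by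
    have h2 : (n : ℝ) - 1 < (n + 1) * (P + Q) := by
      rw [hP, hQ]; calc _ < _ := hsub
        _ = _ := by ring
    have h3 : 2 / (n : ℝ) * n = 2 := by field_simp
    by_contra hcon
    have h4 : (n : ℝ) * (P + Q) ≤ n - 2 := by nlinarith
    have h5 : (n : ℝ) * (P + Q) ≥ (n / (n + 1)) * (n - 1) := by
      rw [ge_iff_le, div_mul_eq_mul_div, div_le_iff₀ (by linarith)]
      nlinarith
    have h6 : (n : ℝ) / (n + 1) * (n - 1) > n - 2 := by
      rw [gt_iff_lt, div_mul_eq_mul_div, lt_div_iff₀ (by linarith)]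
      nlinarith
    linarith
  have h2 : p * (1 - 2 / n - Q) < Q := by
    have hQp : Q * (q + 1) = 1 := by rw [hQ]; field_simp
    have h3 : ((n : ℝ) - 2) * (p * q - 1) < 2 * (p + 1) := by
      rwa [lt_div_iff₀ (by linarith)] at halpha
    have h4 : p * (1 - 2 / n - Q) * (n * (q + 1)) < Q * (n * (q + 1)) := by
      have e1 : p * (1 - 2 / n - Q) * (n * (q + 1)) = p * (n - 2) * (q + 1) - p * n * (Q * (q + 1)) := by
        field_simp
      have e2 : Q * (n * (q + 1)) = n * (Q * (q + 1)) := by ring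
      rw [e1, e2, hQp]
      nlinarith
    exact lt_of_mul_lt_mul_right h4 (by positivity)
  have hPQ : P < 1 - Q := by
    have : 1 - Q = q / (q + 1) := by rw [hQ]; field_simp; ring
    rw [this, hP, div_lt_div_iff₀ (by linarith) (by linarith)]
    nlinarith
  obtain ⟨θ, hθ1, hθ2⟩ : ∃ θ, max 0 (1 - 2 / n - Q) < θ ∧ θ < min P (Q / p) := by
    refine exists_between (max_lt (lt_min hP0 (by positivity)) (lt_min h1 ?_))
    rw [lt_div_iff₀ hp]; linarith
  have t1 : 0 < θ := (le_max_left _ _).trans_lt hθ1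
  have t2 : 1 - 2 / n - Q < θ := (le_max_right _ _).trans_lt hθ1
  have t3 : θ < P := hθ2.trans_le (min_le_left _ _)
  have t4 : p * θ < Q := by
    have := hθ2.trans_le (min_le_right _ _)
    rw [lt_div_iff₀ hp] at this; linarith
  obtain ⟨a, ha1, ha2⟩ : ∃ a, max 0 (n * (1 - θ - Q) / 2) < a ∧ a < 1 := by
    refine exists_between (max_lt one_pos ?_)
    have : n * (1 - θ - Q) < n * (2 / n) := by
      apply mul_lt_mul_of_pos_left _ hn0; linarith
    have h3 : (n : ℝ) * (2 / n) = 2 := by field_simp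
    linarith
  have a0 : 0 < a := (le_max_left _ _).trans_lt ha1
  have a3 : 1 - θ - Q < 2 * (a / n) := by
    have := (le_max_right _ _).trans_lt ha1
    have h3 : 2 * (a / n) = 2 * a / n := by ring
    rw [h3, lt_div_iff₀ hn0]; linarith
  have an0 : 0 < a / n := by positivity
  obtain ⟨ζ, z1, z2⟩ : ∃ ζ, max (1 - θ - a / n) Q < ζ ∧ ζ < min (Q + a / n) (1 - θ) := by
    refine exists_between (max_lt (lt_min ?_ ?_) (lt_min ?_ ?_)) <;> linarith
  refine ⟨θ, a, ζ, t1, hP ▸ t3, hQ ▸ t4, a0, ha2, ?_, (le_max_left _ _).trans_lt z1,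
    hQ ▸ ((le_max_right _ _).trans z1.le), hQ ▸ (z2.trans_le (min_le_left _ _)),
    z2.le.trans (min_le_right _ _), by rw [← hQ]; linarith⟩
  rw [← hQ]
  refine a3.trans_le ?_
  rw [← mul_div_assoc]
  gcongr
  linarith

theorem cube_mono (n : ℕ) {r R : ℝ} (h : r ≤ R) : cube n r ≤ cube n R := by
  rw [cube_eq, cube_eq]
  refine Measure.restrict_mono (Icc_subset_Icc ?_ ?_) le_rfl
  · exact fun _ => neg_le_neg h
  · exact fun _ => h

theorem exists_good_level {n : ℕ} {a : ℝ} (ha0 : 0 < a) (ha1 : a < 1) : ∃ C : NNReal,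
    ∀ h : (Fin (n + 1) → ℝ) → ENNReal, Measurable h → ∫⁻ y, h y ∂cube (n + 1) 3 ≤ 2 →
      ∃ r ∈ Icc (1 : ℝ) 2, ∀ i, ∫⁻ y, ‖r - y i‖ₑ ^ (-a) * h y ∂cube (n + 1) 3 ≤ C ∧
        ∫⁻ y, ‖-r - y i‖ₑ ^ (-a) * h y ∂cube (n + 1) 3 ≤ C := by
  obtain ⟨C, hC⟩ := exists_weighted_bound ha0 ha1 3
  refine ⟨(n + 1) * (C * 2 + C * 2), fun h hh hintg => ?_⟩
  set M : Fin (n + 1) → ℝ → ENNReal := fun i t => ∫⁻ y, ‖t - y i‖ₑ ^ (-a) * h y ∂cube (n + 1) 3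
    with hM
  have hMm : ∀ i, Measurable (M i) := fun i => by
    have : Measurable fun z : ℝ × (Fin (n + 1) → ℝ) => ‖z.1 - z.2 i‖ₑ ^ (-a) * h z.2 := by fun_prop
    exact this.lintegral_prod_right'
  have hB : ∀ i, ∫⁻ t in Icc (-3 : ℝ) 3, M i t ≤ C * 2 := fun i =>
    (hC (n + 1) i h hh).trans (mul_le_mul_right hintg _)
  have h1 : ∀ i, ∫⁻ t in Icc (1 : ℝ) 2, M i t ≤ C * 2 := fun i =>
    (lintegral_mono_set (Icc_subset_Icc (by norm_num) (by norm_num))).trans (hB i)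
  have h2 : ∀ i, ∫⁻ t in Icc (1 : ℝ) 2, M i (-t) ≤ C * 2 := fun i => by
    have e : ∫⁻ t in Neg.neg ⁻¹' Icc (-3 : ℝ) 3, M i (-t) = ∫⁻ t in Icc (-3 : ℝ) 3, M i t :=
      (Measure.measurePreserving_neg volume).setLIntegral_comp_preimage_emb
        (MeasurableEquiv.neg ℝ).measurableEmbedding (M i) (Icc (-3) 3)
    refine le_trans ?_ (e.le.trans (hB i))
    refine lintegral_mono_set fun t ht => ?_
    simp only [mem_preimage, mem_Icc] at ht ⊢
    constructor <;> linarith [ht.1, ht.2]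
  have hMM : ∀ i, Measurable fun t => M i t + M i (-t) := fun i =>
    (hMm i).add ((hMm i).comp measurable_neg)
  have hW : Measurable fun t => ∑ i, (M i t + M i (-t)) :=
    Finset.measurable_sum _ fun i _ => hMM i
  have hI : ∫⁻ t in Icc (1 : ℝ) 2, ∑ i, (M i t + M i (-t)) ≤ (n + 1) * (C * 2 + C * 2) := by
    rw [lintegral_finsetSum _ fun i _ => hMM i]
    refine (Finset.sum_le_sum (g := fun _ => (C * 2 + C * 2 : ENNReal)) fun i _ => ?_).trans ?_
    · rw [lintegral_add_left (hMm i)]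
      exact add_le_add (h1 i) (h2 i)
    · simp [mul_add]
  obtain ⟨r, hr, hle⟩ := exists_le_setLAverage (μ := volume) (s := Icc (1 : ℝ) 2) (by simp)
    (by simp) hW.aemeasurable
  have hle2 : ∑ i, (M i r + M i (-r)) ≤ (n + 1) * (C * 2 + C * 2) := by
    refine hle.trans ?_
    rw [setLAverage_eq, Real.volume_Icc]
    norm_num
    exact hI
  refine ⟨r, hr, fun i => ?_⟩
  have h3 : M i r + M i (-r) ≤ (n + 1) * (C * 2 + C * 2) :=
    (Finset.single_le_sum (f := fun i => M i r + M i (-r)) (fun _ _ => zero_le)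
      (Finset.mem_univ i)).trans hle2
  push_cast
  exact ⟨le_self_add.trans h3, le_add_self.trans h3⟩

theorem exists_slice_power_bound {a lam k z s τ : ℝ} (ha0 : 0 < a) (ha1 : a < 1)
    (hlam : 0 < lam) (hk : 1 ≤ k) (hz : k ≤ z) (hs : 1 / s = 1 + 1 / z - 1 / k)
    (hls : lam * s < 1) (hτ : 0 < τ) (K D : NNReal) : ∃ K' : NNReal, ∀ (i : Fin (n + 1)) (t r : ℝ)
      (w : (Fin n → ℝ) → ENNReal) (f : (Fin (n + 1) → ℝ) → ENNReal) (Y : ENNReal), 1 ≤ Y → r ≤ 2 →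
      Measurable f →
      (∀ x' : Fin n → ℝ, (∀ l, |x' l| ≤ 2) → w x' ≤ K * (slicePotential a lam i t x' f + 1)) →
      ∫⁻ y, ‖t - y i‖ₑ ^ (-a) * f y ^ k ∂cube (n + 1) 3 ≤ D * Y ^ τ →
      ∫⁻ x', w x' ^ z ∂cube n r ≤ K' * Y ^ (τ * (z / k)) := by
  obtain ⟨C, hC⟩ := exists_slice_bound (n := n) 3 ha0 ha1 hlam hk hz hs hls
  have hz1 : 1 ≤ z := hk.trans hz
  have hk0 : 0 < k := by linarith
  have hz0 : 0 ≤ z := by linarith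
  have hzk : 0 ≤ z / k := by positivity
  refine ⟨K ^ z * (2 ^ (z - 1) * (C * D ^ (z / k) + (6 ^ n : NNReal))), ?_⟩
  intro i t r w f Y hY hr hf hw hM
  have hvol : cube n 3 univ = (6 ^ n : NNReal) := by
    rw [cube_eq, Measure.restrict_apply_univ, Real.volume_Icc_pi]
    norm_num
  have h1 : ∫⁻ x', w x' ^ z ∂cube n r ≤ ∫⁻ x', (K : ENNReal) ^ z * (2 ^ (z - 1) *
      (slicePotential a lam i t x' f ^ z + 1)) ∂cube n r := by
    refine lintegral_mono_ae ?_
    filter_upwards [ae_cube_abs_le n r] with x' hx'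
    refine (ENNReal.rpow_le_rpow (hw x' fun l => (hx' l).trans hr) hz0).trans ?_
    rw [ENNReal.mul_rpow_of_nonneg _ _ hz0]
    refine mul_le_mul_right ?_ _
    refine (ENNReal.rpow_add_le_mul_rpow_add_rpow _ _ hz1).trans ?_
    rw [ENNReal.one_rpow]
  have h2 : ∫⁻ x', (slicePotential a lam i t x' f ^ z + 1) ∂cube n r
      ≤ (C * D ^ (z / k) + (6 ^ n : NNReal)) * Y ^ (τ * (z / k)) := by
    refine (lintegral_mono' (cube_mono n (by linarith : r ≤ 3)) le_rfl).trans ?_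
    rw [lintegral_add_right _ measurable_const, lintegral_one, hvol, add_mul]
    refine add_le_add ?_ ?_
    · refine (hC i t f hf).trans ?_
      rw [mul_assoc]
      refine mul_le_mul_right ((ENNReal.rpow_le_rpow hM hzk).trans ?_) _
      rw [ENNReal.mul_rpow_of_nonneg _ _ hzk, ← ENNReal.rpow_mul]
    · refine le_mul_of_one_le_right' ?_
      exact ENNReal.one_le_rpow hY (mul_pos hτ (div_pos (hk0.trans_le hz) hk0))
  refine h1.trans ?_
  have hK : (K : ENNReal) ^ z ≠ ⊤ := ENNReal.rpow_ne_top_of_nonneg hz0 ENNReal.coe_ne_top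
  have h2t : (2 : ENNReal) ^ (z - 1) ≠ ⊤ := ENNReal.rpow_ne_top_of_nonneg (by linarith) (by simp)
  rw [lintegral_const_mul' _ _ hK, lintegral_const_mul' _ _ h2t]
  refine (mul_le_mul_right (mul_le_mul_right h2 _) _).trans (le_of_eq ?_)
  push_cast
  rw [ENNReal.coe_rpow_of_nonneg _ hz0, ENNReal.coe_rpow_of_nonneg _ (by linarith),
    ENNReal.coe_rpow_of_nonneg _ hzk]
  push_cast
  ring

theorem exists_good_level_pair {n : ℕ} {a : ℝ} (ha0 : 0 < a) (ha1 : a < 1) : ∃ C : NNReal,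
    ∀ (F G : (Fin (n + 1) → ℝ) → ENNReal) (A B : ENNReal), Measurable F → Measurable G →
      A ≠ 0 → A ≠ ⊤ → B ≠ 0 → B ≠ ⊤ → ∫⁻ y, F y ∂cube (n + 1) 3 ≤ A →
      ∫⁻ y, G y ∂cube (n + 1) 3 ≤ B → ∃ r ∈ Icc (1 : ℝ) 2, ∀ i, ∀ t : ℝ, t = r ∨ t = -r →
        ∫⁻ y, ‖t - y i‖ₑ ^ (-a) * F y ∂cube (n + 1) 3 ≤ C * A ∧
        ∫⁻ y, ‖t - y i‖ₑ ^ (-a) * G y ∂cube (n + 1) 3 ≤ C * B := by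
  obtain ⟨C, hC⟩ := exists_good_level (n := n) ha0 ha1
  refine ⟨C, fun F G A B hF hG hA0 hA hB0 hB hFA hGB => ?_⟩
  obtain ⟨r, hr, hle⟩ := hC (fun y => A⁻¹ * F y + B⁻¹ * G y) (by fun_prop) (by
    rw [lintegral_add_left (by fun_prop), lintegral_const_mul _ hF, lintegral_const_mul _ hG]
    refine (add_le_add ?_ ?_).trans one_add_one_eq_two.le
    · exact (mul_le_mul_right hFA _).trans (ENNReal.inv_mul_cancel hA0 hA).le
    · exact (mul_le_mul_right hGB _).trans (ENNReal.inv_mul_cancel hB0 hB).le)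
  refine ⟨r, hr, fun i t ht => ?_⟩
  have h1 : ∫⁻ y, ‖t - y i‖ₑ ^ (-a) * (A⁻¹ * F y + B⁻¹ * G y) ∂cube (n + 1) 3 ≤ C := by
    rcases ht with rfl | rfl
    exacts [(hle i).1, (hle i).2]
  have key : ∀ {H : (Fin (n + 1) → ℝ) → ENNReal} {D : ENNReal}, Measurable H → D ≠ 0 → D ≠ ⊤ →
      (∀ y, D⁻¹ * H y ≤ A⁻¹ * F y + B⁻¹ * G y) →
      ∫⁻ y, ‖t - y i‖ₑ ^ (-a) * H y ∂cube (n + 1) 3 ≤ C * D := by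
    intro H D hH hD0 hD hle
    have h2 : D⁻¹ * ∫⁻ y, ‖t - y i‖ₑ ^ (-a) * H y ∂cube (n + 1) 3 ≤ C := by
      rw [← lintegral_const_mul _ (by fun_prop)]
      refine le_trans (lintegral_mono fun y => ?_) h1
      rw [mul_left_comm]
      exact mul_le_mul_right (hle y) _
    rw [mul_comm] at h2
    rwa [← div_eq_mul_inv, ENNReal.div_le_iff hD0 hD] at h2
  exact ⟨key hF hA0 hA fun y => le_self_add, key hG hB0 hB fun y => le_add_self⟩

theorem exists_interior_bound (hn : 2 ≤ n) (hp : 0 < p) (hq : 0 < q) (hpq : 1 < p * q)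
    (hC₂ : 0 < C₂) (C₁ : ℝ) (L : NNReal) {θ τ : ℝ} (hθ : θ < 1) (hτ0 : 0 < τ) (hτ1 : τ < 1)
    (hτ : τ * (1 - θ) = p * θ) :
    ∃ D : NNReal, D ≠ 0 ∧ ∀ u v : EuclideanSpace ℝ (Fin (n + 1)) → ℝ,
      IsSol p q C₁ C₂ (5 * (n + 1 : ℕ)) u v →
      (∀ x : EuclideanSpace ℝ (Fin (n + 1)), (∀ i, |x i| ≤ 3) →
        ‖v x‖ₑ ^ (p + 1) ≤ L * ‖u x‖ₑ ^ (q + 1) + 1) →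
      ∫⁻ y, ‖v (WithLp.toLp 2 y) ^ p‖ₑ ^ (1 / (1 - θ)) ∂cube (n + 1) 3 ≤
        D * (1 + ∫⁻ y, ‖u (WithLp.toLp 2 y)‖ₑ ^ (q + 1) ∂cube (n + 1) 3) ^ τ := by
  obtain ⟨M, hM⟩ := exists_integral_bound (N := n + 1) (by omega) hp hq hpq hC₂ C₁
  refine ⟨M ^ (1 - τ) * (L + 6 ^ (n + 1)) ^ τ + 1, by positivity, fun u v h hcomp => ?_⟩
  set Y : ENNReal := 1 + ∫⁻ y, ‖u (WithLp.toLp 2 y)‖ₑ ^ (q + 1) ∂cube (n + 1) 3 with hY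
  have T := (PiLp.continuousLinearEquiv 2 ℝ (fun _ : Fin (n + 1) => ℝ)).symm.continuous
  have hv : Continuous fun y : Fin (n + 1) → ℝ => v (WithLp.toLp 2 y) :=
    h.contDiff_v.continuous.comp T
  have hball : ∀ y : EuclideanSpace ℝ (Fin (n + 1)), (∀ i, |y i| ≤ 3) →
      ‖y‖ < 4 * (n + 1 : ℕ) := fun y hy => by
    have h0 : (0 : ℝ) < (n + 1 : ℕ) := by positivity
    linarith [norm_le_of_abs_coord_le hy]
  have h1 : ∫⁻ y, ‖v (WithLp.toLp 2 y) ^ p‖ₑ ∂cube (n + 1) 3 ≤ M :=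
    (cube_lintegral_le (fun y hy => by rw [mem_ball_zero_iff]; exact hball y hy)
      fun y => ‖v y ^ p‖ₑ).trans (hM u v h).1
  have hvol : cube (n + 1) 3 univ = (6 ^ (n + 1) : NNReal) := by
    rw [cube_eq, Measure.restrict_apply_univ, Real.volume_Icc_pi]
    norm_num
  have h2 : ∫⁻ y, ‖v (WithLp.toLp 2 y)‖ₑ ^ (p + 1) ∂cube (n + 1) 3 ≤
      (L + (6 ^ (n + 1) : NNReal)) * Y := by
    calc _ ≤ ∫⁻ y, (L * ‖u (WithLp.toLp 2 y)‖ₑ ^ (q + 1) + 1) ∂cube (n + 1) 3 := by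
          refine lintegral_mono_ae ?_
          filter_upwards [ae_cube_abs_le (n + 1) 3] with y hy
          exact hcomp _ hy
      _ = L * ∫⁻ y, ‖u (WithLp.toLp 2 y)‖ₑ ^ (q + 1) ∂cube (n + 1) 3
          + (6 ^ (n + 1) : NNReal) := by
          rw [lintegral_add_right _ measurable_const, lintegral_const_mul' _ _ ENNReal.coe_ne_top,
            lintegral_one, hvol]
      _ ≤ _ := by
          rw [add_mul]
          exact add_le_add (mul_le_mul_right le_add_self _)
            (le_mul_of_one_le_right' le_self_add)
  have h3 : ∫⁻ y, ‖v (WithLp.toLp 2 y) ^ p‖ₑ ^ (1 / (1 - θ)) ∂cube (n + 1) 3 =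
      ∫⁻ y, ‖v (WithLp.toLp 2 y) ^ p‖ₑ ^ (1 - τ) * (‖v (WithLp.toLp 2 y)‖ₑ ^ (p + 1)) ^ τ
        ∂cube (n + 1) 3 := by
    refine lintegral_congr_ae ?_
    filter_upwards [ae_cube_abs_le (n + 1) 3] with y hy
    have hv0 : 0 ≤ v (WithLp.toLp 2 y) := h.v_nonneg _ (by
      rw [mem_ball_zero_iff]
      have := hball (WithLp.toLp 2 y) hy
      have h0 : (0 : ℝ) < (n + 1 : ℕ) := by positivity
      linarith)
    rw [Real.enorm_rpow_of_nonneg hv0 hp.le, ← ENNReal.rpow_mul, ← ENNReal.rpow_mul,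
      ← ENNReal.rpow_mul, ← ENNReal.rpow_add_of_nonneg _ _ (by nlinarith) (by nlinarith)]
    congr 1
    have : 1 - θ ≠ 0 := by linarith
    field_simp
    linear_combination (-1) * hτ
  rw [h3]
  have hvm := hv.measurable
  refine (ENNReal.lintegral_mul_norm_pow_le (hvm.pow_const p).enorm.aemeasurable
    (hvm.enorm.pow_const (p + 1)).aemeasurable (by linarith) hτ0.le
    (by ring)).trans ?_
  refine (mul_le_mul' (ENNReal.rpow_le_rpow h1 (by linarith)) (ENNReal.rpow_le_rpow h2 hτ0.le)).trans ?_
  rw [ENNReal.mul_rpow_of_nonneg _ _ hτ0.le, ← mul_assoc]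
  refine mul_le_mul_left ?_ _
  push_cast
  rw [ENNReal.coe_rpow_of_nonneg _ (by linarith), ENNReal.coe_rpow_of_nonneg _ hτ0.le]
  push_cast
  exact le_self_add

end KeyEstimate

section KeyBound

variable {n : ℕ} {p q C₁ C₂ : ℝ}

theorem ofReal_bdryDensity (hp : 0 < p) (hq : 0 < q) {N : ℕ} (u v : EuclideanSpace ℝ (Fin N) → ℝ)
    (x : EuclideanSpace ℝ (Fin N)) : ENNReal.ofReal (bdryDensity p q u v x) =
      ‖u x‖ₑ ^ (q + 1) + ‖v x‖ₑ ^ (p + 1) + ‖jetSum u x‖ₑ * ‖jetSum v x‖ₑ := by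
  have hu := jetSum_nonneg u x
  have hv := jetSum_nonneg v x
  rw [bdryDensity, ENNReal.ofReal_add (by positivity) (by positivity),
    ENNReal.ofReal_add (by positivity) (by positivity), ENNReal.ofReal_mul hu,
    ← ENNReal.ofReal_rpow_of_nonneg (abs_nonneg _) (by positivity),
    ← ENNReal.ofReal_rpow_of_nonneg (abs_nonneg _) (by positivity), ← Real.norm_eq_abs,
    ← Real.norm_eq_abs, ofReal_norm, ofReal_norm, Real.enorm_of_nonneg hu, Real.enorm_of_nonneg hv]

theorem exists_key_bound (hn : 2 ≤ n) (hq : 0 < q) (hqp : q ≤ p) (hpq : 1 < p * q)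
    (hsub : (n : ℝ) - 1 < (n + 1) / (p + 1) + (n + 1) / (q + 1))
    (halpha : (n : ℝ) - 2 < 2 * (p + 1) / (p * q - 1)) (hC₂ : 0 < C₂) (C₁ : ℝ) (L : NNReal) :
    ∃ K : NNReal, ∃ b : ℝ, 0 < b ∧ b < 1 ∧
      ∀ (u v : EuclideanSpace ℝ (Fin (n + 1)) → ℝ) (c d : ℝ),
      IsSol p q C₁ C₂ (5 * (n + 1 : ℕ)) u v → C₂ ≤ c → c ≤ C₁ → C₂ ≤ d → d ≤ C₁ →
      (∀ x : EuclideanSpace ℝ (Fin (n + 1)), (∀ i, |x i| ≤ 3) →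
        ‖v x‖ₑ ^ (p + 1) ≤ L * ‖u x‖ₑ ^ (q + 1) + 1) →
      (∀ x : EuclideanSpace ℝ (Fin (n + 1)), (∀ i, |x i| ≤ 2) →
        |lap u x + c * v x ^ p| * jetSum v x ≤ 1 ∧ |lap v x + d * u x ^ q| * jetSum u x ≤ 1) →
      ∫⁻ y, ‖u (WithLp.toLp 2 y)‖ₑ ^ (q + 1) ∂cube (n + 1) 1 ≤
        K * (1 + ∫⁻ y, ‖u (WithLp.toLp 2 y)‖ₑ ^ (q + 1) ∂cube (n + 1) 3) ^ b := by
  have hp : 0 < p := by linarith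
  obtain ⟨θ, a, ζ, hθ0, hθp, hpθ, ha0, ha1, e1, e2, e3, e4, e5, e6⟩ :=
    exists_exponents hn hq hqp hpq hsub halpha
  obtain ⟨Q, hQ⟩ : ∃ Q : ℝ, Q = 1 / (q + 1) := ⟨_, rfl⟩
  rw [← hQ] at hpθ e1 e3 e4 e6
  have hQ0 : 0 < Q := by rw [hQ]; positivity
  have hQq : Q * (q + 1) = 1 := by rw [hQ]; field_simp
  have hθ1 : θ < 1 := by linarith
  have hn2 : (2 : ℝ) ≤ n := by exact_mod_cast hn
  have hn0 : (0 : ℝ) < n := by linarith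
  have hζ0 : 0 < ζ := by linarith
  have hζ1 : ζ < 1 := by linarith
  obtain ⟨τ, hτ⟩ : ∃ τ : ℝ, τ = p * θ / (1 - θ) := ⟨_, rfl⟩
  have hτe : τ * (1 - θ) = p * θ := by
    rw [hτ, div_mul_cancel₀ _ (by linarith)]
  have hτ0 : 0 < τ := by rw [hτ]; exact div_pos (by positivity) (by linarith)
  have hτ1 : τ < 1 := by rw [hτ, div_lt_one (by linarith)]; linarith
  obtain ⟨D, hD0, hD⟩ := exists_interior_bound hn hp hq hpq hC₂ C₁ L hθ1 hτ0 hτ1 hτe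
  obtain ⟨C, hC⟩ := exists_good_level_pair (n := n) ha0 ha1
  obtain ⟨Ku, hKu⟩ := exists_slicePotential_bound hn hp hq hpq hC₂ C₁ ha0 ha1
  obtain ⟨Kv, hKv⟩ := exists_slicePotential_bound hn hq hp (by linarith [mul_comm p q]) hC₂ C₁
    ha0 ha1
  have hna : a / n < 1 := by rw [div_lt_one hn0]; linarith
  have hlam : ((n : ℝ) - a) / n = 1 - a / n := by field_simp
  have hlam' : ((n : ℝ) - 1 - a) / n = 1 - (1 + a) / n := by field_simp; ring
  have hls : ∀ {lam s : ℝ}, 0 < s → lam < s → lam * (1 / s) < 1 := fun hs h => by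
    rw [mul_one_div, div_lt_one hs]; exact h
  obtain ⟨K1, hK1⟩ := exists_slice_power_bound (n := n) (a := a) (lam := (n - 1 - a) / n)
    (k := 1 / (1 - θ)) (z := q + 1) (s := 1 / (θ + Q)) (τ := τ) ha0 ha1
    (div_pos (by linarith) hn0) (by rw [le_div_iff₀ (by linarith)]; linarith)
    (by rw [div_le_iff₀ (by linarith)]; nlinarith)
    (by rw [one_div_one_div, one_div_one_div, ← hQ]; ring)
    (hls (by linarith) (by linarith)) hτ0 Ku (C * D)
  obtain ⟨K2, hK2⟩ := exists_slice_power_bound (n := n) (a := a) (lam := (n - a) / n)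
    (k := 1 / (1 - θ)) (z := 1 / ζ) (s := 1 / (θ + ζ)) (τ := τ) ha0 ha1
    (div_pos (by linarith) hn0) (by rw [le_div_iff₀ (by linarith)]; linarith)
    (one_div_le_one_div_of_le hζ0 e5)
    (by rw [one_div_one_div, one_div_one_div, one_div_one_div]; ring)
    (hls (by linarith) (by linarith)) hτ0 Ku (C * D)
  obtain ⟨K3, hK3⟩ := exists_slice_power_bound (n := n) (a := a) (lam := (n - a) / n)
    (k := 1 / (1 - Q)) (z := 1 / (1 - ζ)) (s := 1 / (1 - ζ + Q)) (τ := 1) ha0 ha1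
    (div_pos (by linarith) hn0) (by rw [le_div_iff₀ (by linarith)]; linarith)
    (one_div_le_one_div_of_le (by linarith) (by linarith))
    (by rw [one_div_one_div, one_div_one_div, one_div_one_div]; ring)
    (hls (by linarith) (by linarith)) one_pos Kv C
  obtain ⟨K0, hK0⟩ := exists_pohozaev_bound (C₁ := C₁) hp hq hC₂ hsub
  obtain ⟨b, hb⟩ : ∃ b : ℝ, b = max ((q + 1) * (p * θ)) (p * θ + 1 - Q) := ⟨_, rfl⟩
  have hpθ0 : 0 < p * θ := by positivity
  have hb0 : 0 < b := by rw [hb]; exact lt_max_of_lt_left (by positivity)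
  have hb1 : b < 1 := by rw [hb]; exact max_lt (by nlinarith) (by linarith)
  obtain ⟨B, hB⟩ : ∃ B : NNReal, B = K1 + (L * K1 + 6 ^ n) + K2 ^ ζ * K3 ^ (1 - ζ) := ⟨_, rfl⟩
  refine ⟨K0 * (1 + (n + 1) * (B + B)), b, hb0, hb1, fun u v c d h hc1 hc2 hd1 hd2 hcomp herr => ?_⟩
  set Y : ENNReal := 1 + ∫⁻ y, ‖u (WithLp.toLp 2 y)‖ₑ ^ (q + 1) ∂cube (n + 1) 3 with hY
  have hY1 : 1 ≤ Y := le_self_add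
  have T := (PiLp.continuousLinearEquiv 2 ℝ (fun _ : Fin (n + 1) => ℝ)).symm.continuous
  have hum : Measurable fun y : Fin (n + 1) → ℝ => u (WithLp.toLp 2 y) :=
    (h.contDiff_u.continuous.comp T).measurable
  have hvm : Measurable fun y : Fin (n + 1) → ℝ => v (WithLp.toLp 2 y) :=
    (h.contDiff_v.continuous.comp T).measurable
  have hball : ∀ x : EuclideanSpace ℝ (Fin (n + 1)), (∀ i, |x i| ≤ 3) →
      x ∈ ball (0 : EuclideanSpace ℝ (Fin (n + 1))) (5 * (n + 1 : ℕ)) := fun x hx => by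
    rw [mem_ball_zero_iff]
    have h0 : (0 : ℝ) < (n + 1 : ℕ) := by positivity
    linarith [norm_le_of_abs_coord_le hx]
  have hYt : Y ≠ ⊤ := by
    have h1 : Continuous fun y : Fin (n + 1) → ℝ => |u (WithLp.toLp 2 y)| ^ (q + 1) :=
      (Real.continuous_rpow_const (by linarith)).comp (h.contDiff_u.continuous.comp T).abs
    have h2 := (integrable_cube 3 h1).2
    refine ENNReal.add_ne_top.2 ⟨ENNReal.one_ne_top, ?_⟩
    refine ne_of_eq_of_ne (lintegral_congr fun y => ?_) h2.ne
    rw [Real.enorm_rpow_of_nonneg (abs_nonneg _) (by linarith), Real.enorm_abs]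
  have hYpow : ∀ e : ℝ, Y ^ e ≠ 0 := fun e =>
    (ENNReal.rpow_pos (zero_lt_one.trans_le hY1) hYt).ne'
  have hYpow' : ∀ e : ℝ, 0 ≤ e → Y ^ e ≠ ⊤ := fun e he => ENNReal.rpow_ne_top_of_nonneg he hYt
  have hYb : ∀ e : ℝ, e ≤ b → Y ^ e ≤ Y ^ b := fun e he =>
    ENNReal.rpow_le_rpow_of_exponent_le hY1 he
  have hG : ∫⁻ y, ‖u (WithLp.toLp 2 y) ^ q‖ₑ ^ (1 / (1 - Q)) ∂cube (n + 1) 3 ≤ Y := by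
    refine le_trans (le_of_eq (lintegral_congr_ae ?_)) le_add_self
    filter_upwards [ae_cube_abs_le (n + 1) 3] with y hy
    rw [Real.enorm_rpow_of_nonneg (h.u_nonneg _ (hball _ hy)) hq.le, ← ENNReal.rpow_mul]
    congr 1
    have : 1 - Q ≠ 0 := by linarith
    field_simp
    linear_combination hQq
  obtain ⟨r, hr, hlev⟩ := hC (fun y => ‖v (WithLp.toLp 2 y) ^ p‖ₑ ^ (1 / (1 - θ)))
    (fun y => ‖u (WithLp.toLp 2 y) ^ q‖ₑ ^ (1 / (1 - Q))) (D * Y ^ τ) Y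
    ((hvm.pow_const p).enorm.pow_const _) ((hum.pow_const q).enorm.pow_const _)
    (mul_ne_zero (by exact_mod_cast hD0) (hYpow τ))
    (ENNReal.mul_ne_top ENNReal.coe_ne_top (hYpow' τ hτ0.le)) (zero_lt_one.trans_le hY1).ne' hYt
    (hD u v h hcomp) hG
  have hface : ∀ (i : Fin (n + 1)) (t : ℝ), t = r ∨ t = -r →
      ∫⁻ x, ENNReal.ofReal (bdryDensity p q u v (WithLp.toLp 2 (i.insertNth t x))) ∂cube n r ≤
        B * Y ^ b := by
    intro i t ht
    have ht2 : |t| ≤ 2 := by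
      rcases ht with rfl | rfl
      · rw [abs_of_nonneg (by linarith [hr.1])]; exact hr.2
      · rw [abs_neg, abs_of_nonneg (by linarith [hr.1])]; exact hr.2
    have hins : Continuous fun x : Fin n → ℝ => (WithLp.toLp 2 (i.insertNth t x) :
        EuclideanSpace ℝ (Fin (n + 1))) := T.comp (continuous_const.finInsertNth i continuous_id)
    have hjet : ∀ {w : EuclideanSpace ℝ (Fin (n + 1)) → ℝ}, ContDiff ℝ 2 w →
        Measurable fun x : Fin n → ℝ => ‖jetSum w (WithLp.toLp 2 (i.insertNth t x))‖ₑ :=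
      fun hw => ((jetSum_continuous (hw.of_le one_le_two)).comp hins).measurable.enorm
    have huf : Measurable fun x : Fin n → ℝ => ‖u (WithLp.toLp 2 (i.insertNth t x))‖ₑ :=
      (h.contDiff_u.continuous.comp hins).measurable.enorm
    obtain ⟨l1, l2⟩ := hlev i t ht
    have l1' : ∫⁻ y, ‖t - y i‖ₑ ^ (-a) * ‖v (WithLp.toLp 2 y) ^ p‖ₑ ^ (1 / (1 - θ))
        ∂cube (n + 1) 3 ≤ (C * D : NNReal) * Y ^ τ := by
      push_cast; rw [mul_assoc]; exact l1
    have l2' : ∫⁻ y, ‖t - y i‖ₑ ^ (-a) * ‖u (WithLp.toLp 2 y) ^ q‖ₑ ^ (1 / (1 - Q))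
        ∂cube (n + 1) 3 ≤ C * Y ^ (1 : ℝ) := by rw [ENNReal.rpow_one]; exact l2
    have b1 := hK1 i t r (fun x => ‖u (WithLp.toLp 2 (i.insertNth t x))‖ₑ) _ Y hY1 hr.2
      (hvm.pow_const p).enorm (fun x' hx' => (hKu u v h i t x' ht2 hx').1) l1'
    have b2 := hK2 i t r (fun x => ‖jetSum u (WithLp.toLp 2 (i.insertNth t x))‖ₑ) _ Y hY1 hr.2
      (hvm.pow_const p).enorm (fun x' hx' => (hKu u v h i t x' ht2 hx').2) l1'
    have b3 := hK3 i t r (fun x => ‖jetSum v (WithLp.toLp 2 (i.insertNth t x))‖ₑ) _ Y hY1 hr.2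
      (hum.pow_const q).enorm (fun x' hx' => (hKv v u h.symm i t x' ht2 hx').2) l2'
    have b1' : ∫⁻ x, ‖u (WithLp.toLp 2 (i.insertNth t x))‖ₑ ^ (q + 1) ∂cube n r ≤ K1 * Y ^ b := by
      refine b1.trans (mul_le_mul_right (hYb _ ?_) _)
      have : τ * ((q + 1) / (1 / (1 - θ))) = (q + 1) * (p * θ) := by
        rw [div_div_eq_mul_div, div_one]; linear_combination (q + 1) * hτe
      rw [this, hb]; exact le_max_left _ _
    have b4 : ∫⁻ x, ‖v (WithLp.toLp 2 (i.insertNth t x))‖ₑ ^ (p + 1) ∂cube n r ≤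
        (L * K1 + (6 ^ n : NNReal)) * Y ^ b := by
      have hvol : cube n r univ ≤ (6 ^ n : NNReal) := by
        refine (cube_mono n (by linarith [hr.2] : r ≤ 3) univ).trans ?_
        rw [cube_eq, Measure.restrict_apply_univ, Real.volume_Icc_pi]
        norm_num
      calc _ ≤ ∫⁻ x, (L * ‖u (WithLp.toLp 2 (i.insertNth t x))‖ₑ ^ (q + 1) + 1) ∂cube n r := by
            refine lintegral_mono_ae ?_
            filter_upwards [ae_cube_abs_le n r] with x hx
            refine hcomp _ fun j => ?_
            rcases Fin.eq_self_or_eq_succAbove i j with rfl | ⟨k, rfl⟩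
            · simpa using ht2.trans (by norm_num)
            · simpa using (hx k).trans (by linarith [hr.2])
        _ = L * ∫⁻ x, ‖u (WithLp.toLp 2 (i.insertNth t x))‖ₑ ^ (q + 1) ∂cube n r
            + cube n r univ := by
            rw [lintegral_add_right _ measurable_const, lintegral_const_mul' _ _ ENNReal.coe_ne_top,
              lintegral_one]
        _ ≤ _ := by
            rw [add_mul, mul_assoc]
            refine add_le_add (mul_le_mul_right b1' _) (hvol.trans (le_mul_of_one_le_right' ?_))
            exact ENNReal.one_le_rpow hY1 hb0
    have b5 : ∫⁻ x, ‖jetSum u (WithLp.toLp 2 (i.insertNth t x))‖ₑ *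
        ‖jetSum v (WithLp.toLp 2 (i.insertNth t x))‖ₑ ∂cube n r ≤ (K2 ^ ζ * K3 ^ (1 - ζ)) * Y ^ b := by
      have hh := ENNReal.lintegral_mul_norm_pow_le (μ := cube n r)
        ((hjet h.contDiff_u).pow_const (1 / ζ)).aemeasurable
        ((hjet h.contDiff_v).pow_const (1 / (1 - ζ))).aemeasurable hζ0.le (by linarith : 0 ≤ 1 - ζ)
        (by ring)
      have hz : ∀ s : ℝ, 0 < s → ∀ X : ENNReal, (X ^ (1 / s)) ^ s = X := fun s hs X => by
        rw [← ENNReal.rpow_mul, one_div_mul_cancel hs.ne', ENNReal.rpow_one]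
      simp only [hz ζ hζ0, hz (1 - ζ) (by linarith)] at hh
      refine hh.trans ((mul_le_mul' (ENNReal.rpow_le_rpow b2 hζ0.le)
        (ENNReal.rpow_le_rpow b3 (by linarith : 0 ≤ 1 - ζ))).trans ?_)
      rw [ENNReal.mul_rpow_of_nonneg _ _ hζ0.le,
        ENNReal.mul_rpow_of_nonneg _ _ (by linarith : 0 ≤ 1 - ζ), mul_mul_mul_comm]
      refine mul_le_mul_right ?_ _
      rw [← ENNReal.rpow_mul, ← ENNReal.rpow_mul, ← ENNReal.rpow_add _ _ (by positivity) hYt]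
      refine hYb _ ?_
      have h1ζ : 1 - ζ ≠ 0 := by linarith
      have : τ * (1 / ζ / (1 / (1 - θ))) * ζ + 1 * (1 / (1 - ζ) / (1 / (1 - Q))) * (1 - ζ) =
          p * θ + 1 - Q := by
        rw [← hτe, div_div_eq_mul_div, div_div_eq_mul_div]
        field_simp
        ring
      rw [this, hb]
      exact le_max_right _ _
    simp_rw [ofReal_bdryDensity hp hq]
    have hmm : Measurable fun x : Fin n → ℝ => ‖u (WithLp.toLp 2 (i.insertNth t x))‖ₑ ^ (q + 1) +
        ‖v (WithLp.toLp 2 (i.insertNth t x))‖ₑ ^ (p + 1) :=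
      (huf.pow_const _).add ((h.contDiff_v.continuous.comp hins).measurable.enorm.pow_const _)
    rw [lintegral_add_left hmm, lintegral_add_left (huf.pow_const _), hB]
    refine (add_le_add (add_le_add b1' b4) b5).trans (le_of_eq ?_)
    push_cast
    rw [ENNReal.coe_rpow_of_nonneg _ hζ0.le, ENNReal.coe_rpow_of_nonneg _ (by linarith)]
    ring
  refine (lintegral_mono' (cube_mono (n + 1) hr.1) le_rfl).trans ?_
  refine (hK0 u v c d r h.contDiff_u h.contDiff_v hc1 hc2 hd1 hd2 hr.1 hr.2 (fun x hx =>
    have hx' := hball x fun i => (hx i).trans (by norm_num)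
    ⟨h.u_nonneg x hx', h.v_nonneg x hx'⟩) herr).trans ?_
  have hsum := Finset.sum_le_sum fun (i : Fin (n + 1)) (_ : i ∈ Finset.univ) =>
    add_le_add (hface i r (.inl rfl)) (hface i (-r) (.inr rfl))
  push_cast
  rw [mul_assoc]
  refine mul_le_mul_right ?_ _
  rw [add_mul, one_mul]
  refine add_le_add (ENNReal.one_le_rpow hY1 hb0) (hsum.trans (le_of_eq ?_))
  simp [mul_add, add_mul, mul_assoc]

end KeyBound

section Comparison

variable {N : ℕ} {u v : EuclideanSpace ℝ (Fin N) → ℝ}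

theorem deriv_deriv_nonpos_of_isLocalMax {g : ℝ → ℝ} {t : ℝ} (hc : ContinuousAt g t)
    (h : IsLocalMax g t) : deriv (deriv g) t ≤ 0 := by
  by_contra! hpos
  have hmin := isLocalMin_of_deriv_deriv_pos hpos h.deriv_eq_zero hc
  have heq : g =ᶠ[nhds t] fun _ => g t := by
    filter_upwards [h, hmin] with s h1 h2 using le_antisymm h1 h2
  have : deriv (deriv g) t = 0 := by
    rw [heq.deriv.deriv_eq]; simp
  linarith

theorem hasDerivAt_line (hu : ContDiff ℝ 1 u) (i : Fin N) (x : EuclideanSpace ℝ (Fin N)) (t : ℝ) :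
    HasDerivAt (fun s : ℝ => u (x + s • EuclideanSpace.single i 1))
      (pd i u (x + t • EuclideanSpace.single i 1)) t := by
  have h1 : HasDerivAt (fun s : ℝ => x + s • EuclideanSpace.single i (1 : ℝ))
      (EuclideanSpace.single i 1) t := by
    simpa using ((hasDerivAt_id t).smul_const (EuclideanSpace.single i (1 : ℝ))).const_add x
  exact ((hu.differentiable one_ne_zero _).hasFDerivAt.comp_hasDerivAt t h1)

theorem lap_nonpos_of_isLocalMax (hu : ContDiff ℝ 2 u) {x : EuclideanSpace ℝ (Fin N)}
    (h : IsLocalMax u x) : lap u x ≤ 0 := by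
  rw [lap_eq_sum_pd hu]
  refine Finset.sum_nonpos fun i _ => ?_
  have h1 : ContDiff ℝ 1 u := hu.of_le one_le_two
  have hd : deriv (fun s : ℝ => u (x + s • EuclideanSpace.single i 1)) =
      fun t => pd i u (x + t • EuclideanSpace.single i 1) :=
    funext fun t => (hasDerivAt_line h1 i x t).deriv
  have hdd := (hasDerivAt_line (pd_contDiff hu i) i x 0).deriv
  rw [← hd, zero_smul, add_zero] at hdd
  rw [← hdd]
  have hc : ContinuousAt (fun s : ℝ => x + s • EuclideanSpace.single i (1 : ℝ)) 0 := by fun_prop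
  refine deriv_deriv_nonpos_of_isLocalMax (hasDerivAt_line h1 i x 0).continuousAt ?_
  have ht : Tendsto (fun s : ℝ => x + s • EuclideanSpace.single i (1 : ℝ)) (nhds 0) (nhds x) := by
    simpa using hc.tendsto
  have := ht.eventually h
  simpa [IsLocalMax, IsMaxFilter] using this

theorem lap_sub (hu : ContDiff ℝ 2 u) (hv : ContDiff ℝ 2 v) (x : EuclideanSpace ℝ (Fin N)) :
    lap (u - v) x = lap u x - lap v x := by
  simp only [lap]
  rw [iteratedFDeriv_sub_apply hu.contDiffAt hv.contDiffAt]
  simp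

theorem lap_const_mul (hu : ContDiff ℝ 2 u) (c : ℝ) (x : EuclideanSpace ℝ (Fin N)) :
    lap (c • u) x = c * lap u x := by
  simp only [lap]
  rw [iteratedFDeriv_const_smul_apply hu.contDiffAt]
  simp [Finset.mul_sum]

theorem contDiff_sum_sq {k : ℕ∞} :
    ContDiff ℝ k (fun x : EuclideanSpace ℝ (Fin N) => ∑ j, x j * x j) :=
  ContDiff.sum fun j _ => (coord_contDiff j).mul (coord_contDiff j)

theorem lap_sum_sq (x : EuclideanSpace ℝ (Fin N)) :
    lap (fun x : EuclideanSpace ℝ (Fin N) => ∑ j, x j * x j) x = 2 * N := by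
  have hd : ∀ (j : Fin N) (x : EuclideanSpace ℝ (Fin N)),
      DifferentiableAt ℝ (fun y : EuclideanSpace ℝ (Fin N) => y j) x := fun j x =>
    (coord_contDiff (k := 1) j).differentiable one_ne_zero x
  have h1 : ∀ i : Fin N, pd i (fun x : EuclideanSpace ℝ (Fin N) => ∑ j, x j * x j) =
      fun x => 2 * x i := fun i => funext fun x => by
    have h3 := pd_sum (F := fun j y => y j * y j) (fun j => (hd j x).mul (hd j x)) i
    rw [h3]
    have h2 : ∀ j, pd i (fun y : EuclideanSpace ℝ (Fin N) => y j * y j) x = _ := fun j =>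
      pd_mul (hd j x) (hd j x) i
    simp only [h2, pd_coord, ite_mul, one_mul, zero_mul, mul_ite, mul_one, mul_zero]
    rw [Finset.sum_add_distrib]
    simp
    ring
  rw [lap_eq_sum_pd (contDiff_sum_sq (k := 2))]
  simp only [h1]
  simp_rw [fun i => pd_const_mul 2 (hd i x) i, pd_coord]
  simp
  ring

theorem rpow_le_tangent {a b σ : ℝ} (ha : 0 < a) (hb : 0 ≤ b) (hσ0 : 0 ≤ σ) (hσ1 : σ ≤ 1) :
    b ^ σ ≤ a ^ σ + σ * a ^ (σ - 1) * (b - a) := by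
  have h := rpow_one_add_le_one_add_mul_self (s := b / a - 1)
    (by linarith [div_nonneg hb ha.le]) hσ0 hσ1
  rw [add_sub_cancel, Real.div_rpow hb ha.le, div_le_iff₀ (Real.rpow_pos_of_pos ha σ)] at h
  refine h.trans (le_of_eq ?_)
  rw [Real.rpow_sub_one ha.ne']
  field_simp

variable {p q C₁ C₂ : ℝ}

theorem exists_comparison (N : ℕ) (hp : 0 < p) (hq : 0 < q) (hqp : q ≤ p) (hC₂ : 0 < C₂)
    {M ρ τ l : ℝ} (hM : 0 < M) (hρ : 0 < ρ) (hτ : 0 < τ) (hl : 0 < l)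
    (hl2 : 2 * C₁ ≤ l ^ (p + 1) * ((q + 1) / (p + 1)) * C₂) : ∃ K, ρ ≤ K ∧
      ∀ u v : EuclideanSpace ℝ (Fin N) → ℝ, IsSol p q C₁ C₂ K u v →
        (∀ x ∈ ball 0 K, u x ≤ M ∧ v x ≤ M) →
        ∀ x ∈ ball 0 ρ, v x ≤ l * u x ^ ((q + 1) / (p + 1)) + τ := by
  obtain ⟨σ, hσ⟩ : ∃ σ, σ = (q + 1) / (p + 1) := ⟨_, rfl⟩
  rw [← hσ] at hl2 ⊢
  have hσ0 : 0 < σ := by rw [hσ]; positivity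
  have hσ1 : σ ≤ 1 := by rw [hσ, div_le_one (by linarith)]; linarith
  have hσp : σ * p + (σ - 1) = q := by rw [hσ]; field_simp; ring
  obtain ⟨A, hA⟩ : ∃ A, A = l * σ * M ^ (σ - 1) * C₂ * (τ / 2) ^ p / 2 := ⟨_, rfl⟩
  have hA0 : 0 < A := by rw [hA]; positivity
  obtain ⟨η, hη⟩ : ∃ η, η = min (τ / (2 * ρ ^ 2)) (A / (4 * (N + 1))) := ⟨_, rfl⟩
  have hη0 : 0 < η := by rw [hη]; positivity
  have hη1 : η * ρ ^ 2 ≤ τ / 2 := by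
    have : η ≤ τ / (2 * ρ ^ 2) := by rw [hη]; exact min_le_left _ _
    rw [le_div_iff₀ (by positivity)] at this
    linarith
  have hη2 : 2 * N * η < A := by
    have : η ≤ A / (4 * (N + 1)) := by rw [hη]; exact min_le_right _ _
    rw [le_div_iff₀ (by positivity)] at this
    nlinarith [(Nat.cast_nonneg N : (0 : ℝ) ≤ N)]
  obtain ⟨R, hR⟩ : ∃ R, R = max ρ (Real.sqrt (M / η)) := ⟨_, rfl⟩
  have hRρ : ρ ≤ R := by rw [hR]; exact le_max_left _ _
  have hRM : M ≤ η * R ^ 2 := by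
    have h1 : Real.sqrt (M / η) ≤ R := by rw [hR]; exact le_max_right _ _
    have h2 : M / η ≤ R ^ 2 := by
      rw [← Real.sq_sqrt (by positivity : 0 ≤ M / η)]
      gcongr
    rw [div_le_iff₀ hη0] at h2
    linarith
  refine ⟨R + 1, by linarith, fun u v h hbd x₀ hx₀ => ?_⟩
  by_contra! hcon
  have hsub : closedBall (0 : EuclideanSpace ℝ (Fin N)) R ⊆ ball 0 (R + 1) :=
    closedBall_subset_ball (by linarith)
  set φ : EuclideanSpace ℝ (Fin N) → ℝ := fun x => v x - l * u x ^ σ - η * ‖x‖ ^ 2 with hφ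
  have hφc : Continuous φ := by
    have h1 := (Real.continuous_rpow_const hσ0.le).comp h.contDiff_u.continuous
    have h2 := h.contDiff_v.continuous
    exact (h2.sub (continuous_const.mul h1)).sub (continuous_const.mul (continuous_norm.pow 2))
  have hx₀R : x₀ ∈ closedBall (0 : EuclideanSpace ℝ (Fin N)) R :=
    ball_subset_closedBall (ball_subset_ball hRρ hx₀)
  obtain ⟨x₁, hx₁, hmax⟩ := (isCompact_closedBall (0 : EuclideanSpace ℝ (Fin N)) R).exists_isMaxOn
    ⟨x₀, hx₀R⟩ hφc.continuousOn
  have hpos : τ / 2 < φ x₁ := by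
    refine lt_of_lt_of_le ?_ (hmax hx₀R)
    have h1 : ‖x₀‖ ≤ ρ := (mem_ball_zero_iff.1 hx₀).le
    have h2 : η * ‖x₀‖ ^ 2 ≤ η * ρ ^ 2 := by gcongr
    simp only [hφ]
    linarith
  have hu₁ := h.u_nonneg x₁ (hsub hx₁)
  have hv₁ : τ / 2 + l * u x₁ ^ σ < v x₁ := by
    have : 0 ≤ η * ‖x₁‖ ^ 2 := by positivity
    simp only [hφ] at hpos
    linarith
  have hlu : 0 ≤ l * u x₁ ^ σ := by positivity
  have hx₁R : x₁ ∈ ball (0 : EuclideanSpace ℝ (Fin N)) R := by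
    rw [mem_ball_zero_iff]
    refine lt_of_le_of_ne (mem_closedBall_zero_iff.1 hx₁) fun he => ?_
    simp only [hφ, he] at hpos
    have := (hbd x₁ (hsub hx₁)).2
    linarith
  have hnhds : ∀ᶠ x in nhds x₁, x ∈ ball (0 : EuclideanSpace ℝ (Fin N)) R :=
    isOpen_ball.mem_nhds hx₁R
  have hvp : (τ / 2) ^ p ≤ v x₁ ^ p := Real.rpow_le_rpow (by positivity) (by linarith) hp.le
  have hcs : ∀ (c : ℝ) {w : EuclideanSpace ℝ (Fin N) → ℝ}, ContDiff ℝ 2 w → ContDiff ℝ 2 (c • w) :=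
    fun c w hw => contDiff_const.smul hw
  rcases hu₁.eq_or_lt with hu0 | hu0
  · have h1 : IsLocalMax ((-1 : ℝ) • u) x₁ := by
      filter_upwards [hnhds] with x hx
      have := h.u_nonneg x (hsub (ball_subset_closedBall hx))
      simp only [Pi.smul_apply, smul_eq_mul]
      linarith
    have h2 := lap_nonpos_of_isLocalMax (hcs _ h.contDiff_u) h1
    rw [lap_const_mul h.contDiff_u] at h2
    have h3 := h.lower_u x₁ (hsub hx₁)
    have h4 : 0 < C₂ * (τ / 2) ^ p := by positivity
    have h5 : C₂ * (τ / 2) ^ p ≤ C₂ * v x₁ ^ p := by gcongr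
    linarith
  · obtain ⟨s, hs⟩ : ∃ s, s = σ * u x₁ ^ (σ - 1) := ⟨_, rfl⟩
    have hsq : ContDiff ℝ 2 (fun x : EuclideanSpace ℝ (Fin N) => ∑ j, x j * x j) :=
      contDiff_sum_sq (k := 2)
    have hnorm : ∀ x : EuclideanSpace ℝ (Fin N), ‖x‖ ^ 2 = ∑ j, x j * x j := fun x => by
      rw [EuclideanSpace.real_norm_sq_eq]
      simp [sq]
    have h1 : IsLocalMax (v - (l * s) • u - η • fun x : EuclideanSpace ℝ (Fin N) =>
        ∑ j, x j * x j) x₁ := by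
      filter_upwards [hnhds] with x hx
      have h2 := hmax (ball_subset_closedBall hx)
      simp only [hφ, hnorm, mem_ofPred_eq] at h2
      have h3 := rpow_le_tangent hu0 (h.u_nonneg x (hsub (ball_subset_closedBall hx))) hσ0.le hσ1
      rw [← hs] at h3
      have h4 := mul_le_mul_of_nonneg_left h3 hl.le
      simp only [Pi.sub_apply, Pi.smul_apply, smul_eq_mul]
      linarith
    have hd1 : ContDiff ℝ 2 (v - (l * s) • u) := h.contDiff_v.sub (hcs _ h.contDiff_u)
    have h2 := lap_nonpos_of_isLocalMax (u := v - (l * s) • u - η • _) (hd1.sub (hcs η hsq)) h1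
    rw [lap_sub hd1 (hcs η hsq), lap_sub h.contDiff_v (hcs _ h.contDiff_u),
      lap_const_mul h.contDiff_u, lap_const_mul hsq, lap_sum_sq] at h2
    have h3 := h.lower_u x₁ (hsub hx₁)
    have h4 := h.upper_v x₁ (hsub hx₁)
    have hs0 : 0 < s := by rw [hs]; positivity
    have h5 : l * s * (C₂ * v x₁ ^ p) ≤ l * s * -lap u x₁ := by gcongr
    have h6 : A ≤ l * s * (C₂ * v x₁ ^ p) / 2 := by
      have h7 : M ^ (σ - 1) ≤ u x₁ ^ (σ - 1) :=
        Real.rpow_le_rpow_of_nonpos hu0 (hbd x₁ (hsub hx₁)).1 (by linarith)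
      calc A = l * (σ * M ^ (σ - 1)) * (C₂ * (τ / 2) ^ p) / 2 := by rw [hA]; ring
        _ ≤ _ := by rw [hs]; gcongr
    have h8 : C₁ * u x₁ ^ q ≤ l * s * (C₂ * v x₁ ^ p) / 2 := by
      have h9 : (l * u x₁ ^ σ) ^ p ≤ v x₁ ^ p :=
        Real.rpow_le_rpow hlu (by linarith) hp.le
      have h10 : l * s * (C₂ * (l * u x₁ ^ σ) ^ p) = l ^ (p + 1) * σ * C₂ * u x₁ ^ q := by
        rw [Real.mul_rpow hl.le (by positivity), ← Real.rpow_mul hu₁, hs, Real.rpow_add_one hl.ne',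
          ← hσp, Real.rpow_add hu0]
        ring
      have h11 : l * s * (C₂ * (l * u x₁ ^ σ) ^ p) ≤ l * s * (C₂ * v x₁ ^ p) := by gcongr
      have h12 : 2 * C₁ * u x₁ ^ q ≤ l ^ (p + 1) * σ * C₂ * u x₁ ^ q := by gcongr
      linarith
    linarith

end Comparison

section Rescaling

variable {N : ℕ} {u v : EuclideanSpace ℝ (Fin N) → ℝ}

theorem contDiff_rescale (hu : ContDiff ℝ 2 u) (A μ : ℝ) (x₀ : EuclideanSpace ℝ (Fin N)) :
    ContDiff ℝ 2 (fun x => A * u (x₀ + μ • x)) :=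
  contDiff_const.mul (hu.comp
    (by fun_prop : ContDiff ℝ 2 fun x : EuclideanSpace ℝ (Fin N) => x₀ + μ • x))

theorem fderiv_rescale {k : WithTop ℕ∞} (hu : ContDiff ℝ k u) (hk : k ≠ 0) (A μ : ℝ)
    (x₀ x : EuclideanSpace ℝ (Fin N)) :
    fderiv ℝ (fun x => A * u (x₀ + μ • x)) x = (A * μ) • fderiv ℝ u (x₀ + μ • x) := by
  have h1 : HasFDerivAt (fun x : EuclideanSpace ℝ (Fin N) => x₀ + μ • x)
      (μ • ContinuousLinearMap.id ℝ (EuclideanSpace ℝ (Fin N))) x :=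
    ((hasFDerivAt_id x).const_smul μ).const_add x₀
  have h2 : HasFDerivAt (fun x => A * u (x₀ + μ • x)) _ x :=
    ((hu.differentiable hk (x₀ + μ • x)).hasFDerivAt.comp x h1).const_mul A
  rw [h2.fderiv]
  ext y
  simp [mul_assoc]

theorem pd_rescale {k : WithTop ℕ∞} (hu : ContDiff ℝ k u) (hk : k ≠ 0) (A μ : ℝ)
    (x₀ x : EuclideanSpace ℝ (Fin N)) (i : Fin N) :
    pd i (fun x => A * u (x₀ + μ • x)) x = A * μ * pd i u (x₀ + μ • x) := by
  rw [pd, fderiv_rescale hu hk]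
  simp [pd]

theorem lap_rescale (hu : ContDiff ℝ 2 u) (A μ : ℝ) (x₀ x : EuclideanSpace ℝ (Fin N)) :
    lap (fun x => A * u (x₀ + μ • x)) x = A * μ ^ 2 * lap u (x₀ + μ • x) := by
  rw [lap_eq_sum_pd (contDiff_rescale hu A μ x₀), lap_eq_sum_pd hu, Finset.mul_sum]
  refine Finset.sum_congr rfl fun i _ => ?_
  have h1 : pd i (fun x => A * u (x₀ + μ • x)) = fun x => A * μ * pd i u (x₀ + μ • x) :=
    funext fun y => pd_rescale hu two_ne_zero A μ x₀ y i
  rw [h1, pd_rescale (pd_contDiff hu i) one_ne_zero]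
  ring

theorem rescale_rpow {α β p μ t : ℝ} (hμ : 0 < μ) (ht : 0 ≤ t) (h : α + 2 = p * β) :
    (μ ^ β * t) ^ p = μ ^ α * μ ^ 2 * t ^ p := by
  rw [Real.mul_rpow (by positivity) ht, ← Real.rpow_mul hμ.le, mul_comm β p, ← h,
    Real.rpow_add hμ, Real.rpow_two]

theorem isSol_rescale {p q C₁ C₂ ρ α β μ : ℝ} {x₀ : EuclideanSpace ℝ (Fin N)}
    (hu : ContDiff ℝ 2 u) (hv : ContDiff ℝ 2 v) (hμ : 0 < μ) (hα : α + 2 = p * β)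
    (hβ : β + 2 = q * α) (h0 : ∀ y ∈ ball x₀ (μ * ρ), 0 ≤ u y ∧ 0 ≤ v y)
    (h1 : ∀ y ∈ ball x₀ (μ * ρ), C₂ * v y ^ p ≤ -lap u y ∧ -lap u y ≤ C₁ * v y ^ p)
    (h2 : ∀ y ∈ ball x₀ (μ * ρ), C₂ * u y ^ q ≤ -lap v y ∧ -lap v y ≤ C₁ * u y ^ q) :
    IsSol p q C₁ C₂ ρ (fun x => μ ^ α * u (x₀ + μ • x)) (fun x => μ ^ β * v (x₀ + μ • x)) := by
  have hmem : ∀ {x : EuclideanSpace ℝ (Fin N)}, x ∈ ball 0 ρ → x₀ + μ • x ∈ ball x₀ (μ * ρ) := by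
    intro x hx
    rw [mem_ball_iff_norm, add_sub_cancel_left, norm_smul, Real.norm_of_nonneg hμ.le]
    exact mul_lt_mul_of_pos_left (mem_ball_zero_iff.1 hx) hμ
  have hm : ∀ a : ℝ, 0 ≤ μ ^ a * μ ^ 2 := fun a => by positivity
  refine ⟨contDiff_rescale hu _ _ _, contDiff_rescale hv _ _ _,
    fun x hx => mul_nonneg (by positivity) (h0 _ (hmem hx)).1,
    fun x hx => mul_nonneg (by positivity) (h0 _ (hmem hx)).2, fun x hx => ?_, fun x hx => ?_,
    fun x hx => ?_, fun x hx => ?_⟩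
  · rw [lap_rescale hu, rescale_rpow hμ (h0 _ (hmem hx)).2 hα]
    nlinarith [mul_le_mul_of_nonneg_left (h1 _ (hmem hx)).1 (hm α)]
  · rw [lap_rescale hv, rescale_rpow hμ (h0 _ (hmem hx)).1 hβ]
    nlinarith [mul_le_mul_of_nonneg_left (h2 _ (hmem hx)).1 (hm β)]
  · rw [lap_rescale hu, rescale_rpow hμ (h0 _ (hmem hx)).2 hα]
    nlinarith [mul_le_mul_of_nonneg_left (h1 _ (hmem hx)).2 (hm α)]
  · rw [lap_rescale hv, rescale_rpow hμ (h0 _ (hmem hx)).1 hβ]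
    nlinarith [mul_le_mul_of_nonneg_left (h2 _ (hmem hx)).2 (hm β)]

theorem lintegral_cube_smul (n : ℕ) {r R : ℝ} (hR : 0 < R) {f : (Fin n → ℝ) → ENNReal}
    (hf : Measurable f) : ∫⁻ y, f (R • y) ∂cube n r =
      ENNReal.ofReal ((R ^ n)⁻¹) * ∫⁻ y, f y ∂cube n (R * r) := by
  have hpre : (fun y : Fin n → ℝ => R • y) ⁻¹' Icc (fun _ => -(R * r)) (fun _ => R * r) =
      Icc (fun _ => -r) (fun _ => r) := by
    ext y
    simp only [mem_preimage, mem_Icc, Pi.le_def, Pi.smul_apply, smul_eq_mul]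
    refine and_congr (forall_congr' fun i => ?_) (forall_congr' fun i => ?_)
    · rw [← mul_neg, mul_le_mul_iff_right₀ hR]
    · rw [mul_le_mul_iff_right₀ hR]
  have hm : Measurable fun y : Fin n → ℝ => R • y := measurable_const_smul R
  have hmap := Measure.map_addHaar_smul (volume : Measure (Fin n → ℝ)) hR.ne'
  rw [cube_eq, cube_eq, ← hpre, ← setLIntegral_map measurableSet_Icc hf hm, hmap,
    Measure.restrict_smul, lintegral_smul_measure]
  simp [abs_of_pos hR]

theorem jetSum_le (u : EuclideanSpace ℝ (Fin N) → ℝ) (x : EuclideanSpace ℝ (Fin N)) :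
    jetSum u x ≤ |u x| + N * ‖fderiv ℝ u x‖ := by
  rw [jetSum]
  gcongr
  refine (Finset.sum_le_sum fun i _ => ?_).trans (b := ∑ _i : Fin N, ‖fderiv ℝ u x‖) (by simp)
  simpa [pd] using (fderiv ℝ u x).le_opNorm (EuclideanSpace.single i 1)

theorem norm_fderiv_le_sum (u : EuclideanSpace ℝ (Fin N) → ℝ) (x : EuclideanSpace ℝ (Fin N)) :
    ‖fderiv ℝ u x‖ ≤ ∑ i, |pd i u x| := by
  refine ContinuousLinearMap.opNorm_le_bound _ (by positivity) fun y => ?_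
  have hy : y = ∑ i, y i • EuclideanSpace.single i (1 : ℝ) := by
    ext j
    simp [Finset.sum_apply, Pi.single_apply]
  conv_lhs => rw [hy]
  rw [map_sum, Finset.sum_mul]
  refine (norm_sum_le _ _).trans (Finset.sum_le_sum fun i _ => ?_)
  rw [map_smul, norm_smul, mul_comm]
  exact mul_le_mul_of_nonneg_left (PiLp.norm_apply_le y i) (abs_nonneg _)

end Rescaling

section GradientSmallness

theorem lintegral_ball_enorm_rpow_ne_top {N : ℕ} {s : ℝ} (hs : 0 < s) (hsN : s < N) :
    ∫⁻ y in ball (0 : EuclideanSpace ℝ (Fin N)) 1, ‖y‖ₑ ^ (-s) ≠ ⊤ := by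
  have hN : (0 : ℝ) < N := hs.trans hsN
  obtain ⟨e, he⟩ : ∃ e : ℝ, e = s / N := ⟨_, rfl⟩
  have hes : -s = -e * N := by rw [he]; field_simp
  obtain ⟨D, hD⟩ := exists_singular_bound (e := e) (by rw [he]; positivity)
    (by rw [he, div_lt_one hN]; exact hsN) 1
  have h1 : ∫⁻ y in ball (0 : EuclideanSpace ℝ (Fin N)) 1, ‖y‖ₑ ^ (-s) ≤
      ∫⁻ y, ∏ i : Fin N, ‖(y : Fin N → ℝ) i‖ₑ ^ (-e) ∂cube N 1 := by
    refine (setLIntegral_le_cube (R := 1) (fun y hy i => ?_) _).trans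
      (lintegral_mono fun y => ?_)
    · exact (PiLp.norm_apply_le y i).trans (mem_ball_zero_iff.1 hy).le
    · rw [hes, ENNReal.rpow_mul, ENNReal.rpow_natCast]
      have : ∏ _i : Fin N, ‖WithLp.toLp 2 y‖ₑ ^ (-e) = (‖WithLp.toLp 2 y‖ₑ ^ (-e)) ^ N := by simp
      rw [← this]
      refine Finset.prod_le_prod' fun i _ => ?_
      rw [ENNReal.rpow_neg, ENNReal.rpow_neg, ENNReal.inv_le_inv]
      refine ENNReal.rpow_le_rpow ?_ (by rw [he]; positivity)
      exact enorm_le_iff_norm_le.2 (PiLp.norm_apply_le (WithLp.toLp 2 y) i)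
  refine ne_top_of_le_ne_top ?_ h1
  rw [lintegral_cube_prod (fun _ t => ‖t‖ₑ ^ (-e)) fun _ => by fun_prop]
  refine ne_top_of_le_ne_top (b := ∏ _i : Fin N, (D : ENNReal)) ?_
    (Finset.prod_le_prod' fun i _ => ?_)
  · simp
  · simpa using hD 0

/-- Interior gradient bound at a point for functions small together with their Laplacian. -/
theorem exists_fderiv_bound {N : ℕ} (hN : 3 ≤ N) : ∃ C : ℝ, 0 < C ∧
    ∀ (u : EuclideanSpace ℝ (Fin N) → ℝ) (δ : ℝ), ContDiff ℝ 2 u → 0 ≤ δ →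
      (∀ y ∈ ball 0 1, |u y| ≤ δ ∧ |lap u y| ≤ δ) → ‖fderiv ℝ u 0‖ ≤ C * δ := by
  obtain ⟨m, hm⟩ : ∃ m : ℝ, m = (N - 2) / 2 := ⟨_, rfl⟩
  have hN3 : (3 : ℝ) ≤ N := by exact_mod_cast hN
  have hm0 : 0 < m := by rw [hm]; linarith
  have hNm : (N : ℝ) = 2 * m + 2 := by rw [hm]; ring
  have hP := poleMass_pos hm0 hNm
  obtain ⟨I, hI⟩ : ∃ I : NNReal, (I : ENNReal) = _ := ⟨_, ENNReal.coe_toNNReal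
    (lintegral_ball_enorm_rpow_ne_top (N := N) (s := 2 * m + 1) (by linarith) (by linarith))⟩
  obtain ⟨V, hV⟩ : ∃ V : NNReal, (V : ENNReal) = _ := ⟨_, ENNReal.coe_toNNReal
    (measure_ball_lt_top (x := (0 : EuclideanSpace ℝ (Fin N))) (r := 1) (μ := volume)).ne⟩
  obtain ⟨B, hB⟩ : ∃ B : ℝ, B = 2 * m * I + 4 * bumpCoeff m * V := ⟨_, rfl⟩
  have hb := bumpCoeff_pos hm0
  have hB0 : 0 ≤ B := by rw [hB]; positivity
  refine ⟨N * (B / poleMass N m) + 1, by positivity, fun u δ hu hδ h => ?_⟩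
  have key : ∀ i, |pd i u 0| ≤ B / poleMass N m * δ := by
    intro i
    have h1 := gradient_potential_upper_bound (x := 0) hm0 hNm hu i
    have h2 : ∫⁻ y in ball (0 : EuclideanSpace ℝ (Fin N)) 1,
        ‖0 - y‖ₑ ^ (-(2 * m + 1)) * ‖lap u y‖ₑ ≤ I * ENNReal.ofReal δ := by
      rw [hI, ← lintegral_mul_const' _ _ ENNReal.ofReal_ne_top]
      refine setLIntegral_mono' measurableSet_ball fun y hy => ?_
      rw [zero_sub, enorm_neg]
      gcongr
      rw [← Real.enorm_of_nonneg hδ]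
      refine enorm_le_iff_norm_le.2 ?_
      rw [Real.norm_of_nonneg hδ]
      exact (h y hy).2
    have h3 : ∫⁻ y in ball (0 : EuclideanSpace ℝ (Fin N)) 1, ‖u y‖ₑ ≤ V * ENNReal.ofReal δ := by
      rw [hV, mul_comm, ← setLIntegral_const]
      refine setLIntegral_mono' measurableSet_ball fun y hy => ?_
      rw [← Real.enorm_of_nonneg hδ]
      refine enorm_le_iff_norm_le.2 ?_
      rw [Real.norm_of_nonneg hδ]
      exact (h y hy).1
    have h4 := h1.trans (add_le_add (mul_le_mul_right h2 _) (mul_le_mul_right h3 _))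
    have h5 := ENNReal.toReal_mono (by finiteness) h4
    rw [ENNReal.toReal_add (by finiteness) (by finiteness)] at h5
    simp only [ENNReal.toReal_mul, ENNReal.toReal_ofReal hP.le, ENNReal.toReal_ofReal hδ,
      ENNReal.toReal_ofReal (by positivity : 0 ≤ 2 * m), ENNReal.coe_toReal,
      ENNReal.toReal_ofReal (by positivity : 0 ≤ 4 * bumpCoeff m), toReal_enorm,
      Real.norm_eq_abs] at h5
    rw [div_mul_eq_mul_div, le_div_iff₀ hP, hB]
    linarith
  refine (norm_fderiv_le_sum u 0).trans ((Finset.sum_le_sum fun i _ => key i).trans ?_)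
  simp only [Finset.sum_const, Finset.card_univ, Fintype.card_fin, nsmul_eq_mul]
  nlinarith

end GradientSmallness

section Nondegeneracy

theorem exists_rpow_small (c : ℝ) {s ε : ℝ} (hs : 0 < s) (hε : 0 < ε) :
    ∃ t₀ > 0, ∀ t, 0 ≤ t → t ≤ t₀ → c * t ^ s ≤ ε := by
  refine ⟨(ε / (|c| + 1)) ^ s⁻¹, by positivity, fun t ht0 ht => ?_⟩
  have h1 : t ^ s ≤ ε / (|c| + 1) := by
    refine (Real.rpow_le_rpow ht0 ht hs.le).trans_eq ?_
    rw [← Real.rpow_mul (by positivity), inv_mul_cancel₀ hs.ne', Real.rpow_one]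
  have h2 : t ^ s * (|c| + 1) ≤ ε := (le_div_iff₀ (by positivity)).1 h1
  nlinarith [le_abs_self c, Real.rpow_nonneg ht0 s]

theorem exists_rpow_large (c : ℝ) {s : ℝ} (hs : 0 < s) : ∃ l > 0, ∀ x ≥ l, c < x ^ s := by
  obtain ⟨l, hl⟩ := eventually_atTop.1 ((tendsto_rpow_atTop hs).eventually (eventually_gt_atTop c))
  exact ⟨max l 1, by positivity, fun x hx => hl x ((le_max_left _ _).trans hx)⟩

theorem IsSol.abs_lap_u_le {N : ℕ} {p q C₁ C₂ ρ : ℝ} {u v : EuclideanSpace ℝ (Fin N) → ℝ}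
    (h : IsSol p q C₁ C₂ ρ u v) (hC₂ : 0 ≤ C₂) {x : EuclideanSpace ℝ (Fin N)}
    (hx : x ∈ ball 0 ρ) : |lap u x| ≤ C₁ * v x ^ p := by
  have h1 := mul_nonneg hC₂ (Real.rpow_nonneg (h.v_nonneg x hx) p)
  have h2 := h.lower_u x hx
  rw [abs_of_nonpos (by linarith)]
  exact h.upper_u x hx

theorem exists_nondegenerate_point {N : ℕ} (hN : 3 ≤ N) {p q C₁ C₂ A ε : ℝ} (hp : 0 < p)
    (hq : 0 < q) (hqp : q ≤ p) (hC₂ : 0 < C₂) (hA : 0 < A) (hε : 0 < ε) :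
    ∃ K, 1 ≤ K ∧ ∃ η > 0, ∀ u v : EuclideanSpace ℝ (Fin N) → ℝ, IsSol p q C₁ C₂ K u v →
      (∀ x ∈ ball 0 K, u x ≤ A ∧ v x ≤ A) →
      (ε ≤ u 0 ∨ ε ≤ v 0 ∨ ε ≤ ‖fderiv ℝ u 0‖ ∨ ε ≤ ‖fderiv ℝ v 0‖) →
      ∃ x ∈ ball (0 : EuclideanSpace ℝ (Fin N)) 1, η ≤ u x := by
  obtain ⟨C, hC0, hC⟩ := exists_fderiv_bound hN
  obtain ⟨δ, hδ0, hδε, hCδ⟩ : ∃ δ > 0, δ < ε ∧ C * δ < ε := by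
    refine ⟨ε / (2 * (C + 1)), by positivity, ?_, ?_⟩
    · rw [div_lt_iff₀ (by positivity)]; nlinarith
    · rw [mul_div_assoc', div_lt_iff₀ (by positivity)]; nlinarith
  obtain ⟨t₁, ht₁, h1⟩ := exists_rpow_small C₁ hp hδ0
  obtain ⟨t₂, ht₂, h2⟩ := exists_rpow_small C₁ hq hδ0
  obtain ⟨δ', hδ'⟩ : ∃ δ', δ' = min δ (min t₁ t₂) := ⟨_, rfl⟩
  have hδ'0 : 0 < δ' := by rw [hδ']; positivity
  have hδ'1 : δ' ≤ δ := by rw [hδ']; exact min_le_left _ _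
  have hδ'2 : δ' ≤ t₁ := by rw [hδ']; exact (min_le_right _ _).trans (min_le_left _ _)
  have hδ'3 : δ' ≤ t₂ := by rw [hδ']; exact (min_le_right _ _).trans (min_le_right _ _)
  obtain ⟨l, hl, hl2⟩ := exists_rpow_large (2 * C₁ / ((q + 1) / (p + 1) * C₂))
    (by linarith : 0 < p + 1)
  have hl3 : 2 * C₁ ≤ l ^ (p + 1) * ((q + 1) / (p + 1)) * C₂ := by
    have := (div_lt_iff₀ (by positivity)).1 (hl2 l le_rfl)
    linarith
  obtain ⟨K, hK, hcomp⟩ := exists_comparison N hp hq hqp hC₂ hA one_pos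
    (by positivity : 0 < δ' / 2) hl hl3
  obtain ⟨t₃, ht₃, h3⟩ := exists_rpow_small l (by positivity : 0 < (q + 1) / (p + 1))
    (by positivity : 0 < δ' / 2)
  refine ⟨K, hK, min δ' t₃, by positivity, fun u v hsol hb hnd => ?_⟩
  by_contra! hcon
  have hK1 : ∀ x ∈ ball (0 : EuclideanSpace ℝ (Fin N)) 1, x ∈ ball 0 K := fun x hx =>
    ball_subset_ball hK hx
  have hu : ∀ x ∈ ball (0 : EuclideanSpace ℝ (Fin N)) 1, u x ≤ δ' := fun x hx =>
    (hcon x hx).le.trans (min_le_left _ _)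
  have hv : ∀ x ∈ ball (0 : EuclideanSpace ℝ (Fin N)) 1, v x ≤ δ' := fun x hx => by
    have := hcomp u v hsol hb x hx
    have := h3 (u x) (hsol.u_nonneg x (hK1 x hx)) ((hcon x hx).le.trans (min_le_right _ _))
    linarith
  have h0 : (0 : EuclideanSpace ℝ (Fin N)) ∈ ball 0 1 := mem_ball_self one_pos
  rcases hnd with h | h | h | h
  · linarith [hu 0 h0]
  · linarith [hv 0 h0]
  · refine absurd (hC u δ hsol.contDiff_u hδ0.le fun y hy => ⟨?_, ?_⟩) (by linarith)
    · rw [abs_of_nonneg (hsol.u_nonneg y (hK1 y hy))]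
      linarith [hu y hy]
    · exact (hsol.abs_lap_u_le hC₂.le (hK1 y hy)).trans
        (h1 _ (hsol.v_nonneg y (hK1 y hy)) ((hv y hy).trans hδ'2))
  · refine absurd (hC v δ hsol.contDiff_v hδ0.le fun y hy => ⟨?_, ?_⟩) (by linarith)
    · rw [abs_of_nonneg (hsol.v_nonneg y (hK1 y hy))]
      linarith [hv y hy]
    · exact (hsol.symm.abs_lap_u_le hC₂.le (hK1 y hy)).trans
        (h2 _ (hsol.u_nonneg y (hK1 y hy)) ((hu y hy).trans hδ'3))

end Nondegeneracy

section Growth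

/-- A sequence of at most exponential growth does not grow faster at every step. -/
theorem exists_moderate_step {M c B : ℝ} (hM : 0 < M) (hc : 0 < c) (I : ℕ) : ∃ J ≥ I,
    ∀ f : ℕ → ℝ, c ≤ f I → (∀ i ≤ J, f i ≤ B * M ^ i) →
      ∃ i, I ≤ i ∧ i < J ∧ f (i + 1) ≤ 2 * M * f i := by
  obtain ⟨J, hJ⟩ := pow_unbounded_of_one_lt (B * M ^ I / c) (one_lt_two)
  refine ⟨I + J, I.le_add_right J, fun f hf hB => ?_⟩
  by_contra! hcon
  have h : ∀ j ≤ J, (2 * M) ^ j * c ≤ f (I + j) := by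
    intro j
    induction j with
    | zero => intro; simpa using hf
    | succ j ih =>
      intro hj
      have h1 := hcon (I + j) (by omega) (by omega)
      have h2 := ih (by omega)
      rw [← add_assoc, pow_succ]
      nlinarith
  have h1 := (h J le_rfl).trans (hB (I + J) le_rfl)
  rw [div_lt_iff₀ hc] at hJ
  rw [mul_pow, pow_add] at h1
  have : 0 < M ^ J := by positivity
  nlinarith

theorem exists_sublinear_bound {K M b : ℝ} (hK : 0 ≤ K) (hM : 0 ≤ M) (hb : b < 1)
    (hb0 : 0 < b) : ∃ X₀ ≥ 1, ∀ X ≥ X₀, K * (1 + M * X) ^ b < X := by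
  obtain ⟨l, hl, hl2⟩ := exists_rpow_large (K * (1 + M) ^ b) (by linarith : 0 < 1 - b)
  refine ⟨max l 1, le_max_right _ _, fun X hX => ?_⟩
  have hX1 : 1 ≤ X := (le_max_right _ _).trans hX
  have h1 : (1 + M * X) ^ b ≤ (1 + M) ^ b * X ^ b := by
    rw [← Real.mul_rpow (by positivity) (by positivity)]
    exact Real.rpow_le_rpow (by positivity) (by nlinarith) hb0.le
  have h2 := hl2 X ((le_max_left _ _).trans hX)
  have h3 : 0 < X ^ b := by positivity
  calc K * (1 + M * X) ^ b ≤ K * (1 + M) ^ b * X ^ b := by nlinarith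
    _ < X ^ (1 - b) * X ^ b := by nlinarith
    _ = X := by rw [← Real.rpow_add (by linarith)]; simp

end Growth

section CubeMass

variable {N : ℕ} {A q K : ℝ} {u : EuclideanSpace ℝ (Fin N) → ℝ}

theorem lintegral_cube_le_of_bound (hq : 0 < q) (hA : 0 < A) {R : ℝ} (hR : 0 < R) (hK : N * R < K)
    (h : ∀ x ∈ ball 0 K, |u x| ≤ A) :
    ∫⁻ y, ‖u (WithLp.toLp 2 y)‖ₑ ^ (q + 1) ∂cube N R ≤
      ENNReal.ofReal (A ^ (q + 1) * (2 * R) ^ N) := by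
  have hvol : cube N R univ = ENNReal.ofReal ((2 * R) ^ N) := by
    rw [cube_eq, Measure.restrict_apply_univ, Real.volume_Icc_pi]
    simp only [Finset.prod_const, Finset.card_univ, Fintype.card_fin, sub_neg_eq_add]
    rw [← ENNReal.ofReal_pow (by positivity), two_mul]
  have h1 : ∫⁻ y, ‖u (WithLp.toLp 2 y)‖ₑ ^ (q + 1) ∂cube N R ≤
      ∫⁻ _, ENNReal.ofReal (A ^ (q + 1)) ∂cube N R := by
    refine lintegral_mono_ae ?_
    filter_upwards [ae_cube_abs_le N R] with y hy
    have hx : WithLp.toLp 2 y ∈ ball (0 : EuclideanSpace ℝ (Fin N)) K :=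
      mem_ball_zero_iff.2 ((norm_le_of_abs_coord_le hy).trans_lt hK)
    rw [← ENNReal.ofReal_rpow_of_nonneg (by positivity) (by positivity), Real.enorm_eq_ofReal_abs]
    gcongr
    exact h _ hx
  refine h1.trans_eq ?_
  rw [lintegral_const, hvol, ← ENNReal.ofReal_mul (by positivity)]

theorem exists_cube_mass_lower_bound (N : ℕ) {A q η : ℝ} (hq : 0 < q) (hA : 0 < A) (hη : 0 < η) :
    ∃ c : ℝ, 0 < c ∧ ∀ u : EuclideanSpace ℝ (Fin N) → ℝ, ContDiff ℝ 2 u →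
      (∀ x ∈ ball 0 2, ‖fderiv ℝ u x‖ ≤ A) → (∃ x ∈ ball 0 1, η ≤ u x) →
      ENNReal.ofReal c ≤ ∫⁻ y, ‖u (WithLp.toLp 2 y)‖ₑ ^ (q + 1) ∂cube N 2 := by
  obtain ⟨r, hr⟩ : ∃ r, r = min 1 (η / (2 * A)) := ⟨_, rfl⟩
  have hr0 : 0 < r := by rw [hr]; positivity
  have hr1 : r ≤ 1 := by rw [hr]; exact min_le_left _ _
  have hr2 : A * r ≤ η / 2 := by
    have : r ≤ η / (2 * A) := by rw [hr]; exact min_le_right _ _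
    rw [le_div_iff₀ (by positivity)] at this
    linarith
  obtain ⟨V, hV⟩ : ∃ V : ℝ, V = volume.real (ball (0 : EuclideanSpace ℝ (Fin N)) r) := ⟨_, rfl⟩
  have hV0 : 0 < V := by rw [hV]; exact ENNReal.toReal_pos (measure_ball_pos _ _ hr0).ne' measure_ball_lt_top.ne
  refine ⟨(η / 2) ^ (q + 1) * V, by positivity, fun u hu hb ⟨x, hx, hux⟩ => ?_⟩
  have hsub : ∀ y ∈ ball x r, y ∈ ball (0 : EuclideanSpace ℝ (Fin N)) 2 := fun y hy => by
    rw [mem_ball_zero_iff] at hx ⊢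
    rw [mem_ball_iff_norm] at hy
    calc ‖y‖ = ‖(y - x) + x‖ := by simp
      _ ≤ ‖y - x‖ + ‖x‖ := norm_add_le _ _
      _ < 2 := by linarith
  refine le_trans ?_ (setLIntegral_le_cube (R := 2) (s := ball x r)
    (fun y hy i => (PiLp.norm_apply_le y i).trans (mem_ball_zero_iff.1 (hsub y hy)).le)
    fun y => ‖u y‖ₑ ^ (q + 1))
  have hvol : volume (ball x r) = ENNReal.ofReal V := by
    rw [hV, ofReal_measureReal measure_ball_lt_top.ne]
    exact Measure.addHaar_ball_center _ _ _
  rw [ENNReal.ofReal_mul (by positivity), ← hvol, ← setLIntegral_const]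
  refine setLIntegral_mono' measurableSet_ball fun y hy => ?_
  have h1 : ‖u y - u x‖ ≤ A * ‖y - x‖ :=
    (convex_ball (0 : EuclideanSpace ℝ (Fin N)) 2).norm_image_sub_le_of_norm_fderiv_le
      (fun z _ => hu.differentiable two_ne_zero z) hb (ball_subset_ball one_le_two hx) (hsub y hy)
  have h2 : A * ‖y - x‖ ≤ A * r :=
    mul_le_mul_of_nonneg_left (mem_ball_iff_norm.1 hy).le hA.le
  have h3 : η / 2 ≤ |u y| := by
    have := (abs_le.1 h1).1
    exact le_trans (by linarith) (le_abs_self _)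
  rw [← ENNReal.ofReal_rpow_of_nonneg (by positivity) (by positivity), Real.enorm_eq_ofReal_abs]
  gcongr

end CubeMass

section Nonexistence

theorem jet_error_rescale {N : ℕ} {α β p c A ω R : ℝ} {u v : EuclideanSpace ℝ (Fin N) → ℝ}
    (hu : ContDiff ℝ 2 u) (hv : ContDiff ℝ 2 v) (hα : α + 2 = p * β) (hA : 0 < A) (hR : 1 ≤ R)
    (x₀ x : EuclideanSpace ℝ (Fin N)) (hv0 : 0 ≤ v (x₀ + R • x)) (hvA : v (x₀ + R • x) ≤ A)
    (hdv : ‖fderiv ℝ v (x₀ + R • x)‖ ≤ A)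
    (he : |lap u (x₀ + R • x) + c * v (x₀ + R • x) ^ p| ≤ ω)
    (hω : ω * (R ^ (α + 2 + (β + 1)) * A * (N + 1)) ≤ 1) :
    |lap (fun x => R ^ α * u (x₀ + R • x)) x + c * (R ^ β * v (x₀ + R • x)) ^ p| *
      jetSum (fun x => R ^ β * v (x₀ + R • x)) x ≤ 1 := by
  have hR0 : 0 < R := by linarith
  have h1 : lap (fun x => R ^ α * u (x₀ + R • x)) x + c * (R ^ β * v (x₀ + R • x)) ^ p =
      R ^ (α + 2) * (lap u (x₀ + R • x) + c * v (x₀ + R • x) ^ p) := by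
    rw [lap_rescale hu, rescale_rpow hR0 hv0 hα, Real.rpow_add hR0, Real.rpow_two]
    ring
  have h2 : jetSum (fun x => R ^ β * v (x₀ + R • x)) x ≤ R ^ (β + 1) * A * (N + 1) := by
    refine (jetSum_le _ x).trans ?_
    rw [fderiv_rescale hv two_ne_zero, norm_smul, abs_of_nonneg (by positivity),
      Real.norm_of_nonneg (by positivity), Real.rpow_add_one hR0.ne']
    have h3 : R ^ β * v (x₀ + R • x) ≤ R ^ β * R * A := by
      rw [mul_assoc]
      gcongr
      nlinarith
    have h4 : N * (R ^ β * R * ‖fderiv ℝ v (x₀ + R • x)‖) ≤ N * (R ^ β * R * A) := by gcongr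
    linarith
  rw [h1, abs_mul, abs_of_nonneg (by positivity)]
  refine le_trans ?_ hω
  have hω0 := (abs_nonneg _).trans he
  calc _ ≤ R ^ (α + 2) * ω * (R ^ (β + 1) * A * (N + 1)) := by
        gcongr
        exact jetSum_nonneg _ _
    _ = _ := by rw [Real.rpow_add hR0 (α + 2)]; ring

theorem lintegral_cube_rescale {N : ℕ} {α q R r : ℝ} {u : EuclideanSpace ℝ (Fin N) → ℝ}
    (hu : Continuous u) (hq : 0 < q) (hR : 0 < R) :
    ∫⁻ y, ‖R ^ α * u (0 + R • WithLp.toLp 2 y)‖ₑ ^ (q + 1) ∂cube N r =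
      ENNReal.ofReal (R ^ (α * (q + 1) - N)) *
        ∫⁻ y, ‖u (WithLp.toLp 2 y)‖ₑ ^ (q + 1) ∂cube N (R * r) := by
  have h1 : ∀ y : Fin N → ℝ, ‖R ^ α * u (0 + R • WithLp.toLp 2 y)‖ₑ ^ (q + 1) =
      ENNReal.ofReal (R ^ (α * (q + 1))) * ‖u (WithLp.toLp 2 (R • y))‖ₑ ^ (q + 1) := by
    intro y
    rw [zero_add, enorm_mul, ENNReal.mul_rpow_of_nonneg _ _ (by linarith), Real.rpow_mul hR.le,
      ← ENNReal.ofReal_rpow_of_nonneg (by positivity) (by linarith),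
      Real.enorm_of_nonneg (by positivity), WithLp.toLp_smul]
  have hm : Measurable fun y : Fin N → ℝ => ‖u (WithLp.toLp 2 y)‖ₑ ^ (q + 1) := by
    have : Continuous fun y : Fin N → ℝ => u (WithLp.toLp 2 y) :=
      hu.comp (PiLp.continuous_toLp 2 _)
    exact this.measurable.enorm.pow_const _
  simp_rw [h1]
  rw [lintegral_const_mul' _ _ ENNReal.ofReal_ne_top,
    lintegral_cube_smul N hR (f := fun y => ‖u (WithLp.toLp 2 y)‖ₑ ^ (q + 1)) hm, ← mul_assoc,
    ← ENNReal.ofReal_mul (by positivity), Real.rpow_sub hR, Real.rpow_natCast, div_eq_mul_inv]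

theorem enorm_rpow_le_of_comparison {p q l R α β τ s t : ℝ} (hp : 0 < p) (hq : 0 < q) (hl : 0 < l) (hR : 0 < R)
    (hs : 0 ≤ s) (ht : 0 ≤ t) (hτ : R ^ β * τ ≤ 1 / 2)
    (hβ : β * (p + 1) = α * (q + 1)) (h : t ≤ l * s ^ ((q + 1) / (p + 1)) + τ) :
    ‖R ^ β * t‖ₑ ^ (p + 1) ≤
      (2 ^ p * l ^ (p + 1)).toNNReal * ‖R ^ α * s‖ₑ ^ (q + 1) + 1 := by
  have hp1 : p + 1 ≠ 0 := by linarith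
  have e1 : R ^ β * t ≤ R ^ β * (l * s ^ ((q + 1) / (p + 1))) + 1 / 2 := by
    have := mul_le_mul_of_nonneg_left h (by positivity : 0 ≤ R ^ β)
    linarith
  have hx : 0 ≤ R ^ β * (l * s ^ ((q + 1) / (p + 1))) := by positivity
  have e2 : (R ^ β * t) ^ (p + 1) ≤
      2 ^ p * ((R ^ β * (l * s ^ ((q + 1) / (p + 1)))) ^ (p + 1) + (1 / 2) ^ (p + 1)) := by
    refine (Real.rpow_le_rpow (by positivity) e1 (by linarith)).trans ?_
    have := NNReal.rpow_add_le_mul_rpow_add_rpow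
      ⟨R ^ β * (l * s ^ ((q + 1) / (p + 1))), hx⟩ (1 / 2) (by linarith : 1 ≤ p + 1)
    rw [add_sub_cancel_right] at this
    exact_mod_cast this
  have e3 : (2 : ℝ) ^ p * (1 / 2) ^ (p + 1) ≤ 1 := by
    rw [Real.rpow_add_one (by norm_num), ← mul_assoc, ← Real.mul_rpow (by norm_num) (by norm_num)]
    norm_num
  have e4 : (R ^ β * (l * s ^ ((q + 1) / (p + 1)))) ^ (p + 1) =
      l ^ (p + 1) * (R ^ α * s) ^ (q + 1) := by
    rw [Real.mul_rpow (by positivity) (by positivity), Real.mul_rpow hl.le (by positivity),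
      ← Real.rpow_mul hR.le, ← Real.rpow_mul hs, div_mul_cancel₀ _ hp1, hβ,
      Real.mul_rpow (by positivity) hs, ← Real.rpow_mul hR.le]
    ring
  have e5 : ∀ {x r : ℝ}, 0 ≤ x → 0 ≤ r → ‖x‖ₑ ^ r = ENNReal.ofReal (x ^ r) := fun hx hr => by
    rw [← ENNReal.ofReal_rpow_of_nonneg hx hr, Real.enorm_of_nonneg hx]
  rw [e5 (by positivity) (by linarith), e5 (by positivity) (by linarith), ← ENNReal.ofReal,
    ← ENNReal.ofReal_mul (by positivity), ← ENNReal.ofReal_one,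
    ← ENNReal.ofReal_add (by positivity) zero_le_one]
  refine ENNReal.ofReal_le_ofReal (e2.trans ?_)
  rw [mul_add, e4, ← mul_assoc]
  linarith

end Nonexistence

set_option maxHeartbeats 1600000 in
/-- Almost solutions with constant coefficients on large balls degenerate at the center. -/
theorem exists_nonexistence {n : ℕ} {p q C₁ C₂ A ε : ℝ} (hn : 2 ≤ n) (hq : 0 < q) (hqp : q ≤ p)
    (hpq : 1 < p * q) (hsub : (n : ℝ) - 1 < (n + 1) / (p + 1) + (n + 1) / (q + 1))
    (halpha : (n : ℝ) - 2 < 2 * (p + 1) / (p * q - 1)) (hC₂ : 0 < C₂)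
    (hA : 0 < A) (hε : 0 < ε) : ∃ K > 0, ∃ ω > 0,
      ∀ (u v : EuclideanSpace ℝ (Fin (n + 1)) → ℝ) (c d : ℝ), IsSol p q C₁ C₂ K u v →
        C₂ ≤ c → c ≤ C₁ → C₂ ≤ d → d ≤ C₁ →
        (∀ x ∈ ball 0 K, u x ≤ A ∧ v x ≤ A ∧ ‖fderiv ℝ u x‖ ≤ A ∧ ‖fderiv ℝ v x‖ ≤ A) →
        (∀ x ∈ ball 0 K, |lap u x + c * v x ^ p| ≤ ω ∧ |lap v x + d * u x ^ q| ≤ ω) →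
        ¬(ε ≤ u 0 ∨ ε ≤ v 0 ∨ ε ≤ ‖fderiv ℝ u 0‖ ∨ ε ≤ ‖fderiv ℝ v 0‖) := by
  have hp : 0 < p := by linarith
  have hpq0 : 0 < p * q - 1 := by linarith
  obtain ⟨α, hα⟩ : ∃ α, α = 2 * (p + 1) / (p * q - 1) := ⟨_, rfl⟩
  obtain ⟨β, hβ⟩ : ∃ β, β = 2 * (q + 1) / (p * q - 1) := ⟨_, rfl⟩
  have hα0 : 0 < α := by rw [hα]; positivity
  have hβ0 : 0 < β := by rw [hβ]; positivity
  have hαβ : α + 2 = p * β := by rw [hα, hβ]; field_simp; ring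
  have hβα : β + 2 = q * α := by
    rw [hα, hβ, div_add' _ _ _ hpq0.ne', mul_div_assoc']
    congr 1
    ring
  have hpow : β * (p + 1) = α * (q + 1) := by rw [hα, hβ]; field_simp
  obtain ⟨δ, hδ⟩ : ∃ δ, δ = α * (q + 1) - (n + 1 : ℕ) := ⟨_, rfl⟩
  have hδ0 : 0 < δ := by
    have h1 : ((n : ℝ) + 1) / (p + 1) + (n + 1) / (q + 1) =
        (n + 1) * (p + q + 2) / ((p + 1) * (q + 1)) := by field_simp; ring
    rw [h1, lt_div_iff₀ (by positivity)] at hsub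
    have h2 : ((n + 1 : ℕ) : ℝ) < α * (q + 1) := by
      rw [hα, div_mul_eq_mul_div, lt_div_iff₀ hpq0]
      push_cast
      nlinarith
    linarith
  have hN0 : (0 : ℝ) < (n + 1 : ℕ) := by positivity
  obtain ⟨l, hl, hl2⟩ := exists_rpow_large (2 * C₁ / ((q + 1) / (p + 1) * C₂))
    (by linarith : 0 < p + 1)
  have hl3 : 2 * C₁ ≤ l ^ (p + 1) * ((q + 1) / (p + 1)) * C₂ := by
    have := (div_lt_iff₀ (by positivity)).1 (hl2 l le_rfl)
    linarith
  obtain ⟨k, b, hb0, hb1, hkey⟩ := exists_key_bound hn hq hqp hpq hsub halpha hC₂ C₁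
    (2 ^ p * l ^ (p + 1)).toNNReal
  obtain ⟨K₁, hK₁, η, hη, hnd⟩ := exists_nondegenerate_point (N := n + 1) (by omega) (C₁ := C₁)
    hp hq hqp hC₂ hA hε
  obtain ⟨c₀, hc₀, hmass⟩ := exists_cube_mass_lower_bound (n + 1) hq hA hη
  obtain ⟨X₀, hX₀, hX⟩ := exists_sublinear_bound k.2 (by positivity : 0 ≤ 2 * (3 : ℝ) ^ (n + 1))
    hb1 hb0
  obtain ⟨r₀, hr₀, hr₀'⟩ := exists_rpow_large (X₀ / c₀) hδ0
  obtain ⟨I, hI⟩ := pow_unbounded_of_one_lt r₀ (by norm_num : (1 : ℝ) < 3)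
  obtain ⟨J, hIJ, hJ⟩ := exists_moderate_step (M := 3 ^ (n + 1)) (B := A ^ (q + 1) * 4 ^ (n + 1))
    (by positivity) hc₀ I
  obtain ⟨Rm, hRm⟩ : ∃ Rm : ℝ, Rm = 2 * 3 ^ J := ⟨_, rfl⟩
  have hRm0 : 0 < Rm := by rw [hRm]; positivity
  have hRm2 : 2 ≤ Rm := by
    have : (1 : ℝ) ≤ 3 ^ J := one_le_pow₀ (by norm_num)
    linarith
  obtain ⟨τ, hτ⟩ : ∃ τ, τ = (Rm ^ β)⁻¹ / 2 := ⟨_, rfl⟩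
  have hτ0 : 0 < τ := by rw [hτ]; positivity
  obtain ⟨K₂, hK₂, hcomp⟩ := exists_comparison (n + 1) hp hq hqp hC₂ hA
    (by positivity : 0 < 5 * (n + 1 : ℕ) * Rm) hτ0 hl hl3
  have hK₂2 : 10 ≤ K₂ := by
    have h1 : (1 : ℝ) ≤ (n + 1 : ℕ) := by exact_mod_cast Nat.succ_pos n
    nlinarith
  obtain ⟨ω₁, hω₁⟩ : ∃ ω₁, ω₁ = Rm ^ (α + 2 + (β + 1)) * A * ((n + 1 : ℕ) + 1) := ⟨_, rfl⟩
  obtain ⟨ω₂, hω₂⟩ : ∃ ω₂, ω₂ = Rm ^ (β + 2 + (α + 1)) * A * ((n + 1 : ℕ) + 1) := ⟨_, rfl⟩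
  have hω₁0 : 0 < ω₁ := by rw [hω₁]; positivity
  have hω₂0 : 0 < ω₂ := by rw [hω₂]; positivity
  refine ⟨max K₁ K₂, by positivity, min ω₁⁻¹ ω₂⁻¹, by positivity, ?_⟩
  intro u v c d hsol hc hc' hd hd' hbd herr hnd0
  have hKK : ∀ {ρ : ℝ} {x : EuclideanSpace ℝ (Fin (n + 1))}, ‖x‖ < ρ → ρ ≤ K₂ →
      x ∈ ball 0 (max K₁ K₂) := fun hx hρ =>
    mem_ball_zero_iff.2 (hx.trans_le (hρ.trans (le_max_right _ _)))
  obtain ⟨x₁, hx₁, hux₁⟩ := hnd u v (hsol.mono (le_max_left _ _))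
    (fun x hx => have h := hbd x (ball_subset_ball (le_max_left _ _) hx); ⟨h.1, h.2.1⟩) hnd0
  have hcomp' := hcomp u v (hsol.mono (le_max_right _ _))
    (fun x hx => have h := hbd x (ball_subset_ball (le_max_right _ _) hx); ⟨h.1, h.2.1⟩)
  have hF2 := hmass u hsol.contDiff_u
    (fun x hx => (hbd x (hKK (mem_ball_zero_iff.1 hx) (by linarith))).2.2.1) ⟨x₁, hx₁, hux₁⟩
  obtain ⟨F, hF⟩ : ∃ F : ℝ → ENNReal, F = fun R =>
    ∫⁻ y, ‖u (WithLp.toLp 2 y)‖ₑ ^ (q + 1) ∂cube (n + 1) R := ⟨_, rfl⟩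
  have hFub : ∀ i ≤ J, F (2 * 3 ^ i) ≤
      ENNReal.ofReal (A ^ (q + 1) * 4 ^ (n + 1) * (3 ^ (n + 1)) ^ i) := by
    intro i hi
    have h3 : (2 : ℝ) * 3 ^ i ≤ Rm := by
      rw [hRm]
      gcongr
      norm_num
    have h4 : ((n + 1 : ℕ) : ℝ) * (2 * 3 ^ i) < K₂ := by
      refine lt_of_lt_of_le ?_ hK₂
      nlinarith
    rw [hF]
    refine (lintegral_cube_le_of_bound (K := K₂) hq hA (by positivity) h4 fun x hx => ?_).trans_eq ?_
    · have hx' := hKK (mem_ball_zero_iff.1 hx) le_rfl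
      rw [abs_of_nonneg (hsol.u_nonneg x hx')]
      exact (hbd x hx').1
    · congr 1
      rw [← pow_mul, mul_comm (n + 1) i, pow_mul, mul_assoc, ← mul_pow]
      ring_nf
  have hFfin : ∀ i ≤ J, F (2 * 3 ^ i) = ENNReal.ofReal (F (2 * 3 ^ i)).toReal := fun i hi =>
    (ENNReal.ofReal_toReal (ne_top_of_le_ne_top ENNReal.ofReal_ne_top (hFub i hi))).symm
  have hFc : ∀ i ≤ J, c₀ ≤ (F (2 * 3 ^ i)).toReal := fun i hi => by
    rw [← ENNReal.ofReal_le_ofReal_iff ENNReal.toReal_nonneg, ← hFfin i hi]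
    refine hF2.trans ?_
    rw [hF]
    refine lintegral_mono' (cube_mono _ ?_) le_rfl
    have : (1 : ℝ) ≤ 3 ^ i := one_le_pow₀ (by norm_num)
    linarith
  obtain ⟨i, hIi, hiJ, hi⟩ := hJ (fun i => (F (2 * 3 ^ i)).toReal) (hFc I hIJ) fun i hi => by
    have := ENNReal.toReal_mono ENNReal.ofReal_ne_top (hFub i hi)
    rwa [ENNReal.toReal_ofReal (by positivity)] at this
  obtain ⟨R, hR⟩ : ∃ R : ℝ, R = 2 * 3 ^ i := ⟨_, rfl⟩
  have hR3 : R * 3 = 2 * 3 ^ (i + 1) := by rw [hR]; ring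
  have hR1 : 1 ≤ R := by
    have : (1 : ℝ) ≤ 3 ^ i := one_le_pow₀ (by norm_num)
    linarith
  have hR0 : 0 < R := by linarith
  have hRm3 : R * 3 ≤ Rm := by
    rw [hR3, hRm]
    gcongr
    · norm_num
    · omega
  have hRRm : R ≤ Rm := by linarith
  have hr₀R : r₀ ≤ R := by
    have : (3 : ℝ) ^ I ≤ 3 ^ i := pow_le_pow_right₀ (by norm_num) hIi
    rw [hR]
    linarith [pow_pos (by norm_num : (0 : ℝ) < 3) I]
  have hmem : ∀ {y : EuclideanSpace ℝ (Fin (n + 1))}, y ∈ ball 0 (R * (5 * (n + 1 : ℕ))) →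
      y ∈ ball 0 (5 * (n + 1 : ℕ) * Rm) := fun hy => by
    refine ball_subset_ball ?_ hy
    rw [mul_comm]
    gcongr
  have hmem' : ∀ {y : EuclideanSpace ℝ (Fin (n + 1))}, y ∈ ball 0 (5 * (n + 1 : ℕ) * Rm) →
      y ∈ ball 0 (max K₁ K₂) := fun hy => hKK (mem_ball_zero_iff.1 hy) hK₂
  have hcoord : ∀ {x : EuclideanSpace ℝ (Fin (n + 1))}, (∀ j, |x j| ≤ 3) →
      0 + R • x ∈ ball 0 (5 * (n + 1 : ℕ) * Rm) := fun hx => by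
    rw [zero_add, mem_ball_zero_iff, norm_smul, Real.norm_of_nonneg hR0.le]
    have := norm_le_of_abs_coord_le hx
    nlinarith
  have hk := hkey (fun x => R ^ α * u (0 + R • x)) (fun x => R ^ β * v (0 + R • x)) c d
    (isSol_rescale hsol.contDiff_u hsol.contDiff_v hR0 hαβ hβα
      (fun y hy => ⟨hsol.u_nonneg y (hmem' (hmem hy)), hsol.v_nonneg y (hmem' (hmem hy))⟩)
      (fun y hy => ⟨hsol.lower_u y (hmem' (hmem hy)), hsol.upper_u y (hmem' (hmem hy))⟩)
      (fun y hy => ⟨hsol.lower_v y (hmem' (hmem hy)), hsol.upper_v y (hmem' (hmem hy))⟩))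
    hc hc' hd hd'
    (fun x hx => by
      have hx' := hcoord hx
      refine enorm_rpow_le_of_comparison hp hq hl hR0 (hsol.u_nonneg _ (hmem' hx'))
        (hsol.v_nonneg _ (hmem' hx')) ?_ hpow (hcomp' _ hx')
      have h1 : R ^ β ≤ Rm ^ β := Real.rpow_le_rpow hR0.le hRRm hβ0.le
      have h2 : Rm ^ β * τ = 1 / 2 := by
        rw [hτ]
        field_simp
      nlinarith)
    (fun x hx => by
      have hx' := hmem' (hcoord fun j => (hx j).trans (by norm_num))
      obtain ⟨b1, b2, b3, b4⟩ := hbd _ hx'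
      obtain ⟨e1, e2⟩ := herr _ hx'
      refine ⟨jet_error_rescale hsol.contDiff_u hsol.contDiff_v hαβ hA hR1 0 x
        (hsol.v_nonneg _ hx') b2 b4 (e1.trans (min_le_left _ _)) ?_,
        jet_error_rescale hsol.contDiff_v hsol.contDiff_u hβα hA hR1 0 x
        (hsol.u_nonneg _ hx') b1 b3 (e2.trans (min_le_right _ _)) ?_⟩
      · rw [inv_mul_le_iff₀ hω₁0, mul_one, hω₁]
        gcongr
      · rw [inv_mul_le_iff₀ hω₂0, mul_one, hω₂]
        gcongr)
  rw [lintegral_cube_rescale hsol.contDiff_u.continuous hq hR0,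
    lintegral_cube_rescale hsol.contDiff_u.continuous hq hR0, ← hδ, mul_one, hR3] at hk
  have hF1 : ∫⁻ y, ‖u (WithLp.toLp 2 y)‖ₑ ^ (q + 1) ∂cube (n + 1) R =
      ENNReal.ofReal (F (2 * 3 ^ i)).toReal := by rw [← hFfin i hiJ.le, hF, hR]
  have hF3 : ∫⁻ y, ‖u (WithLp.toLp 2 y)‖ₑ ^ (q + 1) ∂cube (n + 1) (2 * 3 ^ (i + 1)) =
      ENNReal.ofReal (F (2 * 3 ^ (i + 1))).toReal := by rw [← hFfin (i + 1) hiJ, hF]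
  have hg : 0 < R ^ δ := by positivity
  rw [hF1, hF3, ← ENNReal.ofReal_mul hg.le, ← ENNReal.ofReal_mul hg.le, ← ENNReal.ofReal_one,
    ← ENNReal.ofReal_add zero_le_one (by positivity),
    ENNReal.ofReal_rpow_of_nonneg (by positivity) hb0.le, ← ENNReal.ofReal_coe_nnreal,
    ← ENNReal.ofReal_mul k.coe_nonneg, ENNReal.ofReal_le_ofReal_iff (by positivity)] at hk
  have hX1 : X₀ ≤ R ^ δ * (F (2 * 3 ^ i)).toReal := by
    have h1 := (div_lt_iff₀ hc₀).1 (hr₀' R hr₀R)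
    nlinarith [hFc i hiJ.le]
  refine absurd (hX _ hX1) (not_lt.2 (hk.trans ?_))
  refine mul_le_mul_of_nonneg_left (Real.rpow_le_rpow (by positivity) ?_ hb0.le) k.coe_nonneg
  nlinarith

section JetSize

variable {N : ℕ}

/-- Scale invariant size of the jets of a pair of functions. -/
noncomputable def jetSize (α β : ℝ) (u v : EuclideanSpace ℝ (Fin N) → ℝ)
    (x : EuclideanSpace ℝ (Fin N)) : ℝ :=
  u x ^ (1 / α) + v x ^ (1 / β) + ‖fderiv ℝ u x‖ ^ (1 / (α + 1)) + ‖fderiv ℝ v x‖ ^ (1 / (β + 1))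

theorem continuous_jetSize {α β : ℝ} {u v : EuclideanSpace ℝ (Fin N) → ℝ} (hα : 0 < α)
    (hβ : 0 < β) (hu : ContDiff ℝ 2 u) (hv : ContDiff ℝ 2 v) :
    Continuous (jetSize α β u v) := by
  have h1 := hu.continuous.rpow_const (p := 1 / α) fun _ => .inr (by positivity)
  have h2 := hv.continuous.rpow_const (p := 1 / β) fun _ => .inr (by positivity)
  have h3 := (hu.continuous_fderiv two_ne_zero).norm.rpow_const (p := 1 / (α + 1))
    fun _ => .inr (by positivity)
  have h4 := (hv.continuous_fderiv two_ne_zero).norm.rpow_const (p := 1 / (β + 1))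
    fun _ => .inr (by positivity)
  exact ((h1.add h2).add h3).add h4

theorem inv_rpow_mul_le {a t M k : ℝ} (ha : 0 < a) (hM : 0 < M) (ht : 0 ≤ t)
    (hk : 0 < k) (h : t ^ (1 / a) ≤ k * M) : M⁻¹ ^ a * t ≤ k ^ a := by
  have h1 : t ≤ (k * M) ^ a := by
    rw [one_div] at h
    exact (Real.rpow_inv_le_iff_of_pos ht (by positivity) ha).1 h
  calc M⁻¹ ^ a * t ≤ M⁻¹ ^ a * (k * M) ^ a := by gcongr
    _ = k ^ a := by
      rw [← Real.mul_rpow (by positivity) (by positivity)]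
      congr 1
      field_simp

theorem le_inv_rpow_mul {a t M k : ℝ} (ha : 0 < a) (hM : 0 < M) (ht : 0 ≤ t)
    (hk : 0 < k) (h : k * M ≤ t ^ (1 / a)) : k ^ a ≤ M⁻¹ ^ a * t := by
  have h1 : (k * M) ^ a ≤ t := by
    rw [one_div] at h
    exact (Real.le_rpow_inv_iff_of_pos (by positivity) ht ha).1 h
  calc k ^ a = M⁻¹ ^ a * (k * M) ^ a := by
        rw [← Real.mul_rpow (by positivity) (by positivity)]
        congr 1
        field_simp
    _ ≤ M⁻¹ ^ a * t := by gcongr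

end JetSize

set_option maxHeartbeats 1600000 in
/-- Interior estimate for solutions defined on the whole space, by the doubling argument. -/
theorem exists_jetSize_bound {n : ℕ} {p q C₁ C₂ γ α β : ℝ} (hn : 2 ≤ n) (hq : 0 < q) (hqp : q ≤ p)
    (hpq : 1 < p * q) (hsub : (n : ℝ) - 1 < (n + 1) / (p + 1) + (n + 1) / (q + 1))
    (halpha : (n : ℝ) - 2 < 2 * (p + 1) / (p * q - 1)) (hC₂ : 0 < C₂) (hC₁ : 0 < C₁) (hγ : 0 < γ)
    (hα0 : 0 < α) (hβ0 : 0 < β) (hα : α + 2 = p * β) (hβ : β + 2 = q * α) : ∃ S > 0,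
      ∀ (u v c d : EuclideanSpace ℝ (Fin (n + 1)) → ℝ) (r : ℝ), 0 < r → r ≤ 1 →
        ContDiff ℝ 2 u → ContDiff ℝ 2 v →
        (∀ x ∈ ball 0 r, 0 ≤ u x ∧ 0 ≤ v x) →
        (∀ x ∈ ball 0 r, C₂ ≤ c x ∧ c x ≤ C₁ ∧ C₂ ≤ d x ∧ d x ≤ C₁) →
        (∀ x ∈ ball 0 r, ∀ y ∈ ball 0 r, |c x - c y| ≤ C₁ * ‖x - y‖ ^ γ ∧
          |d x - d y| ≤ C₁ * ‖x - y‖ ^ γ) →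
        (∀ x ∈ ball 0 r, -lap u x = c x * v x ^ p ∧ -lap v x = d x * u x ^ q) →
        ∀ x ∈ ball 0 r, jetSize α β u v x * (r - ‖x‖) ≤ S := by
  have hp : 0 < p := by linarith
  obtain ⟨A, hA⟩ : ∃ A : ℝ, A = 2 ^ (α + β + 1) := ⟨_, rfl⟩
  obtain ⟨ε, hε⟩ : ∃ ε : ℝ, ε = (1 / 4) ^ (α + β + 1) := ⟨_, rfl⟩
  have hA0 : 0 < A := by rw [hA]; positivity
  have hε0 : 0 < ε := by rw [hε]; positivity
  have hAle : ∀ a ≤ α + β + 1, (2 : ℝ) ^ a ≤ A := fun a ha => by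
    rw [hA]
    exact Real.rpow_le_rpow_of_exponent_le one_le_two ha
  have hεle : ∀ a ≤ α + β + 1, ε ≤ (1 / 4 : ℝ) ^ a := fun a ha => by
    rw [hε]
    exact Real.rpow_le_rpow_of_exponent_ge (by norm_num) (by norm_num) ha
  obtain ⟨K, hK, ω, hω, hnon⟩ := exists_nonexistence (C₁ := C₁) hn hq hqp hpq hsub halpha hC₂
    hA0 hε0
  obtain ⟨t₁, ht₁, h1⟩ := exists_rpow_small (C₁ * A ^ p) hγ hω
  obtain ⟨t₂, ht₂, h2⟩ := exists_rpow_small (C₁ * A ^ q) hγ hω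
  obtain ⟨S, hS⟩ : ∃ S, S = max (2 * K) (max (K / t₁) (K / t₂)) := ⟨_, rfl⟩
  have hS0 : 2 * K ≤ S := by rw [hS]; exact le_max_left _ _
  have hS1 : K / t₁ ≤ S := by rw [hS]; exact (le_max_left _ _).trans (le_max_right _ _)
  have hS2 : K / t₂ ≤ S := by rw [hS]; exact (le_max_right _ _).trans (le_max_right _ _)
  rw [div_le_iff₀ ht₁] at hS1
  rw [div_le_iff₀ ht₂] at hS2
  have hSpos : 0 < S := by linarith
  refine ⟨S, hSpos, ?_⟩
  intro u v c d r hr hr1 hu hv h0 hc hosc heq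
  have hcont : Continuous fun y => jetSize α β u v y * (r - ‖y‖) :=
    (continuous_jetSize hα0 hβ0 hu hv).mul (continuous_const.sub continuous_norm)
  obtain ⟨y₀, hy₀, hmax⟩ := (isCompact_closedBall (0 : EuclideanSpace ℝ (Fin (n + 1))) r).exists_isMaxOn
    ⟨0, mem_closedBall_self hr.le⟩ hcont.continuousOn
  by_contra! hcon
  obtain ⟨x, hx, hxS⟩ := hcon
  have hy₀S : S < jetSize α β u v y₀ * (r - ‖y₀‖) := hxS.trans_le (hmax (ball_subset_closedBall hx))
  obtain ⟨M, hM⟩ : ∃ M, M = jetSize α β u v y₀ := ⟨_, rfl⟩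
  obtain ⟨D, hD⟩ : ∃ D, D = r - ‖y₀‖ := ⟨_, rfl⟩
  rw [← hM, ← hD] at hy₀S
  have hD0 : 0 < D := by
    have h3 : 0 ≤ D := by rw [hD]; linarith [mem_closedBall_zero_iff.1 hy₀]
    refine h3.lt_of_ne' fun h => ?_
    rw [h, mul_zero] at hy₀S
    linarith
  have hD1 : D ≤ 1 := by rw [hD]; linarith [norm_nonneg y₀]
  have hM0 : 0 < M := by
    by_contra! h
    nlinarith
  have hMS : S < M := by nlinarith
  have hKM : M⁻¹ * K ≤ D / 2 := by
    rw [inv_mul_le_iff₀ hM0]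
    linarith
  have hmem : ∀ y ∈ ball y₀ (M⁻¹ * K), y ∈ ball (0 : EuclideanSpace ℝ (Fin (n + 1))) r ∧
      jetSize α β u v y ≤ 2 * M := by
    intro y hy
    rw [mem_ball_iff_norm] at hy
    have h3 : ‖y‖ ≤ ‖y - y₀‖ + ‖y₀‖ := by simpa using norm_add_le (y - y₀) y₀
    have h4 : D / 2 ≤ r - ‖y‖ := by linarith
    have h5 : y ∈ ball (0 : EuclideanSpace ℝ (Fin (n + 1))) r :=
      mem_ball_zero_iff.2 (by linarith)
    refine ⟨h5, ?_⟩
    have h6 : jetSize α β u v y * (r - ‖y‖) ≤ M * D := by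
      rw [hM, hD]
      exact hmax (ball_subset_closedBall h5)
    by_contra! h7
    nlinarith
  have hres : ∀ x ∈ ball (0 : EuclideanSpace ℝ (Fin (n + 1))) K,
      y₀ + M⁻¹ • x ∈ ball y₀ (M⁻¹ * K) := fun x hx => by
    rw [mem_ball_iff_norm, add_sub_cancel_left, norm_smul, Real.norm_of_nonneg (by positivity)]
    exact mul_lt_mul_of_pos_left (mem_ball_zero_iff.1 hx) (by positivity)
  have hy₀r : y₀ ∈ ball (0 : EuclideanSpace ℝ (Fin (n + 1))) r :=
    mem_ball_zero_iff.2 (by linarith)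
  have hbd : ∀ x ∈ ball (0 : EuclideanSpace ℝ (Fin (n + 1))) K,
      M⁻¹ ^ α * u (y₀ + M⁻¹ • x) ≤ A ∧ M⁻¹ ^ β * v (y₀ + M⁻¹ • x) ≤ A ∧
      ‖fderiv ℝ (fun x => M⁻¹ ^ α * u (y₀ + M⁻¹ • x)) x‖ ≤ A ∧
      ‖fderiv ℝ (fun x => M⁻¹ ^ β * v (y₀ + M⁻¹ • x)) x‖ ≤ A := by
    intro x hx
    obtain ⟨h3, h4⟩ := hmem _ (hres x hx)
    rw [jetSize] at h4
    have g1 := Real.rpow_nonneg (h0 _ h3).1 (1 / α)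
    have g2 := Real.rpow_nonneg (h0 _ h3).2 (1 / β)
    have g3 := Real.rpow_nonneg (norm_nonneg (fderiv ℝ u (y₀ + M⁻¹ • x))) (1 / (α + 1))
    have g4 := Real.rpow_nonneg (norm_nonneg (fderiv ℝ v (y₀ + M⁻¹ • x))) (1 / (β + 1))
    rw [fderiv_rescale hu two_ne_zero, fderiv_rescale hv two_ne_zero, norm_smul, norm_smul,
      Real.norm_of_nonneg (by positivity), Real.norm_of_nonneg (by positivity),
      ← Real.rpow_add_one (by positivity), ← Real.rpow_add_one (by positivity)]
    exact ⟨(inv_rpow_mul_le hα0 hM0 (h0 _ h3).1 two_pos (by linarith)).trans (hAle _ (by linarith)),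
      (inv_rpow_mul_le hβ0 hM0 (h0 _ h3).2 two_pos (by linarith)).trans (hAle _ (by linarith)),
      (inv_rpow_mul_le (by linarith) hM0 (norm_nonneg _) two_pos (by linarith)).trans
        (hAle _ (by linarith)),
      (inv_rpow_mul_le (by linarith) hM0 (norm_nonneg _) two_pos (by linarith)).trans
        (hAle _ (by linarith))⟩
  have hdist : ∀ x ∈ ball (0 : EuclideanSpace ℝ (Fin (n + 1))) K,
      ‖y₀ - (y₀ + M⁻¹ • x)‖ ≤ M⁻¹ * K := fun x hx => by
    rw [norm_sub_rev]
    exact (mem_ball_iff_norm.1 (hres x hx)).le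
  refine hnon (fun x => M⁻¹ ^ α * u (y₀ + M⁻¹ • x)) (fun x => M⁻¹ ^ β * v (y₀ + M⁻¹ • x))
    (c y₀) (d y₀) (isSol_rescale hu hv (by positivity) hα hβ
      (fun y hy => h0 y (hmem y hy).1) (fun y hy => ?_) (fun y hy => ?_))
    (hc _ hy₀r).1 (hc _ hy₀r).2.1 (hc _ hy₀r).2.2.1 (hc _ hy₀r).2.2.2 hbd (fun x hx => ?_) ?_
  · have hy' := (hmem y hy).1
    have := Real.rpow_nonneg (h0 y hy').2 p
    rw [(heq y hy').1]
    exact ⟨mul_le_mul_of_nonneg_right (hc y hy').1 this,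
      mul_le_mul_of_nonneg_right (hc y hy').2.1 this⟩
  · have hy' := (hmem y hy).1
    have := Real.rpow_nonneg (h0 y hy').1 q
    rw [(heq y hy').2]
    exact ⟨mul_le_mul_of_nonneg_right (hc y hy').2.2.1 this,
      mul_le_mul_of_nonneg_right (hc y hy').2.2.2 this⟩
  · have hy' := (hmem _ (hres x hx)).1
    have hd' := hdist x hx
    have hb := hbd x hx
    have hm : 0 ≤ M⁻¹ * K := by positivity
    have q1 := (hosc _ hy₀r _ hy').1
    have q2 := (hosc _ hy₀r _ hy').2
    have p1 : ‖y₀ - (y₀ + M⁻¹ • x)‖ ^ γ ≤ (M⁻¹ * K) ^ γ :=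
      Real.rpow_le_rpow (norm_nonneg _) hd' hγ.le
    have z1 := h1 (M⁻¹ * K) hm (by rw [inv_mul_le_iff₀ hM0]; nlinarith)
    have z2 := h2 (M⁻¹ * K) hm (by rw [inv_mul_le_iff₀ hM0]; nlinarith)
    have l1 : lap u (y₀ + M⁻¹ • x) = -(c (y₀ + M⁻¹ • x) * v (y₀ + M⁻¹ • x) ^ p) := by
      linarith [(heq _ hy').1]
    have l2 : lap v (y₀ + M⁻¹ • x) = -(d (y₀ + M⁻¹ • x) * u (y₀ + M⁻¹ • x) ^ q) := by
      linarith [(heq _ hy').2]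
    have w1 : 0 ≤ M⁻¹ ^ α * u (y₀ + M⁻¹ • x) := mul_nonneg (by positivity) (h0 _ hy').1
    have w2 : 0 ≤ M⁻¹ ^ β * v (y₀ + M⁻¹ • x) := mul_nonneg (by positivity) (h0 _ hy').2
    constructor
    · have e1 : lap (fun x => M⁻¹ ^ α * u (y₀ + M⁻¹ • x)) x +
          c y₀ * (M⁻¹ ^ β * v (y₀ + M⁻¹ • x)) ^ p =
          (c y₀ - c (y₀ + M⁻¹ • x)) * (M⁻¹ ^ β * v (y₀ + M⁻¹ • x)) ^ p := by
        rw [lap_rescale hu, l1, rescale_rpow (by positivity) (h0 _ hy').2 hα]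
        ring
      rw [e1, abs_mul, abs_of_nonneg (Real.rpow_nonneg w2 p)]
      calc _ ≤ C₁ * (M⁻¹ * K) ^ γ * A ^ p := by
            gcongr
            · exact q1.trans (by gcongr)
            · exact hb.2.1
        _ ≤ ω := by linarith
    · have e1 : lap (fun x => M⁻¹ ^ β * v (y₀ + M⁻¹ • x)) x +
          d y₀ * (M⁻¹ ^ α * u (y₀ + M⁻¹ • x)) ^ q =
          (d y₀ - d (y₀ + M⁻¹ • x)) * (M⁻¹ ^ α * u (y₀ + M⁻¹ • x)) ^ q := by
        rw [lap_rescale hv, l2, rescale_rpow (by positivity) (h0 _ hy').1 hβ]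
        ring
      rw [e1, abs_mul, abs_of_nonneg (Real.rpow_nonneg w1 q)]
      calc _ ≤ C₁ * (M⁻¹ * K) ^ γ * A ^ q := by
            gcongr
            · exact q2.trans (by gcongr)
            · exact hb.1
        _ ≤ ω := by linarith
  · rw [fderiv_rescale hu two_ne_zero, fderiv_rescale hv two_ne_zero, norm_smul, norm_smul,
      Real.norm_of_nonneg (by positivity), Real.norm_of_nonneg (by positivity),
      ← Real.rpow_add_one (by positivity), ← Real.rpow_add_one (by positivity), smul_zero, add_zero]
    rw [jetSize] at hM
    have hsplit : 1 / 4 * M ≤ u y₀ ^ (1 / α) ∨ 1 / 4 * M ≤ v y₀ ^ (1 / β) ∨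
        1 / 4 * M ≤ ‖fderiv ℝ u y₀‖ ^ (1 / (α + 1)) ∨
        1 / 4 * M ≤ ‖fderiv ℝ v y₀‖ ^ (1 / (β + 1)) := by
      by_contra! h
      linarith
    have hq4 : (0 : ℝ) < 1 / 4 := by norm_num
    rcases hsplit with h | h | h | h
    · exact .inl ((hεle _ (by linarith)).trans (le_inv_rpow_mul hα0 hM0 (h0 _ hy₀r).1 hq4 h))
    · exact .inr (.inl ((hεle _ (by linarith)).trans
        (le_inv_rpow_mul hβ0 hM0 (h0 _ hy₀r).2 hq4 h)))
    · exact .inr (.inr (.inl ((hεle _ (by linarith)).trans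
        (le_inv_rpow_mul (by linarith) hM0 (norm_nonneg _) hq4 h))))
    · exact .inr (.inr (.inr ((hεle _ (by linarith)).trans
        (le_inv_rpow_mul (by linarith) hM0 (norm_nonneg _) hq4 h))))

open scoped Topology in
theorem exists_contDiff_extension {N : ℕ} {u : EuclideanSpace ℝ (Fin N) → ℝ} {r : ℝ} (hr : 0 < r)
    (hr1 : r < 1) (hu : ContDiffOn ℝ 2 u (ball 0 1)) : ∃ w : EuclideanSpace ℝ (Fin N) → ℝ,
      ContDiff ℝ 2 w ∧ ∀ x ∈ ball 0 r, w =ᶠ[𝓝 x] u := by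
  obtain ⟨χ, hin, hout⟩ : ∃ χ : ContDiffBump (0 : EuclideanSpace ℝ (Fin N)),
      χ.rIn = r ∧ χ.rOut < 1 :=
    ⟨⟨r, (r + 1) / 2, hr, by linarith⟩, rfl, by simp only; linarith⟩
  refine ⟨fun x => χ x * u x, contDiff_iff_contDiffAt.2 fun x => ?_, fun x hx => ?_⟩
  · by_cases hx : x ∈ ball (0 : EuclideanSpace ℝ (Fin N)) 1
    · exact χ.contDiffAt.mul (hu.contDiffAt (isOpen_ball.mem_nhds hx))
    · have h : x ∈ (closedBall (0 : EuclideanSpace ℝ (Fin N)) χ.rOut)ᶜ := by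
        rw [mem_ball_zero_iff, not_lt] at hx
        rw [mem_compl_iff, mem_closedBall_zero_iff, not_le]
        linarith
      refine contDiffAt_const (c := (0 : ℝ)) |>.congr_of_eventuallyEq ?_
      filter_upwards [isClosed_closedBall.isOpen_compl.mem_nhds h] with y hy
      rw [mem_compl_iff, mem_closedBall, not_le] at hy
      rw [χ.zero_of_le_dist hy.le, zero_mul]
  · filter_upwards [isOpen_ball.mem_nhds hx] with y hy
    rw [χ.one_of_mem_closedBall (by rw [hin]; exact ball_subset_closedBall hy), one_mul]

open scoped Topology in
theorem lap_congr {N : ℕ} {u w : EuclideanSpace ℝ (Fin N) → ℝ} {x : EuclideanSpace ℝ (Fin N)}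
    (h : w =ᶠ[𝓝 x] u) : lap w x = lap u x := by
  rw [lap, lap, (h.iteratedFDeriv ℝ 2).eq_of_nhds]

theorem norm_gradient_eq {N : ℕ} (u : EuclideanSpace ℝ (Fin N) → ℝ)
    (x : EuclideanSpace ℝ (Fin N)) : ‖gradient u x‖ = ‖fderiv ℝ u x‖ :=
  LinearIsometryEquiv.norm_map _ _

/-- Lemma 4.1: universal interior estimates for nonnegative solutions of the system
`-Δu = c(x) v^p`, `-Δv = d(x) u^q` on the unit ball, with Hölder coefficients bounded
and bounded away from zero. Here `α = 2(p+1)/(pq-1)` and `β = 2(q+1)/(pq-1)`. -/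
theorem universal_interior_estimate
    (N : ℕ) (hN : 3 ≤ N) (p q : ℝ) (hq : 0 < q) (hqp : q ≤ p) (hpq : 1 < p * q)
    (hhyper : (N : ℝ) / (p + 1) + (N : ℝ) / (q + 1) > (N : ℝ) - 2)
    (halpha : 2 * (p + 1) / (p * q - 1) > (N : ℝ) - 3)
    (γ : ℝ) (hγ0 : 0 < γ) (hγ1 : γ ≤ 1) (C₁ C₂ : ℝ) (hC₁ : 0 < C₁) (hC₂ : 0 < C₂) :
    ∃ C > 0, ∀ c d u v : EuclideanSpace ℝ (Fin N) → ℝ,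
      (∀ x ∈ closedBall (0 : EuclideanSpace ℝ (Fin N)) 1, |c x| ≤ C₁) →
      (∀ x ∈ closedBall (0 : EuclideanSpace ℝ (Fin N)) 1,
        ∀ y ∈ closedBall (0 : EuclideanSpace ℝ (Fin N)) 1, |c x - c y| ≤ C₁ * ‖x - y‖ ^ γ) →
      (∀ x ∈ closedBall (0 : EuclideanSpace ℝ (Fin N)) 1, |d x| ≤ C₁) →
      (∀ x ∈ closedBall (0 : EuclideanSpace ℝ (Fin N)) 1,
        ∀ y ∈ closedBall (0 : EuclideanSpace ℝ (Fin N)) 1, |d x - d y| ≤ C₁ * ‖x - y‖ ^ γ) →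
      (∀ x ∈ closedBall (0 : EuclideanSpace ℝ (Fin N)) 1, C₂ ≤ c x) →
      (∀ x ∈ closedBall (0 : EuclideanSpace ℝ (Fin N)) 1, C₂ ≤ d x) →
      ContDiffOn ℝ 2 u (ball (0 : EuclideanSpace ℝ (Fin N)) 1) →
      ContDiffOn ℝ 2 v (ball (0 : EuclideanSpace ℝ (Fin N)) 1) →
      (∀ x ∈ ball (0 : EuclideanSpace ℝ (Fin N)) 1, 0 ≤ u x) →
      (∀ x ∈ ball (0 : EuclideanSpace ℝ (Fin N)) 1, 0 ≤ v x) →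
      (∀ x ∈ ball (0 : EuclideanSpace ℝ (Fin N)) 1, -lap u x = c x * v x ^ p) →
      (∀ x ∈ ball (0 : EuclideanSpace ℝ (Fin N)) 1, -lap v x = d x * u x ^ q) →
      ∀ x ∈ ball (0 : EuclideanSpace ℝ (Fin N)) 1,
        u x ^ (1 / (2 * (p + 1) / (p * q - 1)))
          + v x ^ (1 / (2 * (q + 1) / (p * q - 1)))
          + ‖gradient u x‖ ^ (1 / (2 * (p + 1) / (p * q - 1) + 1))
          + ‖gradient v x‖ ^ (1 / (2 * (q + 1) / (p * q - 1) + 1))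
        ≤ C * (1 + (1 - ‖x‖)⁻¹) := by
  obtain ⟨n, rfl⟩ : ∃ n, N = n + 1 := ⟨N - 1, by omega⟩
  have hp : 0 < p := by linarith
  have hpq0 : 0 < p * q - 1 := by linarith
  obtain ⟨α, hα⟩ : ∃ α, α = 2 * (p + 1) / (p * q - 1) := ⟨_, rfl⟩
  obtain ⟨β, hβ⟩ : ∃ β, β = 2 * (q + 1) / (p * q - 1) := ⟨_, rfl⟩
  push_cast at hhyper halpha
  obtain ⟨S, hS, hbound⟩ := exists_jetSize_bound (n := n) (C₁ := C₁) (C₂ := C₂) (α := α) (β := β)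
    (by omega) hq hqp hpq (by linarith) (by linarith) hC₂ hC₁ hγ0 (by rw [hα]; positivity)
    (by rw [hβ]; positivity)
    (by rw [hα, hβ, div_add' _ _ _ hpq0.ne', mul_div_assoc']; congr 1; ring)
    (by rw [hα, hβ, div_add' _ _ _ hpq0.ne', mul_div_assoc']; congr 1; ring)
  refine ⟨S, hS, ?_⟩
  rw [← hα, ← hβ]
  intro c d u v hc1 hc2 hd1 hd2 hc3 hd3 hu hv hu0 hv0 hequ heqv x hx
  rw [norm_gradient_eq, norm_gradient_eq, ← jetSize]
  rw [mem_ball_zero_iff] at hx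
  have key : ∀ r, ‖x‖ < r → r < 1 → jetSize α β u v x * (r - ‖x‖) ≤ S := by
    intro r hxr hr1
    have hr0 : 0 < r := (norm_nonneg x).trans_lt hxr
    obtain ⟨U, hU, hUu⟩ := exists_contDiff_extension hr0 hr1 hu
    obtain ⟨V, hV, hVv⟩ := exists_contDiff_extension hr0 hr1 hv
    have hsub := ball_subset_ball (x := (0 : EuclideanSpace ℝ (Fin (n + 1)))) hr1.le
    have hsub' : ball (0 : EuclideanSpace ℝ (Fin (n + 1))) r ⊆ closedBall 0 1 :=
      hsub.trans ball_subset_closedBall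
    have hxr' : x ∈ ball 0 r := mem_ball_zero_iff.2 hxr
    have h := hbound U V c d r hr0 hr1.le hU hV
      (fun y hy => by
        rw [(hUu y hy).eq_of_nhds, (hVv y hy).eq_of_nhds]
        exact ⟨hu0 y (hsub hy), hv0 y (hsub hy)⟩)
      (fun y hy => ⟨hc3 y (hsub' hy), (le_abs_self _).trans (hc1 y (hsub' hy)),
        hd3 y (hsub' hy), (le_abs_self _).trans (hd1 y (hsub' hy))⟩)
      (fun y hy z hz => ⟨hc2 y (hsub' hy) z (hsub' hz), hd2 y (hsub' hy) z (hsub' hz)⟩)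
      (fun y hy => by
        rw [lap_congr (hUu y hy), lap_congr (hVv y hy), (hUu y hy).eq_of_nhds,
          (hVv y hy).eq_of_nhds]
        exact ⟨hequ y (hsub hy), heqv y (hsub hy)⟩) x hxr'
    rwa [jetSize, (hUu x hxr').eq_of_nhds, (hVv x hxr').eq_of_nhds, (hUu x hxr').fderiv_eq,
      (hVv x hxr').fderiv_eq, ← jetSize] at h
  have hlim : jetSize α β u v x * (1 - ‖x‖) ≤ S := by
    by_contra! hcon
    have hJ : 0 < jetSize α β u v x := by
      by_contra! h
      nlinarith
    obtain ⟨r, hr⟩ : ∃ r, r = max ((1 + ‖x‖) / 2)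
        ((S / jetSize α β u v x + ‖x‖ + 1) / 2) := ⟨_, rfl⟩
    have h1 : S / jetSize α β u v x < 1 - ‖x‖ := by
      rw [div_lt_iff₀ hJ]
      linarith
    have h2 : (S / jetSize α β u v x + ‖x‖ + 1) / 2 ≤ r := by rw [hr]; exact le_max_right _ _
    have h3 := key r (by rw [hr]; exact lt_max_of_lt_left (by linarith))
      (by rw [hr]; exact max_lt (by linarith) (by linarith))
    have h4 : S / jetSize α β u v x < r - ‖x‖ := by linarith
    rw [div_lt_iff₀ hJ] at h4
    linarith
  have hx1 : 0 < 1 - ‖x‖ := by linarith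
  have h5 := (le_div_iff₀ hx1).2 hlim
  rw [div_eq_mul_inv] at h5
  linarith
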